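/- Fix a real number σ with 1 < σ < n−2. Let h be a trace-free symmetric two-tensor on ℝ^n_+ which is smooth and compactly supported, and let V be a smooth vector field on ℝ^n_+ such that: (a) Σ_{k=1}^n ∂_k [ u^{2n/(n−2)} ( h_{ik} − ∂_i V_k − ∂_k V_i + (2/n)(div V) δ_{ik} ) ] = 0 on ℝ^n_+ for all i; (b) V_n(x) = 0 and ∂_n V_i(x) = h_{in}(x) for all x ∈ ∂ℝ^n_+ and i ∈ {1,…,n−1}; (c) ∫_{ℝ^n_+} (1+|x|²)^{−n−2} |V(x)|² dx < ∞ and ∫_{ℝ^n_+} (1+|x|²)^{−n} |∂V(x)|² dx < ∞; (d) sup_{r ≥ 1} r^{−2σ−n−2} ∫_{(B_{2r}(0) \ B_r(0)) ∩ ℝ^n_+} |V(x)|² dx < ∞. Then there exists a constant C, depending only on n and σ, such that sup_{r ≥ 1} r^{−2σ−n−2} ∫_{(B_{2r}(0) \ B_r(0)) ∩ ℝ^n_+} |V(x)|² dx ≤ C ∫_{ℝ^n_+} (1+|x|²)^{−n−2} |V(x)|² dx + C sup_{r ≥ 1} r^{−2σ−n} ∫_{(B_{2r}(0) \ B_r(0))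 ∩ ℝ^n_+} |h(x)|² dx. -/

import Mathlib

noncomputable section

open MeasureTheory Metric

/-- Euclidean space `ℝ^n`. -/
abbrev Euc (n : ℕ) := EuclideanSpace ℝ (Fin n)

/-- Partial derivative in the `i`-th coordinate direction. -/
def pd {n : ℕ} (i : Fin n) (f : Euc n → ℝ) : Euc n → ℝ :=
  fun x => fderiv ℝ f x (EuclideanSpace.single i 1)

/-- Kronecker delta. -/
def kd {n : ℕ} (i k : Fin n) : ℝ := if i = k then 1 else 0

/-- `u(x) = (1/(1+|x|²))^{(n-2)/2}`. -/
def u0 (n : ℕ) : Euc n → ℝ :=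
  fun x => (1 / (1 + ‖x‖ ^ 2)) ^ (((n : ℝ) - 2) / 2)

section Part1

section calcs
variable {n : ℕ}

lemma pd_add {f g : Euc n → ℝ} {x : Euc n} (i : Fin n) (hf : DifferentiableAt ℝ f x)
    (hg : DifferentiableAt ℝ g x) : pd i (fun y => f y + g y) x = pd i f x + pd i g x := by
  simp [pd, fderiv_fun_add hf hg]

lemma pd_sub {f g : Euc n → ℝ} {x : Euc n} (i : Fin n) (hf : DifferentiableAt ℝ f x)
    (hg : DifferentiableAt ℝ g x) : pd i (fun y => f y - g y) x = pd i f x - pd i g x := by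
  simp [pd, fderiv_fun_sub hf hg]

lemma pd_mul {f g : Euc n → ℝ} {x : Euc n} (i : Fin n) (hf : DifferentiableAt ℝ f x)
    (hg : DifferentiableAt ℝ g x) :
    pd i (fun y => f y * g y) x = pd i f x * g x + f x * pd i g x := by
  simp [pd, fderiv_fun_mul hf hg]; ring

lemma pd_sum {ι : Type*} {s : Finset ι} {f : ι → Euc n → ℝ} {x : Euc n} (i : Fin n)
    (hf : ∀ a ∈ s, DifferentiableAt ℝ (f a) x) :
    pd i (fun y => ∑ a ∈ s, f a y) x = ∑ a ∈ s, pd i (f a) x := by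
  simp [pd, fderiv_fun_sum hf]

lemma pd_const (i : Fin n) (c : ℝ) (x : Euc n) : pd i (fun _ => c) x = 0 := by
  simp [pd]

lemma pd_const_mul {f : Euc n → ℝ} {x : Euc n} (i : Fin n) (c : ℝ) (hf : DifferentiableAt ℝ f x) :
    pd i (fun y => c * f y) x = c * pd i f x := by
  simp [pd, fderiv_const_mul hf]

lemma pd_coord (i k : Fin n) (x : Euc n) : pd k (fun y : Euc n => y i) x = kd i k := by
  have h : HasFDerivAt (fun y : Euc n => y i) (EuclideanSpace.proj i : Euc n →L[ℝ] ℝ) x :=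
    (EuclideanSpace.proj i : Euc n →L[ℝ] ℝ).hasFDerivAt
  simp [pd, h.fderiv, kd]

lemma pd_normsq (k : Fin n) (x : Euc n) : pd k (fun y : Euc n => ‖y‖ ^ 2) x = 2 * x k := by
  have h : HasFDerivAt (fun y : Euc n => ‖y‖ ^ 2) _ x := (hasStrictFDerivAt_norm_sq x).hasFDerivAt
  simp [pd, h.fderiv, EuclideanSpace.inner_single_right]

lemma pd_comp {f : Euc n → ℝ} {x : Euc n} {g : ℝ → ℝ} {g' : ℝ} (i : Fin n)
    (hg : HasDerivAt g g' (f x)) (hf : DifferentiableAt ℝ f x) :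
    pd i (fun y => g (f y)) x = g' * pd i f x := by
  have := (hg.comp_hasFDerivAt x hf.hasFDerivAt).fderiv
  simp only [pd]
  rw [show (fun y => g (f y)) = g ∘ f from rfl, this]; simp

lemma vec_eq_sum (v : Euc n) : v = ∑ l, v l • EuclideanSpace.single l (1 : ℝ) := by
  ext i
  simp [Pi.single_apply]

lemma fderiv_eq_sum (f : Euc n → ℝ) (x v : Euc n) : fderiv ℝ f x v = ∑ l, pd l f x * v l := by
  conv_lhs => rw [vec_eq_sum v]
  simp [pd, mul_comm]

lemma pd_comp_vec {f : Euc n → ℝ} {J : Euc n → Euc n} {x : Euc n} (k : Fin n)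
    (hf : DifferentiableAt ℝ f (J x)) (hJ : DifferentiableAt ℝ J x) :
    pd k (fun y => f (J y)) x = ∑ l, pd l f (J x) * pd k (fun y => J y l) x := by
  have h1 := (hf.hasFDerivAt.comp x hJ.hasFDerivAt).fderiv
  simp only [pd]
  rw [show (fun y => f (J y)) = f ∘ J from rfl, h1]
  simp only [ContinuousLinearMap.comp_apply]
  rw [fderiv_eq_sum]
  refine Finset.sum_congr rfl fun l _ => ?_
  have h2 : HasFDerivAt (fun y => J y l)
      ((EuclideanSpace.proj l : Euc n →L[ℝ] ℝ).comp (fderiv ℝ J x)) x :=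
    ((EuclideanSpace.proj l : Euc n →L[ℝ] ℝ).hasFDerivAt).comp x hJ.hasFDerivAt
  rw [h2.fderiv]; simp [pd]

lemma pd_shift (f : Euc n → ℝ) (z x : Euc n) (k : Fin n) :
    pd k (fun y => f (y - z)) x = pd k f (x - z) := by
  simp only [pd]; rw [fderiv_comp_sub]

lemma pd_scale (f : Euc n → ℝ) (a : ℝ) (x : Euc n) (k : Fin n) :
    pd k (fun y => f (a • y)) x = a * pd k f (a • x) := by
  simp only [pd]; rw [fderiv_comp_smul]; simp

lemma pd_congr {f g : Euc n → ℝ} {x : Euc n} (h : f =ᶠ[nhds x] g) (k : Fin n) :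
    pd k f x = pd k g x := by
  simp only [pd]; rw [h.fderiv_eq]

lemma ContDiffAt.pd' {f : Euc n → ℝ} {x : Euc n} (hf : ContDiffAt ℝ (⊤ : ℕ∞) f x) (k : Fin n) :
    ContDiffAt ℝ (⊤ : ℕ∞) (pd k f) x := by
  have := hf.fderiv_right (m := (⊤ : ℕ∞)) (by simp)
  exact this.clm_apply contDiffAt_const

lemma ContDiff.pd' {f : Euc n → ℝ} (hf : ContDiff ℝ (⊤ : ℕ∞) f) (k : Fin n) :
    ContDiff ℝ (⊤ : ℕ∞) (pd k f) :=
  contDiff_iff_contDiffAt.2 fun _ => hf.contDiffAt.pd' k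

lemma cdDiff {f : Euc n → ℝ} (hf : ContDiff ℝ (⊤ : ℕ∞) f) (x : Euc n) : DifferentiableAt ℝ f x :=
  hf.contDiffAt.differentiableAt (by simp)

lemma cdaDiff {f : Euc n → ℝ} {x : Euc n} (hf : ContDiffAt ℝ (⊤ : ℕ∞) f x) :
    DifferentiableAt ℝ f x := hf.differentiableAt (by simp)

lemma tsupport_pd (f : Euc n → ℝ) (k : Fin n) : tsupport (pd k f) ⊆ tsupport f := by
  refine (closure_mono ?_).trans (tsupport_fderiv_subset ℝ (f := f))
  intro x hx
  simp only [Function.mem_support, pd] at hx ⊢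
  intro h; apply hx; rw [h]; simp

lemma pd_hcs {f : Euc n → ℝ} (hf : HasCompactSupport f) (k : Fin n) : HasCompactSupport (pd k f) :=
  hf.mono' (subset_closure.trans (tsupport_pd f k))

lemma cd_coord (i : Fin n) : ContDiff ℝ (⊤ : ℕ∞) (fun y : Euc n => y i) :=
  (EuclideanSpace.proj i : Euc n →L[ℝ] ℝ).contDiff

lemma normsq_eq (x : Euc n) : ‖x‖ ^ 2 = ∑ i, x i ^ 2 := EuclideanSpace.real_norm_sq_eq x

lemma abs_coord_le (x : Euc n) (i : Fin n) : |x i| ≤ ‖x‖ := by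
  have := PiLp.norm_apply_le x i
  simpa using this

lemma kd_symm (i k : Fin n) : kd i k = kd k i := by simp [kd, eq_comm]

lemma cd_normsq : ContDiff ℝ (⊤ : ℕ∞) (fun y : Euc n => ‖y‖ ^ 2) := contDiff_norm_sq ℝ

lemma null_bdry (l : Fin n) : volume {x : Euc n | x l = 0} = 0 := by
  have h := Measure.addHaar_submodule (volume : Measure (Euc n))
    (LinearMap.ker (EuclideanSpace.proj l : Euc n →L[ℝ] ℝ).toLinearMap) (by
      intro h
      have : EuclideanSpace.single l (1 : ℝ) ∈
        LinearMap.ker (EuclideanSpace.proj l : Euc n →L[ℝ] ℝ).toLinearMap := by rw [h]; trivial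
      simp at this)
  rw [← h]; congr 1

lemma meas_half (l : Fin n) : MeasurableSet {x : Euc n | 0 ≤ x l} :=
  measurableSet_le measurable_const (cd_coord l).continuous.measurable

/-- smooth times compactly supported off zero -/
lemma cd_mul_off {A B : Euc n → ℝ} (hA : ∀ x, x ≠ 0 → ContDiffAt ℝ (⊤ : ℕ∞) A x)
    (hB : ContDiff ℝ (⊤ : ℕ∞) B) (h0 : (0 : Euc n) ∉ tsupport B) :
    ContDiff ℝ (⊤ : ℕ∞) (fun x => A x * B x) := by
  rw [contDiff_iff_contDiffAt]
  intro x
  by_cases hx : x = 0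
  · have : (fun y => A y * B y) =ᶠ[nhds x] fun _ => 0 := by
      have h1 := notMem_tsupport_iff_eventuallyEq.1 (hx ▸ h0)
      filter_upwards [h1] with y hy
      simp [hy]
    exact (contDiffAt_const (c := (0:ℝ))).congr_of_eventuallyEq this
  · exact (hA x hx).mul hB.contDiffAt

end calcs

end Part1

section Part2

lemma st_deriv_zero {t : ℝ} (h : t < 0 ∨ 1 < t) : deriv Real.smoothTransition t = 0 := by
  rcases h with h | h
  · have : Real.smoothTransition =ᶠ[nhds t] fun _ => 0 := by
      filter_upwards [Iio_mem_nhds h] with s hs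
      exact Real.smoothTransition.zero_of_nonpos (le_of_lt hs)
    rw [this.deriv_eq]; simp
  · have : Real.smoothTransition =ᶠ[nhds t] fun _ => 1 := by
      filter_upwards [Ioi_mem_nhds h] with s hs
      exact Real.smoothTransition.one_of_one_le (le_of_lt hs)
    rw [this.deriv_eq]; simp

lemma st_deriv_bound : ∃ B : ℝ, 0 ≤ B ∧ ∀ t, |t * deriv Real.smoothTransition t| ≤ B := by
  have hc : Continuous (deriv Real.smoothTransition) :=
    (Real.smoothTransition.contDiff (n := 1)).continuous_deriv le_rfl
  obtain ⟨B, hB⟩ := (isCompact_Icc (a := (0:ℝ)) (b := 1)).exists_bound_of_continuousOn hc.continuousOn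
  refine ⟨B, (norm_nonneg _).trans (hB 0 (by simp)), fun t => ?_⟩
  by_cases h : t ∈ Set.Icc (0:ℝ) 1
  · have := hB t h
    rw [abs_mul]
    rw [Real.norm_eq_abs] at this
    have h1 : |t| ≤ 1 := abs_le.2 ⟨by linarith [h.1], h.2⟩
    nlinarith [abs_nonneg t, abs_nonneg (deriv Real.smoothTransition t)]
  · rw [st_deriv_zero]
    · simpa using (norm_nonneg _).trans (hB 0 (by simp))
    · by_contra hh; push Not at hh; exact h hh

variable {n : ℕ}

lemma lip_bdry (l : Fin n) (F : Euc n → ℝ) (hF : ContDiff ℝ 1 F) (hc : HasCompactSupport F)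
    (h0 : ∀ x, x l = 0 → F x = 0) : ∃ C : ℝ, 0 ≤ C ∧ ∀ x, |F x| ≤ C * |x l| := by
  obtain ⟨C, hC⟩ := ContDiff.lipschitzWith_of_hasCompactSupport hc hF (by simp)
  refine ⟨C, C.2, fun x => ?_⟩
  have h1 : F (x - x l • EuclideanSpace.single l (1:ℝ)) = 0 := h0 _ (by simp)
  have h2 := hC.dist_le_mul x (x - x l • EuclideanSpace.single l (1:ℝ))
  rw [h1] at h2
  simpa [dist_eq_norm, norm_smul] using h2

lemma hcs_int {f : Euc n → ℝ} (hf : Continuous f) (hc : HasCompactSupport f) : Integrable f :=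
  hf.integrable_of_hasCompactSupport hc

def thet (l : Fin n) (m : ℕ) (x : Euc n) : ℝ := Real.smoothTransition ((m : ℝ) * x l)

lemma thet_cd (l : Fin n) (m : ℕ) : ContDiff ℝ 1 (thet l m) :=
  Real.smoothTransition.contDiff.comp (contDiff_const.mul ((cd_coord l).of_le (by simp)))

lemma thet_pd (l k : Fin n) (m : ℕ) (x : Euc n) :
    pd k (thet l m) x = deriv Real.smoothTransition ((m : ℝ) * x l) * ((m : ℝ) * kd l k) := by
  have h := pd_comp (g := Real.smoothTransition) (f := fun y : Euc n => (m:ℝ) * y l) (x := x) k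
    ((Real.smoothTransition.contDiff (n := 1)).differentiable (by simp) _).hasDerivAt
    ((cdDiff (cd_coord l) x).const_mul _)
  rw [pd_const_mul k _ (cdDiff (cd_coord l) x), pd_coord] at h
  exact h

theorem div_half (l : Fin n) (F : Fin n → Euc n → ℝ) (hF : ∀ k, ContDiff ℝ 1 (F k))
    (hc : ∀ k, HasCompactSupport (F k)) (h0 : ∀ x, x l = 0 → F l x = 0) :
    ∫ x in {x : Euc n | 0 ≤ x l}, ∑ k, pd k (F k) x = 0 := by
  have cpd : ∀ k, Continuous (pd k (F k)) := fun k =>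
    ((hF k).continuous_fderiv (by simp)).clm_apply continuous_const
  have ipd : ∀ k, Integrable (pd k (F k)) := fun k => hcs_int (cpd k) (pd_hcs (hc k) k)
  -- identity for each m
  have key : ∀ m : ℕ, ∫ x, thet l m x * ∑ k, pd k (F k) x
      = - ∫ x, deriv Real.smoothTransition ((m : ℝ) * x l) * (m : ℝ) * F l x := by
    intro m
    have cth := (thet_cd l m).continuous
    have h1 : ∀ k, ∫ x, thet l m x * pd k (F k) x = - ∫ x, pd k (thet l m) x * F k x := by
      intro k
      apply integral_mul_fderiv_eq_neg_fderiv_mul_of_integrable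
      · refine hcs_int (Continuous.mul ?_ (hF k).continuous) (hc k).mul_left
        exact ((thet_cd l m).continuous_fderiv (by simp)).clm_apply continuous_const
      · exact hcs_int (cth.mul (cpd k)) (pd_hcs (hc k) k).mul_left
      · exact hcs_int (cth.mul (hF k).continuous) (hc k).mul_left
      · intro x _; exact (thet_cd l m).differentiable (by simp) x
      · intro x _; exact (hF k).differentiable (by simp) x
    have h2 : (fun x => thet l m x * ∑ k, pd k (F k) x)
        = fun x => ∑ k, thet l m x * pd k (F k) x := by
      ext x; rw [Finset.mul_sum]
    have h3 : ∀ k ∈ Finset.univ, Integrable (fun x => thet l m x * pd k (F k) x) := fun k _ =>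
      hcs_int (cth.mul (cpd k)) (pd_hcs (hc k) k).mul_left
    rw [h2, integral_finsetSum _ h3]
    simp_rw [h1, thet_pd]
    rw [Finset.sum_eq_single l]
    · simp [kd]
    · intro k _ hk; simp [kd, Ne.symm hk]
    · simp
  obtain ⟨B, hB0, hB⟩ := st_deriv_bound
  obtain ⟨C, hC0, hC⟩ := lip_bdry l (F l) (hF l) (hc l) h0
  -- right side tends to zero
  have R : Filter.Tendsto (fun m : ℕ => ∫ x, deriv Real.smoothTransition ((m : ℝ) * x l) * (m : ℝ) * F l x)
      Filter.atTop (nhds (∫ x : Euc n, (0:ℝ))) := by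
    apply tendsto_integral_of_dominated_convergence
      (fun x => (tsupport (F l)).indicator (fun _ => B * C) x)
    · intro m
      apply Continuous.aestronglyMeasurable
      have : Continuous (deriv Real.smoothTransition) :=
        (Real.smoothTransition.contDiff (n := 1)).continuous_deriv le_rfl
      have h3 := (hF l).continuous
      have h4 := (cd_coord (n := n) l).continuous
      fun_prop
    · rw [integrable_indicator_iff (isClosed_tsupport _).measurableSet]
      exact integrableOn_const ((hc l).isCompact.measure_lt_top.ne)
    · intro m
      refine Filter.Eventually.of_forall fun x => ?_
      by_cases hx : x ∈ tsupport (F l)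
      · rw [Set.indicator_of_mem hx, Real.norm_eq_abs, abs_mul, abs_mul]
        calc |deriv Real.smoothTransition (↑m * x l)| * |(m:ℝ)| * |F l x|
            ≤ |deriv Real.smoothTransition (↑m * x l)| * |(m:ℝ)| * (C * |x l|) := by
              gcongr; exact hC x
          _ = |(m * x l) * deriv Real.smoothTransition (↑m * x l)| * C := by
              rw [abs_mul, abs_mul]; ring
          _ ≤ B * C := by gcongr; exact hB _
      · rw [Set.indicator_of_notMem hx, image_eq_zero_of_notMem_tsupport hx]; simp
    · refine Filter.Eventually.of_forall fun x => ?_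
      rcases lt_trichotomy (x l) 0 with hx | hx | hx
      · apply tendsto_const_nhds.congr'
        filter_upwards [Filter.eventually_gt_atTop 0] with m hm
        rw [st_deriv_zero (Or.inl (mul_neg_of_pos_of_neg (by exact_mod_cast hm) hx))]; simp
      · simp [h0 x hx]
      · apply tendsto_const_nhds.congr'
        obtain ⟨M, hM⟩ := exists_nat_gt (1 / x l)
        filter_upwards [Filter.eventually_ge_atTop M] with m hm
        rw [st_deriv_zero (Or.inr ?_)]
        · simp
        · rw [div_lt_iff₀ hx] at hM
          have : (M:ℝ) ≤ m := by exact_mod_cast hm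
          nlinarith
  have L : Filter.Tendsto (fun m : ℕ => ∫ x, thet l m x * ∑ k, pd k (F k) x) Filter.atTop
      (nhds (∫ x, {x : Euc n | 0 < x l}.indicator (fun x => ∑ k, pd k (F k) x) x)) := by
    apply tendsto_integral_of_dominated_convergence (fun x => |∑ k, pd k (F k) x|)
    · intro m
      exact ((thet_cd l m).continuous.mul (continuous_finsetSum _ fun k _ => cpd k)).aestronglyMeasurable
    · exact (integrable_finsetSum _ fun k _ => ipd k).abs
    · intro m
      refine Filter.Eventually.of_forall fun x => ?_
      rw [norm_mul, Real.norm_eq_abs, Real.norm_eq_abs]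
      have h1 : |thet l m x| ≤ 1 := abs_le.2 ⟨le_trans (by norm_num) (Real.smoothTransition.nonneg ((m:ℝ) * x l)),
        Real.smoothTransition.le_one _⟩
      exact mul_le_of_le_one_left (abs_nonneg _) h1
    · refine Filter.Eventually.of_forall fun x => ?_
      rcases le_or_gt (x l) 0 with hx | hx
      · rw [Set.indicator_of_notMem (by simpa using hx)]
        apply tendsto_const_nhds.congr'
        refine Filter.Eventually.of_forall fun m => ?_
        simp only [thet]
        rw [Real.smoothTransition.zero_of_nonpos (mul_nonpos_of_nonneg_of_nonpos (by positivity) hx)]; simp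
      · rw [Set.indicator_of_mem (by simpa using hx)]
        apply tendsto_const_nhds.congr'
        obtain ⟨M, hM⟩ := exists_nat_gt (1 / x l)
        filter_upwards [Filter.eventually_ge_atTop M] with m hm
        simp only [thet]
        rw [Real.smoothTransition.one_of_one_le]
        · simp
        · rw [div_lt_iff₀ hx] at hM
          have : (M:ℝ) ≤ m := by exact_mod_cast hm
          nlinarith
  have hm : MeasurableSet {x : Euc n | 0 < x l} :=
    measurableSet_lt measurable_const (cd_coord l).continuous.measurable
  rw [integral_indicator hm] at L
  simp_rw [key] at L
  have e := tendsto_nhds_unique L R.neg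
  simp only [integral_zero, neg_zero] at e
  refine Eq.trans ?_ e
  apply setIntegral_congr_set
  have : ∀ᵐ x : Euc n, ¬ (x l = 0) := by
    rw [ae_iff]; simpa using null_bdry l
  filter_upwards [this] with x hx
  apply propext
  exact ⟨fun h => lt_of_le_of_ne h (Ne.symm hx), fun h => le_of_lt h⟩

end Part2

section Part3

variable {n : ℕ}

def Wt (n : ℕ) (x : Euc n) : ℝ := ((1 + ‖x‖ ^ 2) ^ n)⁻¹

def Lop (Y : Fin n → Euc n → ℝ) (i k : Fin n) (x : Euc n) : ℝ :=
  pd i (Y k) x + pd k (Y i) x - (2 / (n : ℝ)) * (∑ m, pd m (Y m) x) * kd i k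

lemma Wt_pos (x : Euc n) : 0 < Wt n x := by unfold Wt; positivity

lemma Wt_cd : ContDiff ℝ (⊤ : ℕ∞) (Wt n) := by
  unfold Wt
  exact ((contDiff_const.add cd_normsq).pow n).inv (fun x => by positivity)

lemma u0_pow (hn : 4 ≤ n) (x : Euc n) :
    u0 n x ^ (2 * (n : ℝ) / ((n : ℝ) - 2)) = Wt n x := by
  have h4 : (4:ℝ) ≤ n := by exact_mod_cast hn
  unfold u0 Wt
  rw [← Real.rpow_mul (by positivity)]
  rw [show ((n : ℝ) - 2) / 2 * (2 * (n : ℝ) / ((n : ℝ) - 2)) = n by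
    have : (n:ℝ) - 2 ≠ 0 := by linarith
    field_simp]
  rw [Real.rpow_natCast, one_div, inv_pow]

lemma Lop_symm (Y : Fin n → Euc n → ℝ) (i k : Fin n) (x : Euc n) : Lop Y i k x = Lop Y k i x := by
  unfold Lop; rw [kd_symm i k]; ring

lemma Lop_trace (hn : 0 < n) (Y : Fin n → Euc n → ℝ) (x : Euc n) : ∑ i, Lop Y i i x = 0 := by
  have : (n:ℝ) ≠ 0 := by positivity
  simp only [Lop, Finset.sum_sub_distrib, Finset.sum_add_distrib, kd, if_true, mul_one,
    Finset.sum_const, Finset.card_univ, Fintype.card_fin, nsmul_eq_mul]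
  field_simp; ring

lemma sum_kd (A : Fin n → Fin n → ℝ) (i : Fin n) : ∑ k, A i k * kd i k = A i i := by
  simp [kd]

lemma sym_tr (A : Fin n → Fin n → ℝ) (hA : ∀ i k, A i k = A k i) (ht : ∑ i, A i i = 0)
    (X : Fin n → Euc n → ℝ) (x : Euc n) :
    ∑ i, ∑ k, A i k * Lop X i k x = 2 * ∑ i, ∑ k, A i k * pd k (X i) x := by
  have h1 : ∑ i, ∑ k, A i k * pd i (X k) x = ∑ i, ∑ k, A i k * pd k (X i) x := by
    rw [Finset.sum_comm]
    refine Finset.sum_congr rfl fun i _ => Finset.sum_congr rfl fun k _ => ?_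
    rw [hA]
  have h2 : ∀ c : ℝ, ∑ i, ∑ k, A i k * (c * kd i k) = 0 := by
    intro c
    have : ∀ i, ∑ k, A i k * (c * kd i k) = c * A i i := by
      intro i
      rw [← sum_kd A i, Finset.mul_sum]
      exact Finset.sum_congr rfl fun k _ => by ring
    simp_rw [this]
    rw [← Finset.mul_sum, ht, mul_zero]
  simp only [Lop, mul_sub, mul_add, Finset.sum_sub_distrib, Finset.sum_add_distrib]
  rw [h1, h2]; ring

lemma Lop_cd {Y : Fin n → Euc n → ℝ} {x : Euc n} (hY : ∀ i, ContDiffAt ℝ (⊤ : ℕ∞) (Y i) x)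
    (i k : Fin n) : ContDiffAt ℝ (⊤ : ℕ∞) (Lop Y i k) x := by
  unfold Lop
  exact (((hY k).pd' i).add ((hY i).pd' k)).sub
    ((contDiffAt_const.mul (ContDiffAt.sum fun m _ => (hY m).pd' m)).mul contDiffAt_const)

lemma Lop_cd' {Y : Fin n → Euc n → ℝ} (hY : ∀ i, ContDiff ℝ (⊤ : ℕ∞) (Y i))
    (i k : Fin n) : ContDiff ℝ (⊤ : ℕ∞) (Lop Y i k) :=
  contDiff_iff_contDiffAt.2 fun _ => Lop_cd (fun i => (hY i).contDiffAt) i k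

lemma pd_tang {f : Euc n → ℝ} (l i : Fin n) (hil : i ≠ l) (hf : ∀ x, x l = 0 → f x = 0)
    (x : Euc n) (hx : x l = 0) (hd : DifferentiableAt ℝ f x) : pd i f x = 0 := by
  have h1 : HasLineDerivAt ℝ f (fderiv ℝ f x (EuclideanSpace.single i 1)) x
    (EuclideanSpace.single i 1) := hd.hasFDerivAt.hasLineDerivAt _
  have h2 : (fun t : ℝ => f (x + t • EuclideanSpace.single i (1:ℝ))) = fun _ => 0 := by
    ext t; apply hf; simp [hx, hil.symm]
  unfold HasLineDerivAt at h1
  rw [h2] at h1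
  exact h1.unique (hasDerivAt_const _ _)

lemma hcs_sum (f : Fin n → Euc n → ℝ) (hf : ∀ i, HasCompactSupport (f i)) :
    HasCompactSupport (fun x => ∑ i, f i x) := by
  have : HasCompactSupport (∑ i, f i) := by
    classical
    refine Finset.induction_on (Finset.univ : Finset (Fin n)) ?_ ?_
    · simpa using (HasCompactSupport.zero (α := Euc n) (β := ℝ))
    · intro a s ha ih
      rw [Finset.sum_insert ha]
      exact (hf a).add ih
  convert this using 1
  ext x; simp

theorem weakX (hn : 4 ≤ n) (l : Fin n) (h : Fin n → Fin n → Euc n → ℝ)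
    (hh : ∀ i k, ContDiff ℝ (⊤ : ℕ∞) (h i k)) (hs : ∀ i k x, h i k x = h k i x)
    (ht : ∀ x, ∑ i, h i i x = 0)
    (V : Fin n → Euc n → ℝ) (hV : ∀ i, ContDiff ℝ (⊤ : ℕ∞) (V i))
    (he : ∀ x : Euc n, 0 ≤ x l → ∀ i,
          ∑ k, pd k (fun y => u0 n y ^ (2 * (n : ℝ) / ((n : ℝ) - 2))
            * (h i k y - pd i (V k) y - pd k (V i) y
                + (2 / (n : ℝ)) * (∑ m, pd m (V m) y) * kd i k)) x = 0)
    (hb : ∀ x : Euc n, x l = 0 → V l x = 0 ∧ ∀ i, i ≠ l → pd l (V i) x = h i l x)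
    (X : Fin n → Euc n → ℝ) (hX : ∀ i, ContDiff ℝ (⊤ : ℕ∞) (X i))
    (hXc : ∀ i, HasCompactSupport (X i)) (hX0 : ∀ x, x l = 0 → X l x = 0) :
    ∫ x in {x : Euc n | 0 ≤ x l}, Wt n x * ∑ i, ∑ k, (h i k x - Lop V i k x) * Lop X i k x = 0 := by
  set T : Fin n → Fin n → Euc n → ℝ := fun i k x => Wt n x * (h i k x - Lop V i k x) with hT
  have Tcd : ∀ i k, ContDiff ℝ (⊤ : ℕ∞) (T i k) := fun i k =>
    Wt_cd.mul ((hh i k).sub (Lop_cd' hV i k))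
  have Tdiv : ∀ x : Euc n, 0 ≤ x l → ∀ i, ∑ k, pd k (T i k) x = 0 := by
    intro x hx i
    rw [← he x hx i]
    refine Finset.sum_congr rfl fun k _ => ?_
    congr 1; ext y
    rw [u0_pow hn, hT]; simp only [Lop]; ring
  have D := div_half l (fun k x => ∑ i, T i k x * X i x)
    (fun k => ContDiff.sum fun i _ => ((Tcd i k).mul (hX i)).of_le (by simp))
    (fun k => by
      exact hcs_sum _ fun i => (hXc i).mul_left)
    (fun x hx => by
      refine Finset.sum_eq_zero fun i _ => ?_
      by_cases hi : i = l
      · subst hi; rw [hX0 x hx, mul_zero]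
      · have h1 := (hb x hx).2 i hi
        have h2 : pd i (V l) x = 0 :=
          pd_tang l i hi (fun y hy => (hb y hy).1) x hx (cdDiff (hV l) x)
        simp [hT, Lop, h1, h2, kd, hi])
  have e : ∀ x ∈ {x : Euc n | 0 ≤ x l},
      Wt n x * ∑ i, ∑ k, (h i k x - Lop V i k x) * Lop X i k x
        = 2 * ∑ k, pd k (fun x => ∑ i, T i k x * X i x) x := by
    intro x hx
    rw [sym_tr (fun i k => h i k x - Lop V i k x) (fun i k => by rw [hs, Lop_symm])
      (by rw [Finset.sum_sub_distrib, ht, Lop_trace (by omega)]; simp)]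
    have e1 : ∀ k, pd k (fun x => ∑ i, T i k x * X i x) x
        = ∑ i, (pd k (T i k) x * X i x + T i k x * pd k (X i) x) := by
      intro k
      rw [pd_sum (f := fun i y => T i k y * X i y) k
        (fun i _ => (cdDiff (Tcd i k) x).mul (cdDiff (hX i) x))]
      exact Finset.sum_congr rfl fun i _ => pd_mul k (cdDiff (Tcd i k) x) (cdDiff (hX i) x)
    have e2 : ∀ i, ∑ k, (pd k (T i k) x * X i x + T i k x * pd k (X i) x)
        = ∑ k, T i k x * pd k (X i) x := by
      intro i
      rw [Finset.sum_add_distrib, ← Finset.sum_mul, Tdiv x hx i, zero_mul, zero_add]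
    have e3 : ∑ k, pd k (fun x => ∑ i, T i k x * X i x) x = ∑ i, ∑ k, T i k x * pd k (X i) x := by
      simp_rw [e1]
      rw [Finset.sum_comm]
      exact Finset.sum_congr rfl fun i _ => e2 i
    rw [e3]
    simp only [hT, Finset.mul_sum]
    exact Finset.sum_congr rfl fun i _ => Finset.sum_congr rfl fun k _ => by ring
  rw [setIntegral_congr_fun (meas_half l) e, integral_const_mul, D, mul_zero]

end Part3

section Part4

variable {n : ℕ}

def Jv (x : Euc n) : Euc n := (‖x‖ ^ 2)⁻¹ • x
def Rm (x : Euc n) (i k : Fin n) : ℝ := kd i k - 2 * x i * x k * (‖x‖ ^ 2)⁻¹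
def Kvi (Y : Fin n → Euc n → ℝ) (i : Fin n) (x : Euc n) : ℝ :=
  ‖x‖ ^ 2 * Y i (Jv x) - 2 * x i * ∑ m, x m * Y m (Jv x)

lemma Jv_apply (x : Euc n) (i : Fin n) : Jv x i = (‖x‖ ^ 2)⁻¹ * x i := by simp [Jv]

lemma norm_Jv (x : Euc n) : ‖Jv x‖ = ‖x‖⁻¹ := by
  unfold Jv
  rw [norm_smul, Real.norm_of_nonneg (by positivity)]
  by_cases h : ‖x‖ = 0
  · simp [h]
  · field_simp

lemma Jv_Jv (x : Euc n) : Jv (Jv x) = x := by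
  by_cases h : x = 0
  · simp [Jv, h]
  · have : ‖x‖ ≠ 0 := by simpa using h
    conv_lhs => rw [Jv, norm_Jv, Jv, smul_smul]
    rw [show ((‖x‖⁻¹ ^ 2)⁻¹ * (‖x‖ ^ 2)⁻¹) = 1 by field_simp, one_smul]

lemma Jv_ne {x : Euc n} (h : x ≠ 0) : Jv x ≠ 0 := by
  intro h'; apply h; rw [← Jv_Jv x, h']; simp [Jv]

lemma Jv_inversion : (Jv : Euc n → Euc n) = EuclideanGeometry.inversion 0 1 := by
  ext x i; simp [Jv, EuclideanGeometry.inversion]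

lemma Jv_cd {x : Euc n} (h : x ≠ 0) : ContDiffAt ℝ (⊤ : ℕ∞) (Jv : Euc n → Euc n) x := by
  have : ‖x‖ ^ 2 ≠ 0 := by simpa using h
  exact (cd_normsq.contDiffAt.inv this).smul contDiffAt_id

lemma sum_kd_mul (A : Fin n → ℝ) (i : Fin n) : ∑ k, kd i k * A k = A i := by simp [kd]
lemma sum_kd_mul' (A : Fin n → ℝ) (i : Fin n) : ∑ k, kd k i * A k = A i := by simp [kd]
lemma sum_mul_kd (A : Fin n → ℝ) (i : Fin n) : ∑ k, A k * kd i k = A i := by simp [kd]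
lemma sum_mul_kd' (A : Fin n → ℝ) (i : Fin n) : ∑ k, A k * kd k i = A i := by simp [kd]

lemma Rm_symm (x : Euc n) (i k : Fin n) : Rm x i k = Rm x k i := by
  simp only [Rm, kd_symm i k]; ring

lemma Rm_mul {x : Euc n} (hx : x ≠ 0) (i k : Fin n) : ∑ m, Rm x i m * Rm x k m = kd i k := by
  have h0 : ‖x‖ ^ 2 ≠ 0 := by simpa using hx
  have e : ∀ m, Rm x i m * Rm x k m = kd i m * kd k m - 2 * x k * (‖x‖^2)⁻¹ * (kd i m * x m)
      - 2 * x i * (‖x‖^2)⁻¹ * (kd k m * x m) + 4 * x i * x k * ((‖x‖^2)⁻¹)^2 * (x m ^ 2) := by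
    intro m; simp only [Rm]; ring
  simp_rw [e]
  rw [Finset.sum_add_distrib, Finset.sum_sub_distrib, Finset.sum_sub_distrib, ← Finset.mul_sum,
    ← Finset.mul_sum, ← Finset.mul_sum, ← normsq_eq, sum_kd_mul, sum_kd_mul, sum_kd_mul, kd_symm]
  field_simp; ring

lemma Rm_Jv {x : Euc n} (hx : x ≠ 0) (i k : Fin n) : Rm (Jv x) i k = Rm x i k := by
  have h0 : ‖x‖ ≠ 0 := by simpa using hx
  simp only [Rm, Jv_apply, norm_Jv]; field_simp

lemma pd_Jv {x : Euc n} (hx : x ≠ 0) (l k : Fin n) :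
    pd k (fun y => Jv y l) x = (‖x‖ ^ 2)⁻¹ * Rm x l k := by
  have h0 : ‖x‖ ^ 2 ≠ 0 := by simpa using hx
  have e : (fun y : Euc n => Jv y l) = fun y => (‖y‖ ^ 2)⁻¹ * y l := by ext y; rw [Jv_apply]
  have d1 : DifferentiableAt ℝ (fun y : Euc n => (‖y‖ ^ 2)⁻¹) x :=
    (cdDiff cd_normsq x).inv h0
  rw [e, pd_mul k d1 (cdDiff (cd_coord l) x), pd_coord,
    pd_comp (g := fun t => t⁻¹) (f := fun y : Euc n => ‖y‖ ^ 2) k (hasDerivAt_inv h0) (cdDiff cd_normsq x), pd_normsq]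
  simp only [Rm]; field_simp; ring

lemma Kvi_cd {Y : Fin n → Euc n → ℝ} (hY : ∀ i, ContDiff ℝ (⊤ : ℕ∞) (Y i)) {x : Euc n} (hx : x ≠ 0)
    (i : Fin n) : ContDiffAt ℝ (⊤ : ℕ∞) (Kvi Y i) x := by
  unfold Kvi
  have hJ := fun m => (hY m).contDiffAt.comp x (Jv_cd hx)
  exact (cd_normsq.contDiffAt.mul (hJ i)).sub ((contDiffAt_const.mul (cd_coord i).contDiffAt).mul
    (ContDiffAt.sum fun m _ => (cd_coord m).contDiffAt.mul (hJ m)))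

lemma pd_Kvi {Y : Fin n → Euc n → ℝ} (hY : ∀ i, ContDiff ℝ (⊤ : ℕ∞) (Y i)) {x : Euc n} (hx : x ≠ 0)
    (i k : Fin n) : pd k (Kvi Y i) x = 2 * x k * Y i (Jv x) - 2 * x i * Y k (Jv x)
      - 2 * kd i k * ∑ m, x m * Y m (Jv x)
      + ∑ m, ∑ l, Rm x i m * pd l (Y m) (Jv x) * Rm x l k := by
  have h0 : ‖x‖ ^ 2 ≠ 0 := by simpa using hx
  have dJ : ∀ m, DifferentiableAt ℝ (fun y => Y m (Jv y)) x := fun m =>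
    cdaDiff ((hY m).contDiffAt.comp x (Jv_cd hx))
  have pJ : ∀ m, pd k (fun y => Y m (Jv y)) x
      = (‖x‖ ^ 2)⁻¹ * ∑ l, pd l (Y m) (Jv x) * Rm x l k := by
    intro m
    rw [pd_comp_vec k (cdDiff (hY m) _) ((Jv_cd hx).differentiableAt (by simp)), Finset.mul_sum]
    refine Finset.sum_congr rfl fun l _ => ?_
    rw [pd_Jv hx]; ring
  have dc := fun m : Fin n => cdDiff (cd_coord m) x
  have ds : DifferentiableAt ℝ (fun y : Euc n => ∑ m, y m * Y m (Jv y)) x :=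
    DifferentiableAt.fun_sum fun m _ => (dc m).mul (dJ m)
  unfold Kvi
  rw [pd_sub k ((cdDiff cd_normsq x).fun_mul (dJ i)) (((differentiableAt_const _).fun_mul (dc i)).fun_mul ds),
    pd_mul k (cdDiff cd_normsq x) (dJ i), pd_normsq, pd_mul k ((differentiableAt_const _).fun_mul (dc i)) ds,
    pd_const_mul k _ (dc i), pd_coord, pd_sum (f := fun m (y : Euc n) => y m * Y m (Jv y)) k (fun m _ => (dc m).mul (dJ m)), pJ]
  have e1 : ∑ m, pd k (fun y : Euc n => y m * Y m (Jv y)) x = Y k (Jv x)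
      + (‖x‖ ^ 2)⁻¹ * ∑ m, x m * ∑ l, pd l (Y m) (Jv x) * Rm x l k := by
    rw [Finset.mul_sum, ← sum_kd_mul' (fun m => Y m (Jv x)) k, ← Finset.sum_add_distrib]
    refine Finset.sum_congr rfl fun m _ => ?_
    rw [pd_mul k (dc m) (dJ m), pd_coord, pJ]; ring
  have e2 : ∑ m, ∑ l, Rm x i m * pd l (Y m) (Jv x) * Rm x l k
      = ∑ l, pd l (Y i) (Jv x) * Rm x l k
        - 2 * x i * (‖x‖ ^ 2)⁻¹ * ∑ m, x m * ∑ l, pd l (Y m) (Jv x) * Rm x l k := by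
    rw [← sum_kd_mul (fun m => ∑ l, pd l (Y m) (Jv x) * Rm x l k) i, Finset.mul_sum,
      ← Finset.sum_sub_distrib]
    refine Finset.sum_congr rfl fun m _ => ?_
    have : ∑ l, Rm x i m * pd l (Y m) (Jv x) * Rm x l k
      = Rm x i m * ∑ l, pd l (Y m) (Jv x) * Rm x l k := by
      rw [Finset.mul_sum]; exact Finset.sum_congr rfl fun l _ => by ring
    rw [this]; simp only [Rm]; ring
  rw [e1, e2]
  field_simp; ring

lemma Lop_Kvi (hn : 0 < n) {Y : Fin n → Euc n → ℝ} (hY : ∀ i, ContDiff ℝ (⊤ : ℕ∞) (Y i)) {x : Euc n} (hx : x ≠ 0)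
    (i k : Fin n) : Lop (Kvi Y) i k x = ∑ m, ∑ l, Rm x i m * Rm x k l * Lop Y m l (Jv x) := by
  have hn' : (n:ℝ) ≠ 0 := by positivity
  set s := ∑ m, x m * Y m (Jv x) with hs
  have tr : ∑ m, pd m (Kvi Y m) x = - 2 * n * s + ∑ m, pd m (Y m) (Jv x) := by
    simp_rw [pd_Kvi hY hx]
    rw [Finset.sum_add_distrib]
    congr 1
    · simp [kd, hs]; ring
    · rw [Finset.sum_comm]
      refine Finset.sum_congr rfl fun m _ => ?_
      rw [Finset.sum_comm]
      have : ∀ l, ∑ i, Rm x i m * pd l (Y m) (Jv x) * Rm x l i = kd l m * pd l (Y m) (Jv x) := by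
        intro l
        rw [← Rm_mul hx l m, Finset.sum_mul]
        refine Finset.sum_congr rfl fun i _ => ?_
        rw [Rm_symm x i m]; ring
      simp_rw [this]
      exact sum_kd_mul' (fun l => pd l (Y m) (Jv x)) m
  have e3 : ∑ m, ∑ l, Rm x i m * Rm x k l * (pd l (Y m) (Jv x))
      = ∑ m, ∑ l, Rm x i m * pd l (Y m) (Jv x) * Rm x l k :=
    Finset.sum_congr rfl fun m _ => Finset.sum_congr rfl fun l _ => by rw [Rm_symm x k l]; ring
  have e4 : ∑ m, ∑ l, Rm x i m * Rm x k l * (pd m (Y l) (Jv x))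
      = ∑ m, ∑ l, Rm x k m * pd l (Y m) (Jv x) * Rm x l i := by
    rw [Finset.sum_comm]
    exact Finset.sum_congr rfl fun m _ => Finset.sum_congr rfl fun l _ => by rw [Rm_symm x i l]; ring
  have e5 : ∀ c : ℝ, ∑ m, ∑ l, Rm x i m * Rm x k l * (c * kd m l) = c * kd i k := by
    intro c
    rw [← Rm_mul hx i k, Finset.mul_sum]
    refine Finset.sum_congr rfl fun m _ => ?_
    rw [← sum_mul_kd (fun l => c * (Rm x i m * Rm x k l)) m]
    exact Finset.sum_congr rfl fun l _ => by ring
  have e6 : ∑ m, ∑ l, Rm x i m * Rm x k l * Lop Y m l (Jv x)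
     = ∑ m, ∑ l, Rm x k m * pd l (Y m) (Jv x) * Rm x l i + ∑ m, ∑ l, Rm x i m * pd l (Y m) (Jv x) * Rm x l k
       - (2 / (n:ℝ)) * (∑ m, pd m (Y m) (Jv x)) * kd i k := by
    rw [← e3, ← e4, ← e5]
    simp only [Lop, ← Finset.sum_add_distrib, ← Finset.sum_sub_distrib]
    exact Finset.sum_congr rfl fun m _ => Finset.sum_congr rfl fun l _ => by ring
  rw [e6]
  simp only [Lop]
  rw [tr, pd_Kvi hY hx, pd_Kvi hY hx, kd_symm k i]
  field_simp; ring

lemma Jdet (y : Euc n) : |(((1:ℝ) / dist y 0) ^ 2 • (((Submodule.span ℝ {y - 0})ᗮ).reflection : Euc n →L[ℝ] Euc n)).det|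
    = (‖y‖ ^ (2 * n))⁻¹ := by
  have h := (Submodule.span ℝ {y - (0 : Euc n)})ᗮ.det_reflection
  rw [ContinuousLinearMap.det, ContinuousLinearMap.toLinearMap_smul, LinearMap.det_smul, abs_mul]
  erw [h]
  simp [pow_mul]

lemma J_cov : ∀ y ∈ ({0}ᶜ : Set (Euc n)), HasFDerivWithinAt (Jv : Euc n → Euc n)
    (((1:ℝ) / dist y 0) ^ 2 • (((Submodule.span ℝ {y - 0})ᗮ).reflection : Euc n →L[ℝ] Euc n)) {0}ᶜ y := by
  intro y hy
  rw [Jv_inversion]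
  exact (EuclideanGeometry.hasFDerivAt_inversion hy).hasFDerivWithinAt

lemma J_image : Jv '' ({0}ᶜ : Set (Euc n)) = {0}ᶜ := by
  ext x; constructor
  · rintro ⟨y, hy, rfl⟩; exact Jv_ne hy
  · intro hx; exact ⟨Jv x, Jv_ne hx, Jv_Jv x⟩

lemma J_inj : Set.InjOn (Jv : Euc n → Euc n) {0}ᶜ := fun x _ y _ h => by
  rw [← Jv_Jv x, h, Jv_Jv]

lemma ae_ne (hn : 0 < n) : ({0}ᶜ : Set (Euc n)) =ᵐ[volume] Set.univ := by
  have : Nonempty (Fin n) := ⟨⟨0, hn⟩⟩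
  rw [ae_eq_univ, compl_compl]; simp

lemma lint_J (hn : 0 < n) (g : Euc n → ENNReal) :
    ∫⁻ x, g x = ∫⁻ y, ENNReal.ofReal (‖y‖ ^ (2 * n))⁻¹ * g (Jv y) := by
  have := lintegral_image_eq_lintegral_abs_det_fderiv_mul volume (MeasurableSet.singleton (0:Euc n)).compl
    J_cov J_inj g
  rw [J_image, setLIntegral_congr (ae_ne hn), setLIntegral_congr (ae_ne hn)] at this
  simp only [Jdet, setLIntegral_univ] at this
  exact this

lemma int_J (hn : 0 < n) (g : Euc n → ℝ) :
    ∫ x, g x = ∫ y, (‖y‖ ^ (2 * n))⁻¹ * g (Jv y) := by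
  have := integral_image_eq_integral_abs_det_fderiv_smul volume (MeasurableSet.singleton (0:Euc n)).compl
    J_cov J_inj g
  rw [J_image, setIntegral_congr_set (ae_ne hn), setIntegral_congr_set (ae_ne hn)] at this
  simp only [Jdet, setIntegral_univ, smul_eq_mul] at this
  exact this

end Part4

section Part5

variable {n : ℕ}

structure WF (l : Fin n) (f : Fin n → Euc n → ℝ) (F : Fin n → Fin n → Euc n → ℝ) : Prop where
  fcd : ∀ i x, x ≠ 0 → ContDiffAt ℝ (⊤ : ℕ∞) (f i) x
  Fcd : ∀ i k x, x ≠ 0 → ContDiffAt ℝ (⊤ : ℕ∞) (F i k) x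
  fb : ∀ x : Euc n, x l = 0 → f l x = 0
  weak : ∀ Y : Fin n → Euc n → ℝ, (∀ i, ContDiff ℝ (⊤ : ℕ∞) (Y i)) →
    (∀ i, HasCompactSupport (Y i)) → (∀ i, (0 : Euc n) ∉ tsupport (Y i)) →
    (∀ x : Euc n, x l = 0 → Y l x = 0) →
    ∫ x in {x : Euc n | 0 ≤ x l}, Wt n x * ∑ i, ∑ k, (F i k x - Lop f i k x) * Lop Y i k x = 0

def FF (h : Fin n → Fin n → Euc n → ℝ) (i k : Fin n) (y : Euc n) : ℝ :=
  ∑ m, ∑ l, Rm y i m * Rm y k l * h m l (Jv y)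

lemma Wt_J {y : Euc n} (hy : y ≠ 0) : (‖y‖ ^ (2 * n))⁻¹ * Wt n (Jv y) = Wt n y := by
  have h0 : ‖y‖ ≠ 0 := by simpa using hy
  simp only [Wt, norm_Jv]
  rw [pow_mul, ← mul_inv, ← mul_pow]
  congr 2; field_simp; ring

lemma Kvi_smooth {Y : Fin n → Euc n → ℝ} (hY : ∀ i, ContDiff ℝ (⊤ : ℕ∞) (Y i))
    (hYc : ∀ i, HasCompactSupport (Y i)) (i : Fin n) : ContDiff ℝ (⊤ : ℕ∞) (Kvi Y i) := by
  rw [contDiff_iff_contDiffAt]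
  intro x
  by_cases hx : x = 0
  · subst hx
    have hB : ∃ B : ℝ, 0 < B ∧ ∀ m y, B < ‖y‖ → Y m y = 0 := by
      have : ∀ m, ∃ B : ℝ, ∀ y, B < ‖y‖ → Y m y = 0 := by
        intro m
        obtain ⟨B, hB⟩ := (hYc m).isCompact.isBounded.exists_norm_le
        refine ⟨B, fun y hy => ?_⟩
        by_contra h
        exact absurd (hB y (subset_tsupport _ h)) (not_le.2 hy)
      choose B hB using this
      refine ⟨1 + ∑ m, |B m|, by positivity, fun m y hy => hB m y (lt_of_le_of_lt ?_ hy)⟩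
      have := Finset.single_le_sum (f := fun m => |B m|) (fun i _ => abs_nonneg _) (Finset.mem_univ m)
      have h2 := le_abs_self (B m)
      linarith
    obtain ⟨B, hB0, hB⟩ := hB
    have : Kvi Y i =ᶠ[nhds 0] fun _ => 0 := by
      filter_upwards [Metric.ball_mem_nhds (0 : Euc n) (inv_pos.2 hB0)] with y hy
      by_cases h0 : y = 0
      · simp [Kvi, h0]
      · have hz : ∀ m, Y m (Jv y) = 0 := by
          intro m; apply hB; rw [norm_Jv]
          have : 0 < ‖y‖ := by simpa using h0
          rw [mem_ball_zero_iff] at hy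
          rwa [lt_inv_comm₀ hB0 this]
        simp [Kvi, hz]
    exact contDiffAt_const.congr_of_eventuallyEq this
  · exact Kvi_cd hY hx i

lemma Kvi_hcs {Y : Fin n → Euc n → ℝ} 
    (hY0 : ∀ i, (0 : Euc n) ∉ tsupport (Y i)) (i : Fin n) : HasCompactSupport (Kvi Y i) := by
  have : ∀ᶠ y in nhds (0 : Euc n), ∀ m, Y m y = 0 := by
    rw [Filter.eventually_all]
    intro m
    exact notMem_tsupport_iff_eventuallyEq.1 (hY0 m)
  obtain ⟨ρ, hρ, hb⟩ := Metric.eventually_nhds_iff.1 this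
  refine HasCompactSupport.intro (isCompact_closedBall (0 : Euc n) ρ⁻¹) fun x hx => ?_
  rw [mem_closedBall_zero_iff, not_le] at hx
  have h1 : dist (Jv x) 0 < ρ := by
    rw [dist_zero_right, norm_Jv]
    have : 0 < ‖x‖ := lt_trans (inv_pos.2 hρ) hx
    rwa [inv_lt_comm₀ this hρ]
  simp [Kvi, hb h1]

theorem WF_of (hn : 4 ≤ n) (l : Fin n) (h : Fin n → Fin n → Euc n → ℝ)
    (hh : ∀ i k, ContDiff ℝ (⊤ : ℕ∞) (h i k)) (hs : ∀ i k x, h i k x = h k i x)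
    (ht : ∀ x, ∑ i, h i i x = 0)
    (V : Fin n → Euc n → ℝ) (hV : ∀ i, ContDiff ℝ (⊤ : ℕ∞) (V i))
    (he : ∀ x : Euc n, 0 ≤ x l → ∀ i,
          ∑ k, pd k (fun y => u0 n y ^ (2 * (n : ℝ) / ((n : ℝ) - 2))
            * (h i k y - pd i (V k) y - pd k (V i) y
                + (2 / (n : ℝ)) * (∑ m, pd m (V m) y) * kd i k)) x = 0)
    (hb : ∀ x : Euc n, x l = 0 → V l x = 0 ∧ ∀ i, i ≠ l → pd l (V i) x = h i l x) :
    WF l (Kvi V) (FF h) := by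
  refine ⟨fun i x hx => Kvi_cd hV hx i, fun i k x hx => ?_, fun x hx => ?_, ?_⟩
  · unfold FF
    have hR : ∀ i k, ContDiffAt ℝ (⊤ : ℕ∞) (fun y : Euc n => Rm y i k) x := fun i k => by
      unfold Rm
      exact contDiffAt_const.sub (((contDiffAt_const.mul (cd_coord i).contDiffAt).mul
        (cd_coord k).contDiffAt).mul (cd_normsq.contDiffAt.inv (by simpa using hx)))
    exact ContDiffAt.sum fun m _ => ContDiffAt.sum fun j _ =>
      ((hR i m).mul (hR k j)).mul ((hh m j).contDiffAt.comp x (Jv_cd hx))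
  · have : Jv x l = 0 := by rw [Jv_apply, hx, mul_zero]
    simp [Kvi, hx, (hb _ this).1]
  · intro Y hY hYc hY0 hYl
    have W := weakX hn l h hh hs ht V hV he hb (Kvi Y) (Kvi_smooth hY hYc) (Kvi_hcs hY0) (by
      intro x hx
      have : Jv x l = 0 := by rw [Jv_apply, hx, mul_zero]
      simp [Kvi, hx, hYl _ this])
    rw [← integral_indicator (meas_half l), int_J (by omega)] at W
    rw [← integral_indicator (meas_half l)]
    refine Eq.trans ?_ W
    apply integral_congr_ae
    have := ae_ne (n := n) (by omega)
    have h0 : ∀ᵐ y : Euc n, y ≠ 0 := by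
      filter_upwards [this] with y hy
      have : y ∈ ({0}ᶜ : Set (Euc n)) := by
        have h2 : ({0}ᶜ : Set (Euc n)) y = Set.univ y := hy
        exact (iff_of_eq h2).2 trivial
      exact this
    filter_upwards [h0] with y hy
    have hp : 0 < ‖y‖ := by simpa using hy
    have hiff : 0 ≤ Jv y l ↔ 0 ≤ y l := by
      rw [Jv_apply]; constructor
      · intro h; by_contra h'; rw [not_le] at h'
        exact absurd h (not_le.2 (mul_neg_of_pos_of_neg (by positivity) h'))
      · intro h; positivity
    simp only [Set.indicator, Set.mem_ofPred_eq, hiff]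
    split_ifs
    · rw [← mul_assoc, Wt_J hy]
      congr 1
      have e1 : ∀ i k, FF h i k y - Lop (Kvi V) i k y
          = ∑ a, ∑ b, Rm y i a * Rm y k b * (h a b (Jv y) - Lop V a b (Jv y)) := by
        intro i k
        rw [Lop_Kvi (by omega) hV hy, FF]
        simp only [← Finset.sum_sub_distrib, mul_sub]
      have e2 : ∀ a b, Lop (Kvi Y) a b (Jv y) = ∑ i, ∑ k, Rm y a i * Rm y b k * Lop Y i k y := by
        intro a b
        rw [Lop_Kvi (by omega) hY (Jv_ne hy), Jv_Jv]
        simp only [Rm_Jv hy]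
      simp_rw [e1, e2, Finset.sum_mul, Finset.mul_sum]
      rw [Finset.sum_congr rfl fun i _ => Finset.sum_comm]
      rw [Finset.sum_comm]
      refine Finset.sum_congr rfl fun a _ => ?_
      rw [Finset.sum_congr rfl fun i _ => Finset.sum_comm]
      rw [Finset.sum_comm]
      refine Finset.sum_congr rfl fun b _ => ?_
      refine Finset.sum_congr rfl fun i _ => ?_
      refine Finset.sum_congr rfl fun k _ => ?_
      rw [Rm_symm y a i, Rm_symm y b k]; ring
    · simp

lemma off_sum {A : Fin n → Euc n → ℝ} {a : Euc n} (h : ∀ i, a ∉ tsupport (A i)) :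
    a ∉ tsupport (fun x => ∑ i, A i x) := by
  have : ∀ᶠ y in nhds a, ∀ m, A m y = 0 := by
    rw [Filter.eventually_all]
    intro m
    exact notMem_tsupport_iff_eventuallyEq.1 (h m)
  rw [notMem_tsupport_iff_eventuallyEq]
  filter_upwards [this] with y hy
  simp [hy]

lemma Lop_hcs {Y : Fin n → Euc n → ℝ} (hYc : ∀ i, HasCompactSupport (Y i)) (i k : Fin n) :
    HasCompactSupport (Lop Y i k) := by
  unfold Lop
  exact ((pd_hcs (hYc k) i).add (pd_hcs (hYc i) k)).sub
    ((hcs_sum _ (fun m => pd_hcs (hYc m) m)).mul_left.mul_right)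

lemma Lop_off {Y : Fin n → Euc n → ℝ} {a : Euc n} (h : ∀ i, a ∉ tsupport (Y i)) (i k : Fin n) :
    a ∉ tsupport (Lop Y i k) := by
  have : ∀ᶠ y in nhds a, ∀ m j, pd j (Y m) y = 0 := by
    rw [Filter.eventually_all]
    intro m
    rw [Filter.eventually_all]
    intro j
    exact notMem_tsupport_iff_eventuallyEq.1 (fun h' => h m (tsupport_pd _ _ h'))
  rw [notMem_tsupport_iff_eventuallyEq]
  filter_upwards [this] with y hy
  simp [Lop, hy]

/-- the integrated identity -/
theorem star (hn : 0 < n) {l : Fin n} {f : Fin n → Euc n → ℝ} {F : Fin n → Fin n → Euc n → ℝ} (H : WF l f F)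
    {Y : Fin n → Euc n → ℝ} (hY : ∀ i, ContDiff ℝ (⊤ : ℕ∞) (Y i))
    (hYc : ∀ i, HasCompactSupport (Y i)) (hY0 : ∀ i, (0 : Euc n) ∉ tsupport (Y i))
    (hYl : ∀ x : Euc n, x l = 0 → Y l x = 0)
    (hYt : ∀ x : Euc n, x l = 0 → ∀ i, i ≠ l → Lop Y i l x = 0) :
    ∫ x in {x : Euc n | 0 ≤ x l}, (Wt n x * ∑ i, ∑ k, F i k x * Lop Y i k x
      + 2 * ∑ i, ∑ k, f i x * (pd k (Wt n) x * Lop Y i k x + Wt n x * pd k (Lop Y i k) x)) = 0 := by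
  have LY := fun i k => Lop_cd' hY i k
  have LYc := fun i k => Lop_hcs hYc i k
  have LY0 := fun i k => Lop_off hY0 i k
  have WLcd : ∀ i k, ContDiff ℝ (⊤ : ℕ∞) (fun x => Wt n x * Lop Y i k x) := fun i k => Wt_cd.mul (LY i k)
  have WL0 : ∀ i k, (0 : Euc n) ∉ tsupport (fun x => Wt n x * Lop Y i k x) := fun i k h =>
    LY0 i k (closure_mono (fun x hx => by
      simp only [Function.mem_support] at hx ⊢; exact right_ne_zero_of_mul hx) h)
  have Ph : ∀ i k, ContDiff ℝ (⊤ : ℕ∞) (fun x => f i x * (Wt n x * Lop Y i k x)) := fun i k =>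
    cd_mul_off (H.fcd i) (WLcd i k) (WL0 i k)
  have D := div_half l (fun k x => ∑ i, f i x * (Wt n x * Lop Y i k x))
    (fun k => ContDiff.sum fun i _ => (Ph i k).of_le (by simp))
    (fun k => hcs_sum _ fun i => (LYc i k).mul_left.mul_left)
    (fun x hx => by
      refine Finset.sum_eq_zero fun i _ => ?_
      by_cases hi : i = l
      · subst hi; rw [H.fb x hx, zero_mul]
      · rw [hYt x hx i hi]; simp)
  have W := H.weak Y hY hYc hY0 hYl
  -- integrability of the F term
  have FY : ∀ i k, ContDiff ℝ (⊤ : ℕ∞) (fun x => F i k x * Lop Y i k x) := fun i k =>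
    cd_mul_off (H.Fcd i k) (LY i k) (LY0 i k)
  have ne : ∀ x : Euc n, x ≠ 0 → ∀ i k, pd k (fun x => f i x * (Wt n x * Lop Y i k x)) x
      = pd k (f i) x * (Wt n x * Lop Y i k x) + f i x * (pd k (Wt n) x * Lop Y i k x
        + Wt n x * pd k (Lop Y i k) x) := by
    intro x hx i k
    rw [pd_mul k (cdaDiff (H.fcd i x hx)) (cdDiff (WLcd i k) x),
      pd_mul k (cdDiff Wt_cd x) (cdDiff (LY i k) x)]
  have I1 : Integrable (fun x => 2 * ∑ k, pd k (fun x => ∑ i, f i x * (Wt n x * Lop Y i k x)) x) := by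
    apply Integrable.const_mul
    refine integrable_finsetSum _ fun k _ => ?_
    refine hcs_int ?_ (pd_hcs (hcs_sum _ fun i => (LYc i k).mul_left.mul_left) k)
    exact (ContDiff.pd' (ContDiff.sum fun i _ => (Ph i k)) k).continuous
  -- pointwise identity
  have key : ∀ x : Euc n, x ≠ 0 → (Wt n x * ∑ i, ∑ k, F i k x * Lop Y i k x
      + 2 * ∑ i, ∑ k, f i x * (pd k (Wt n) x * Lop Y i k x + Wt n x * pd k (Lop Y i k) x))
      = Wt n x * (∑ i, ∑ k, (F i k x - Lop f i k x) * Lop Y i k x)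
        + 2 * ∑ k, pd k (fun x => ∑ i, f i x * (Wt n x * Lop Y i k x)) x := by
    intro x hx
    have e1 : ∀ k, pd k (fun x => ∑ i, f i x * (Wt n x * Lop Y i k x)) x
      = ∑ i, (pd k (f i) x * (Wt n x * Lop Y i k x) + f i x * (pd k (Wt n) x * Lop Y i k x
        + Wt n x * pd k (Lop Y i k) x)) := by
      intro k
      rw [pd_sum (f := fun i x => f i x * (Wt n x * Lop Y i k x)) k (fun i _ => cdDiff (Ph i k) x)]
      exact Finset.sum_congr rfl fun i _ => ne x hx i k
    have e2 := sym_tr (fun i k => Lop Y i k x) (fun i k => Lop_symm Y i k x) (Lop_trace hn Y x) f x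
    have e3 : ∑ i, ∑ k, (F i k x - Lop f i k x) * Lop Y i k x
       = ∑ i, ∑ k, F i k x * Lop Y i k x - ∑ i, ∑ k, Lop Y i k x * Lop f i k x := by
      simp only [← Finset.sum_sub_distrib]
      exact Finset.sum_congr rfl fun m _ => Finset.sum_congr rfl fun l _ => by ring
    have e5 : ∑ k, ∑ i, (pd k (f i) x * (Wt n x * Lop Y i k x) + f i x * (pd k (Wt n) x * Lop Y i k x
        + Wt n x * pd k (Lop Y i k) x)) = Wt n x * (∑ i, ∑ k, Lop Y i k x * pd k (f i) x)
        + ∑ i, ∑ k, f i x * (pd k (Wt n) x * Lop Y i k x + Wt n x * pd k (Lop Y i k) x) := by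
      rw [Finset.sum_comm]
      simp only [Finset.mul_sum, ← Finset.sum_add_distrib]
      exact Finset.sum_congr rfl fun m _ => Finset.sum_congr rfl fun l _ => by ring
    simp_rw [e1]
    rw [e3, e2, e5]; ring
  have I2 : Integrable (fun x => Wt n x * ∑ i, ∑ k, (F i k x - Lop f i k x) * Lop Y i k x) := by
    refine hcs_int (Wt_cd.continuous.mul (continuous_finsetSum _ fun i _ => continuous_finsetSum _
      fun k _ => (cd_mul_off (fun x hx => (H.Fcd i k x hx).sub (Lop_cd (fun i => H.fcd i x hx) i k))
        (LY i k) (LY0 i k)).continuous)) ?_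
    exact (hcs_sum _ fun i => hcs_sum _ fun k => (LYc i k).mul_left).mul_left
  have h0 : ∀ᵐ y : Euc n ∂(volume.restrict {x : Euc n | 0 ≤ x l}), y ≠ 0 := by
    apply ae_restrict_of_ae
    have := ae_ne (n := n) hn
    rw [ae_eq_univ, compl_compl] at this
    exact measure_eq_zero_iff_ae_notMem.1 this
  rw [integral_congr_ae (h0.mono fun x hx => key x hx), integral_add I2.integrableOn I1.integrableOn, W,
    integral_const_mul, D]
  simp

end Part5

section Part6

variable {n : ℕ}

def qq (e s : ℝ) (y : Euc n) : ℝ := (‖y‖ ^ 2 + e ^ 2) ^ (-s)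

lemma qq_base {e : ℝ} (he : 0 < e) (y : Euc n) : 0 < ‖y‖ ^ 2 + e ^ 2 := by positivity

lemma qq_pos {e : ℝ} (he : 0 < e) (s : ℝ) (y : Euc n) : 0 < qq e s y :=
  Real.rpow_pos_of_pos (qq_base he y) _

lemma qq_cd {e : ℝ} (he : 0 < e) (s : ℝ) : ContDiff ℝ (⊤ : ℕ∞) (qq e s : Euc n → ℝ) := by
  unfold qq
  exact (cd_normsq.add contDiff_const).rpow_const_of_ne (fun y => (qq_base he y).ne')

lemma qq_pd {e : ℝ} (he : 0 < e) (s : ℝ) (k : Fin n) (y : Euc n) :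
    pd k (qq e s) y = -2 * s * y k * qq e (s + 1) y := by
  have h := (Real.hasDerivAt_rpow_const (p := -s) (Or.inl (qq_base he y).ne'))
  have h2 := pd_comp (f := fun y : Euc n => ‖y‖ ^ 2 + e ^ 2) k h
    ((cdDiff cd_normsq y).add (differentiableAt_const _))
  unfold qq
  rw [h2, pd_add k (cdDiff cd_normsq y) (differentiableAt_const _), pd_normsq, pd_const,
    show -s - 1 = -(s + 1) by ring]
  ring

lemma qq_red {e : ℝ} (he : 0 < e) (s : ℝ) (y : Euc n) :
    ‖y‖ ^ 2 * qq e (s + 1) y = qq e s y - e ^ 2 * qq e (s + 1) y := by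
  have : (‖y‖ ^ 2 + e ^ 2) * qq e (s + 1) y = qq e s y := by
    unfold qq
    rw [mul_comm, ← Real.rpow_add_one (qq_base he y).ne']
    congr 1; ring
  linarith

def HP (k : Fin n) (f : Euc n → ℝ) (d : ℝ) (x : Euc n) : Prop := DifferentiableAt ℝ f x ∧ pd k f x = d

lemma HP.add {k : Fin n} {f g : Euc n → ℝ} {a b : ℝ} {x : Euc n} (hf : HP k f a x) (hg : HP k g b x) :
    HP k (fun y => f y + g y) (a + b) x :=
  ⟨hf.1.fun_add hg.1, by rw [pd_add k hf.1 hg.1, hf.2, hg.2]⟩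

lemma HP.sub {k : Fin n} {f g : Euc n → ℝ} {a b : ℝ} {x : Euc n} (hf : HP k f a x) (hg : HP k g b x) :
    HP k (fun y => f y - g y) (a - b) x :=
  ⟨hf.1.fun_sub hg.1, by rw [pd_sub k hf.1 hg.1, hf.2, hg.2]⟩

lemma HP.mul {k : Fin n} {f g : Euc n → ℝ} {a b : ℝ} {x : Euc n} (hf : HP k f a x) (hg : HP k g b x) :
    HP k (fun y => f y * g y) (a * g x + f x * b) x :=
  ⟨hf.1.fun_mul hg.1, by rw [pd_mul k hf.1 hg.1, hf.2, hg.2]⟩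

lemma HP.cm {k : Fin n} {f : Euc n → ℝ} {a : ℝ} {x : Euc n} (hf : HP k f a x) (c : ℝ) :
    HP k (fun y => c * f y) (c * a) x :=
  ⟨hf.1.const_mul c, by rw [pd_const_mul k c hf.1, hf.2]⟩

lemma HP.coord (k i : Fin n) (x : Euc n) : HP k (fun y => y i) (kd i k) x :=
  ⟨cdDiff (cd_coord i) x, pd_coord i k x⟩

lemma HP.qq {e : ℝ} (he : 0 < e) (s : ℝ) (k : Fin n) (x : Euc n) :
    HP k (qq e s) (-2 * s * x k * qq e (s + 1) x) x := ⟨cdDiff (qq_cd he s) x, qq_pd he s k x⟩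

/-- column `j` of the regularised kernel -/
def Gk (n : ℕ) (e : ℝ) (j i : Fin n) (y : Euc n) : ℝ :=
  (3 * (n:ℝ) - 2) * kd i j * qq e ((n:ℝ) / 2 - 1) y
  + 2 * ((n:ℝ) - 1) * ((n:ℝ) - 2) * e ^ 2 * kd i j * qq e ((n:ℝ) / 2) y
  + ((n:ℝ) - 2) ^ 2 * (y i * y j * qq e ((n:ℝ) / 2) y)

lemma Gk_cd {e : ℝ} (he : 0 < e) (j i : Fin n) : ContDiff ℝ (⊤ : ℕ∞) (Gk n e j i) := by
  unfold Gk
  exact ((contDiff_const.mul (qq_cd he _)).add (contDiff_const.mul (qq_cd he _))).add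
    (contDiff_const.mul (((cd_coord i).mul (cd_coord j)).mul (qq_cd he _)))

lemma pd_yy {e : ℝ} (he : 0 < e) (s : ℝ) (i j k : Fin n) (y : Euc n) :
    pd k (fun y : Euc n => y i * y j * qq e s y) y
      = (kd i k * y j + y i * kd j k) * qq e s y + y i * y j * (-2 * s * y k * qq e (s+1) y) := by
  have dc := fun m : Fin n => cdDiff (cd_coord m) y
  have dq := cdDiff (n := n) (qq_cd he s) y
  rw [pd_mul k ((dc i).fun_mul (dc j)) dq, pd_mul k (dc i) (dc j), pd_coord, pd_coord, qq_pd he]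

lemma Gk_pd {e : ℝ} (he : 0 < e) (j i k : Fin n) (y : Euc n) :
    pd k (Gk n e j i) y =
      kd i j * y k * (-((n:ℝ) - 2) * (3 * n - 2) * qq e ((n:ℝ) / 2) y
        - n * (2 * (n - 1) * (n - 2)) * e ^ 2 * qq e ((n:ℝ) / 2 + 1) y)
      + ((n:ℝ) - 2) ^ 2 * ((kd i k * y j + y i * kd j k) * qq e ((n:ℝ) / 2) y
        - n * (y i * y j * y k) * qq e ((n:ℝ) / 2 + 1) y) := by
  have dq := fun s => cdDiff (n := n) (qq_cd he s) y
  have d3 : DifferentiableAt ℝ (fun y : Euc n => y i * y j * qq e ((n:ℝ) / 2) y) y :=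
    cdDiff (((cd_coord i).mul (cd_coord j)).mul (qq_cd he _)) y
  unfold Gk
  rw [pd_add k (((dq _).const_mul _).fun_add ((dq _).const_mul _)) (d3.const_mul _),
    pd_add k ((dq _).const_mul _) ((dq _).const_mul _), pd_const_mul k _ (dq _),
    pd_const_mul k _ (dq _), pd_const_mul k _ d3, pd_yy he, qq_pd he, qq_pd he,
    show (n:ℝ)/2 - 1 + 1 = n/2 by ring]
  ring

lemma sum_yi (y : Euc n) (j : Fin n) : ∑ i, y i * kd i j = y j := sum_mul_kd' (fun i => y i) j

lemma Gk_div {e : ℝ} (he : 0 < e) (j : Fin n) (y : Euc n) :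
    ∑ i, pd i (Gk n e j i) y = -(n:ℝ) * (n - 2) * y j * (2 * qq e ((n:ℝ) / 2) y
      + n * e ^ 2 * qq e ((n:ℝ) / 2 + 1) y) := by
  have R := qq_red he ((n:ℝ) / 2) y
  set q1 := qq e ((n:ℝ) / 2) y
  set q2 := qq e ((n:ℝ) / 2 + 1) y
  have : ∀ i, pd i (Gk n e j i) y = (y i * kd i j) * (-((n:ℝ) - 2) * (3 * n - 2) * q1
        - n * (2 * (n - 1) * (n - 2)) * e ^ 2 * q2 + ((n:ℝ) - 2) ^ 2 * q1)
      + ((n:ℝ) - 2) ^ 2 * y j * q1 - ((n:ℝ) - 2) ^ 2 * n * y j * q2 * (y i ^ 2) := by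
    intro i
    rw [Gk_pd he, kd_symm j i]
    simp only [kd, if_true]; ring
  simp_rw [this]
  rw [Finset.sum_sub_distrib, Finset.sum_add_distrib, ← Finset.sum_mul, sum_yi, 
    ← Finset.mul_sum (f := fun i => y i ^ 2), ← normsq_eq]
  simp only [Finset.sum_const, Finset.card_univ, Fintype.card_fin, nsmul_eq_mul]
  linear_combination (- ((n:ℝ) - 2) ^ 2 * n * y j) * R

lemma Gk_Lop (hn : 0 < n) {e : ℝ} (he : 0 < e) (j i k : Fin n) (y : Euc n) :
    Lop (Gk n e j) i k y = 
      (kd i j * y k + kd k j * y i) * (-2 * n * (n - 2) * (qq e ((n:ℝ) / 2) y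
          + (n - 1) * e ^ 2 * qq e ((n:ℝ) / 2 + 1) y))
      + kd i k * y j * (2 * n * (n - 2) * (qq e ((n:ℝ) / 2) y + e ^ 2 * qq e ((n:ℝ) / 2 + 1) y))
      - 2 * n * ((n:ℝ) - 2) ^ 2 * (y i * y j * y k * qq e ((n:ℝ) / 2 + 1) y) := by
  have hn' : (n:ℝ) ≠ 0 := by positivity
  simp only [Lop]
  rw [Gk_div he, Gk_pd he, Gk_pd he, kd_symm j i, kd_symm j k, kd_symm k i]
  field_simp; ring

lemma Gk_divLop (hn : 0 < n) {e : ℝ} (he : 0 < e) (j i : Fin n) (y : Euc n) :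
    ∑ k, pd k (Lop (Gk n e j) i k) y
      = -(2 * n * (n + 2) * (n - 1) * (n - 2)) * e ^ 4 * qq e ((n:ℝ) / 2 + 2) y * kd i j := by
  have R1 := qq_red he ((n:ℝ) / 2) y
  have R2 := qq_red he ((n:ℝ) / 2 + 1) y
  have dc := fun m : Fin n => cdDiff (cd_coord m) y
  have dq := fun s => cdDiff (n := n) (qq_cd he s) y
  rw [show (n:ℝ) / 2 + 1 + 1 = n/2 + 2 by ring] at R2
  have : ∀ k, pd k (Lop (Gk n e j) i k) y = 
      (kd i j * 1 + kd k j * kd i k) * (-2 * n * (n - 2) * (qq e ((n:ℝ) / 2) y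
          + (n - 1) * e ^ 2 * qq e ((n:ℝ) / 2 + 1) y))
      + (kd i j * y k + kd k j * y i) * (-2 * n * (n - 2) * (-2 * (n / 2) * y k * qq e ((n:ℝ) / 2 + 1) y
          + (n - 1) * e ^ 2 * (-2 * (n / 2 + 1) * y k * qq e ((n:ℝ) / 2 + 2) y)))
      + kd i k * kd j k * (2 * n * (n - 2) * (qq e ((n:ℝ) / 2) y + e ^ 2 * qq e ((n:ℝ) / 2 + 1) y))
      + kd i k * y j * (2 * n * (n - 2) * (-2 * (n / 2) * y k * qq e ((n:ℝ) / 2 + 1) y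
          + e ^ 2 * (-2 * (n / 2 + 1) * y k * qq e ((n:ℝ) / 2 + 2) y)))
      - 2 * n * ((n:ℝ) - 2) ^ 2 * (((kd i k * y j + y i * kd j k) * y k + y i * y j) * qq e ((n:ℝ) / 2 + 1) y
         + y i * y j * y k * (-2 * (n / 2 + 1) * y k * qq e ((n:ℝ) / 2 + 2) y)) := by
    intro k
    have hL : Lop (Gk n e j) i k = fun y => (kd i j * y k + kd k j * y i) * (-2 * n * (n - 2) * (qq e ((n:ℝ) / 2) y
          + (n - 1) * e ^ 2 * qq e ((n:ℝ) / 2 + 1) y))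
      + kd i k * y j * (2 * n * (n - 2) * (qq e ((n:ℝ) / 2) y + e ^ 2 * qq e ((n:ℝ) / 2 + 1) y))
      - 2 * n * ((n:ℝ) - 2) ^ 2 * (y i * y j * y k * qq e ((n:ℝ) / 2 + 1) y) := by
      ext y; exact Gk_Lop hn he j i k y
    rw [hL]
    have c := fun m => HP.coord k m y
    have q1 := HP.qq he ((n:ℝ)/2) k y
    have q2 := HP.qq he ((n:ℝ)/2 + 1) k y
    refine (((((c k).cm (kd i j)).add ((c i).cm (kd k j))).mul ((q1.add (q2.cm ((n - 1) * e ^ 2))).cm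
      (-2 * n * (n - 2)))).add (((c j).cm (kd i k)).mul ((q1.add (q2.cm (e^2))).cm (2 * n * (n - 2)))) |>.sub 
      (((((c i).mul (c j)).mul (c k)).mul q2).cm (2 * n * ((n:ℝ) - 2) ^ 2))).2.trans ?_
    rw [show (n:ℝ) / 2 + 1 + 1 = n/2 + 2 by ring]
    have : kd k k = 1 := by simp [kd]
    rw [this]
    ring
  set q1 := qq e ((n:ℝ) / 2) y
  set q2 := qq e ((n:ℝ) / 2 + 1) y
  set q3 := qq e ((n:ℝ) / 2 + 2) y
  set A : ℝ := -2 * n * (n - 2) * (q1 + (n - 1) * e ^ 2 * q2)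
  set B : ℝ := 2 * n * (n - 2) * (q1 + e ^ 2 * q2)
  set A' : ℝ := -2 * n * (n - 2) * (-n * q2 - (n - 1) * (n + 2) * e ^ 2 * q3) with hA'
  set B' : ℝ := 2 * n * (n - 2) * (-n * q2 - (n + 2) * e ^ 2 * q3) with hB'
  have e2 : ∀ k, pd k (Lop (Gk n e j) i k) y = kd i j * A + (kd i k * kd k j) * (A + B) 
      + kd i j * A' * (y k ^ 2) + (y k * kd k j) * (y i * A' - 2 * n * ((n:ℝ) - 2) ^ 2 * q2 * y i)
      + (kd i k * y k) * (y j * B' - 2 * n * ((n:ℝ) - 2) ^ 2 * q2 * y j)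
      - 2 * n * ((n:ℝ) - 2) ^ 2 * q2 * y i * y j
      + 2 * n * ((n:ℝ) - 2) ^ 2 * (n + 2) * q3 * y i * y j * (y k ^ 2) := by
    intro k; rw [this k, kd_symm j k, hA', hB']; ring
  simp_rw [e2]
  rw [Finset.sum_add_distrib, Finset.sum_sub_distrib, Finset.sum_add_distrib, Finset.sum_add_distrib,
    Finset.sum_add_distrib, Finset.sum_add_distrib, ← Finset.sum_mul (f := fun k => kd i k * kd k j),
    ← Finset.sum_mul (f := fun k => y k * kd k j), ← Finset.sum_mul (f := fun k => kd i k * y k),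
    ← Finset.mul_sum (f := fun k => y k ^ 2), ← Finset.mul_sum (f := fun k => y k ^ 2), ← normsq_eq,
    sum_yi, sum_kd_mul, sum_kd_mul]
  simp only [Finset.sum_const, Finset.card_univ, Fintype.card_fin, nsmul_eq_mul]
  simp only [hA', hB', A, B]
  linear_combination (kd i j * (2 * n * (n - 2)) * n) * R1 + (kd i j * (2 * n * (n - 2)) * (n - 1) * (n + 2) * e ^ 2 + 2 * n * ((n:ℝ) - 2) ^ 2 * (n + 2) * y i * y j) * R2

/-! bounds -/

lemma qq_le1 {e : ℝ} (he : 0 < e) (s : ℝ) (y : Euc n) : e ^ 2 * qq e (s + 1) y ≤ qq e s y := by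
  have := qq_red he s y
  have := mul_nonneg (sq_nonneg ‖y‖) (qq_pos he (s+1) y).le
  linarith

lemma qq_le2 {e : ℝ} (he : 0 < e) (s : ℝ) (y : Euc n) : ‖y‖ ^ 2 * qq e (s + 1) y ≤ qq e s y := by
  have := qq_red he s y
  have := mul_nonneg (sq_nonneg e) (qq_pos he (s+1) y).le
  linarith

lemma qq_le3 {e : ℝ} (s : ℝ) (hs : 0 ≤ s) {y : Euc n} (hy : y ≠ 0) : qq e s y ≤ ‖y‖ ^ (-2 * s) := by
  have h0 : 0 < ‖y‖ := by simpa using hy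
  unfold qq
  rw [show (-2 * s) = (2:ℕ) * (-s) by push_cast; ring, Real.rpow_mul h0.le, Real.rpow_natCast]
  exact Real.rpow_le_rpow_of_nonpos (by positivity) (by nlinarith [sq_nonneg e]) (by linarith)

lemma kd_abs (i j : Fin n) : |kd i j| ≤ 1 := by unfold kd; split_ifs <;> simp

end Part6

section Part7

variable {n : ℕ}

lemma Gk_bound (hn : 4 ≤ n) {e : ℝ} (he : 0 < e) (j i : Fin n) {y : Euc n} (hy : y ≠ 0) :
    |Gk n e j i y| ≤ 20 * n ^ 3 * ‖y‖ ^ (2 - (n:ℝ)) := by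
  have h4 : (4:ℝ) ≤ n := by exact_mod_cast hn
  have b1 := qq_le1 he ((n:ℝ)/2 - 1) y
  have b2 := qq_le2 he ((n:ℝ)/2 - 1) y
  have b3 := qq_le3 (e := e) ((n:ℝ)/2 - 1) (by linarith) hy
  rw [show (n:ℝ)/2 - 1 + 1 = n/2 by ring] at b1 b2
  rw [show -2 * ((n:ℝ)/2 - 1) = 2 - n by ring] at b3
  have p0 := qq_pos he ((n:ℝ)/2 - 1) y
  have p1 := qq_pos he ((n:ℝ)/2) y
  have b4 : |y i * y j * qq e ((n:ℝ)/2) y| ≤ qq e ((n:ℝ)/2 - 1) y := by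
    rw [abs_mul, abs_mul, abs_of_pos p1]
    refine le_trans ?_ b2
    have := mul_le_mul (abs_coord_le y i) (abs_coord_le y j) (abs_nonneg _) (norm_nonneg _)
    rw [sq]; gcongr
  unfold Gk
  set q0 := qq e ((n:ℝ)/2 - 1) y
  set q1 := qq e ((n:ℝ)/2) y
  have hk := kd_abs i j
  have t1 : |(3 * (n:ℝ) - 2) * kd i j * q0| ≤ (3 * n) * q0 := by
    rw [abs_mul, abs_mul, abs_of_pos p0, abs_of_nonneg (by linarith : (0:ℝ) ≤ 3 * n - 2)]
    refine mul_le_mul_of_nonneg_right ?_ p0.le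
    nlinarith [abs_nonneg (kd i j)]
  have t2 : |2 * ((n:ℝ) - 1) * ((n:ℝ) - 2) * e ^ 2 * kd i j * q1| ≤ (2 * n ^ 2) * q0 := by
    rw [show 2 * ((n:ℝ) - 1) * ((n:ℝ) - 2) * e ^ 2 * kd i j * q1
      = (2 * ((n:ℝ) - 1) * ((n:ℝ) - 2)) * kd i j * (e ^ 2 * q1) by ring, abs_mul, abs_mul,
      abs_of_nonneg (by nlinarith : (0:ℝ) ≤ 2 * ((n:ℝ) - 1) * ((n:ℝ) - 2)),
      abs_of_nonneg (by positivity : 0 ≤ e ^ 2 * q1)]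
    have : (2 * ((n:ℝ) - 1) * ((n:ℝ) - 2)) * |kd i j| ≤ 2 * n ^ 2 := by
      have h1 : (2 * ((n:ℝ) - 1) * ((n:ℝ) - 2)) * |kd i j| ≤ (2 * ((n:ℝ) - 1) * ((n:ℝ) - 2)) * 1 := by
        gcongr; nlinarith
      nlinarith
    gcongr
  have t3 : |((n:ℝ) - 2) ^ 2 * (y i * y j * q1)| ≤ n ^ 2 * q0 := by
    rw [abs_mul, abs_of_nonneg (sq_nonneg _)]
    gcongr
    · linarith
    · linarith
  refine (abs_add_le _ _).trans ((add_le_add (abs_add_le _ _) le_rfl).trans ?_)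
  have : (3 * n) * q0 + (2 * n ^ 2) * q0 + n ^ 2 * q0 ≤ 20 * n ^ 3 * q0 := by
    rw [← add_mul, ← add_mul]; gcongr; nlinarith [sq_nonneg (n:ℝ)]
  have h5 : 20 * (n:ℝ) ^ 3 * q0 ≤ 20 * n ^ 3 * ‖y‖ ^ (2 - (n:ℝ)) := by gcongr
  linarith

lemma Gk_pd_bound (hn : 4 ≤ n) {e : ℝ} (he : 0 < e) (j i k : Fin n) {y : Euc n} (hy : y ≠ 0) :
    |pd k (Gk n e j i) y| ≤ 20 * n ^ 3 * ‖y‖ ^ (1 - (n:ℝ)) := by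
  have h4 : (4:ℝ) ≤ n := by exact_mod_cast hn
  have hy0 : 0 < ‖y‖ := by simpa using hy
  have b1 := qq_le1 he ((n:ℝ)/2) y
  have b2 := qq_le2 he ((n:ℝ)/2) y
  have b3 := qq_le3 (e := e) ((n:ℝ)/2) (by linarith) hy
  rw [show -2 * ((n:ℝ)/2) = - n by ring] at b3
  have p1 := qq_pos he ((n:ℝ)/2) y
  have p2 := qq_pos he ((n:ℝ)/2 + 1) y
  rw [Gk_pd he]
  set q1 := qq e ((n:ℝ)/2) y
  set q2 := qq e ((n:ℝ)/2+1) y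
  have ci := fun m => abs_coord_le y m
  have t1 : |kd i j * y k * (-((n:ℝ) - 2) * (3 * n - 2) * q1 - n * (2 * (n - 1) * (n - 2)) * e ^ 2 * q2)|
      ≤ ‖y‖ * ((3 * n ^ 2 + 2 * n ^ 3) * q1) := by
    rw [abs_mul, abs_mul]
    have h1 : |kd i j| * |y k| ≤ 1 * ‖y‖ := mul_le_mul (kd_abs i j) (ci k) (abs_nonneg _) zero_le_one
    rw [one_mul] at h1
    refine mul_le_mul h1 ?_ (abs_nonneg _) hy0.le
    have h2 : 0 ≤ ((n:ℝ) - 2) * (3 * n - 2) * q1 := by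
      apply mul_nonneg _ p1.le; nlinarith
    have h3 : 0 ≤ n * (2 * (n - 1) * ((n:ℝ) - 2)) * (e ^ 2 * q2) := by
      apply mul_nonneg (mul_nonneg (by linarith) (by nlinarith)) (by positivity)
    rw [show (-((n:ℝ) - 2) * (3 * n - 2) * q1 - n * (2 * (n - 1) * (n - 2)) * e ^ 2 * q2)
      = -(((n:ℝ) - 2) * (3 * n - 2) * q1 + n * (2 * (n - 1) * (n - 2)) * (e ^ 2 * q2)) by ring, abs_neg,
      abs_of_nonneg (by linarith), add_mul]
    have h4' : n * (2 * (n - 1) * ((n:ℝ) - 2)) ≤ 2 * (n:ℝ) ^ 3 := by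
      have : (n:ℝ) * ((n - 1) * (n - 2)) ≤ n * n ^ 2 := by gcongr; nlinarith
      nlinarith
    have h5 : n * (2 * (n - 1) * ((n:ℝ) - 2)) * (e ^ 2 * q2) ≤ 2 * (n:ℝ) ^ 3 * q1 := by gcongr
    have h6 : ((n:ℝ) - 2) * (3 * n - 2) * q1 ≤ 3 * n ^ 2 * q1 :=
      mul_le_mul_of_nonneg_right (by nlinarith) p1.le
    linarith
  have t2 : |(kd i k * y j + y i * kd j k) * q1 - n * (y i * y j * y k) * q2| ≤ ‖y‖ * ((2 + n) * q1) := by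
    have a1 : |(kd i k * y j + y i * kd j k) * q1| ≤ ‖y‖ * (2 * q1) := by
      rw [abs_mul, abs_of_pos p1, ← mul_assoc]
      gcongr
      refine (abs_add_le _ _).trans ?_
      rw [abs_mul, abs_mul]
      have := mul_le_mul (kd_abs i k) (ci j) (abs_nonneg _) zero_le_one
      have := mul_le_mul (ci i) (kd_abs j k) (abs_nonneg _) hy0.le
      linarith
    have a2 : |n * (y i * y j * y k) * q2| ≤ ‖y‖ * (n * q1) := by
      rw [abs_mul, abs_mul, abs_mul, abs_mul, abs_of_pos p2, abs_of_nonneg (by linarith : (0:ℝ) ≤ n)]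
      have h1 := mul_le_mul (mul_le_mul (ci i) (ci j) (abs_nonneg _) (norm_nonneg _)) (ci k) (abs_nonneg _) (by positivity)
      calc n * (|y i| * |y j| * |y k|) * q2 ≤ n * (‖y‖ * ‖y‖ * ‖y‖) * q2 := by gcongr
        _ = n * ‖y‖ * (‖y‖ ^ 2 * q2) := by ring
        _ ≤ n * ‖y‖ * q1 := by gcongr
        _ = _ := by ring
    refine (abs_sub _ _).trans ?_
    linarith
  have t3 : |((n:ℝ) - 2) ^ 2 * ((kd i k * y j + y i * kd j k) * q1 - n * (y i * y j * y k) * q2)|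
      ≤ n ^ 2 * (‖y‖ * ((2 + n) * q1)) := by
    rw [abs_mul, abs_of_nonneg (sq_nonneg _)]
    gcongr
    · linarith
    · linarith
  have h5 : ‖y‖ * q1 ≤ ‖y‖ ^ (1 - (n:ℝ)) := by
    rw [show 1 - (n:ℝ) = 1 + -n by ring, Real.rpow_add hy0, Real.rpow_one]
    gcongr
  refine (abs_add_le _ _).trans ((add_le_add t1 t3).trans ?_)
  calc _ = (3 * n ^ 2 + 2 * n ^ 3 + n ^ 2 * (2 + n)) * (‖y‖ * q1) := by ring
    _ ≤ (20 * n ^ 3) * (‖y‖ * q1) := by gcongr; nlinarith [sq_nonneg (n:ℝ)]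
    _ ≤ _ := by gcongr

/-! reflection -/
def sg (l i : Fin n) : ℝ := if i = l then -1 else 1
def rf (l : Fin n) (z : Euc n) : Euc n := WithLp.toLp 2 (fun i => sg l i * z i)

lemma rf_apply (l : Fin n) (z : Euc n) (i : Fin n) : rf l z i = sg l i * z i := rfl

lemma sg_mul (l i : Fin n) : sg l i * sg l i = 1 := by unfold sg; split_ifs <;> norm_num
lemma sg_abs (l i : Fin n) : |sg l i| = 1 := by unfold sg; split_ifs <;> norm_num

lemma rf_norm (l : Fin n) (z : Euc n) : ‖rf l z‖ = ‖z‖ := by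
  have : ‖rf l z‖ ^ 2 = ‖z‖ ^ 2 := by
    rw [normsq_eq, normsq_eq]
    refine Finset.sum_congr rfl fun i _ => ?_
    rw [rf_apply, mul_pow, sq, sg_mul, one_mul]
  exact (sq_eq_sq₀ (norm_nonneg _) (norm_nonneg _)).1 this

lemma rf_sub (l : Fin n) (z y : Euc n) : rf l (y - z) = rf l y - rf l z := by
  ext i; simp [rf_apply, mul_sub]

lemma rf_bd {l : Fin n} {y : Euc n} (hy : y l = 0) : rf l y = y := by
  ext i; rw [rf_apply]; unfold sg; split_ifs with h
  · subst h; simp [hy]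
  · simp

lemma rf_dist {l : Fin n} {y z : Euc n} (hy : 0 ≤ y l) (hz : 0 ≤ z l) : ‖y - z‖ ≤ ‖y - rf l z‖ := by
  rw [← sq_le_sq₀ (norm_nonneg _) (norm_nonneg _), normsq_eq, normsq_eq]
  refine Finset.sum_le_sum fun i _ => ?_
  simp only [PiLp.sub_apply, rf_apply, sg]
  split_ifs with h
  · subst h; nlinarith [mul_nonneg hy hz]
  · simp

lemma qq_rf (l : Fin n) (e s : ℝ) (y : Euc n) : qq e s (rf l y) = qq e s y := by
  simp [qq, rf_norm]

lemma kd_sg (l i j : Fin n) : sg l i * sg l j * kd i j = kd i j := by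
  unfold kd; split_ifs with h
  · subst h; rw [sg_mul, one_mul]
  · simp

lemma Gk_rf (l : Fin n) (e : ℝ) (j i : Fin n) (y : Euc n) :
    Gk n e j i (rf l y) = sg l i * sg l j * Gk n e j i y := by
  unfold Gk
  rw [qq_rf, qq_rf, rf_apply, rf_apply]
  conv_lhs => rw [← kd_sg l i j]
  ring

lemma Lop_rf (hn : 0 < n) (l : Fin n) {e : ℝ} (he : 0 < e) (j i k : Fin n) (y : Euc n) :
    Lop (Gk n e j) i k (rf l y) = sg l i * sg l k * sg l j * Lop (Gk n e j) i k y := by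
  rw [Gk_Lop hn he, Gk_Lop hn he, qq_rf, qq_rf, rf_apply, rf_apply, rf_apply]
  have e1 : kd i j * sg l k = sg l i * sg l k * sg l j * kd i j := by
    conv_lhs => rw [← kd_sg l i j]
    ring
  have e2 : kd k j * sg l i = sg l i * sg l k * sg l j * kd k j := by
    conv_lhs => rw [← kd_sg l k j]
    ring
  have e3 : kd i k * sg l j = sg l i * sg l k * sg l j * kd i k := by
    conv_lhs => rw [← kd_sg l i k]
    ring
  linear_combination (y k * (-2 * n * (n - 2) * (qq e ((n:ℝ) / 2) y
          + (n - 1) * e ^ 2 * qq e ((n:ℝ) / 2 + 1) y))) * e1 +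
    (y i * (-2 * n * (n - 2) * (qq e ((n:ℝ) / 2) y
          + (n - 1) * e ^ 2 * qq e ((n:ℝ) / 2 + 1) y))) * e2 +
    (y j * (2 * n * (n - 2) * (qq e ((n:ℝ) / 2) y + e ^ 2 * qq e ((n:ℝ) / 2 + 1) y))) * e3

def Kt (n : ℕ) (e : ℝ) (l j : Fin n) (z : Euc n) (i : Fin n) (y : Euc n) : ℝ :=
  Gk n e j i (y - z) + sg l j * Gk n e j i (y - rf l z)

lemma Gks_cd {e : ℝ} (he : 0 < e) (j i : Fin n) (z : Euc n) :
    ContDiff ℝ (⊤ : ℕ∞) (fun y => Gk n e j i (y - z)) :=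
  (Gk_cd he j i).comp (contDiff_id.sub contDiff_const)

lemma Kt_cd {e : ℝ} (he : 0 < e) (l j : Fin n) (z : Euc n) (i : Fin n) :
    ContDiff ℝ (⊤ : ℕ∞) (Kt n e l j z i) := by
  unfold Kt
  exact (Gks_cd he j i z).add (contDiff_const.mul (Gks_cd he j i _))

lemma Kt_pd {e : ℝ} (he : 0 < e) (l j : Fin n) (z : Euc n) (i k : Fin n) (y : Euc n) :
    pd k (Kt n e l j z i) y = pd k (Gk n e j i) (y - z) + sg l j * pd k (Gk n e j i) (y - rf l z) := by
  unfold Kt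
  rw [pd_add k (cdDiff (Gks_cd he j i z) y) ((cdDiff (Gks_cd he j i _) y).const_mul _),
    pd_const_mul k _ (cdDiff (Gks_cd he j i _) y), pd_shift, pd_shift]

lemma Kt_Lop {e : ℝ} (he : 0 < e) (l j : Fin n) (z : Euc n) (i k : Fin n) (y : Euc n) :
    Lop (Kt n e l j z) i k y = Lop (Gk n e j) i k (y - z) + sg l j * Lop (Gk n e j) i k (y - rf l z) := by
  simp only [Lop, Kt_pd he, Finset.sum_add_distrib, ← Finset.mul_sum]
  ring

lemma Kt_divLop (hn : 0 < n) {e : ℝ} (he : 0 < e) (l j : Fin n) (z : Euc n) (i : Fin n) (y : Euc n) :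
    ∑ k, pd k (Lop (Kt n e l j z) i k) y
      = -(2 * n * (n + 2) * (n - 1) * (n - 2)) * e ^ 4 * (qq e ((n:ℝ) / 2 + 2) (y - z)
        + sg l j * qq e ((n:ℝ) / 2 + 2) (y - rf l z)) * kd i j := by
  have L := fun k => Lop_cd' (Gk_cd he j) i k
  have hs : ∀ (k : Fin n) (w : Euc n), ContDiff ℝ (⊤ : ℕ∞) (fun y => Lop (Gk n e j) i k (y - w)) :=
    fun k w => (L k).comp (contDiff_id.sub contDiff_const)
  have : ∀ k, pd k (Lop (Kt n e l j z) i k) y = pd k (Lop (Gk n e j) i k) (y - z)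
      + sg l j * pd k (Lop (Gk n e j) i k) (y - rf l z) := by
    intro k
    have e1 : Lop (Kt n e l j z) i k = fun y => Lop (Gk n e j) i k (y - z) + sg l j * Lop (Gk n e j) i k (y - rf l z) := by
      ext y; exact Kt_Lop he l j z i k y
    rw [e1, pd_add k (cdDiff (hs k z) y) ((cdDiff (hs k _) y).const_mul _),
      pd_const_mul k _ (cdDiff (hs k _) y), pd_shift, pd_shift]
  simp_rw [this]
  rw [Finset.sum_add_distrib, ← Finset.mul_sum, Gk_divLop hn he, Gk_divLop hn he]
  ring

lemma sub_rf {l : Fin n} {y : Euc n} (hy : y l = 0) (z : Euc n) : y - rf l z = rf l (y - z) := by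
  rw [rf_sub, rf_bd hy]

lemma Kt_bd {e : ℝ} (l j : Fin n) (z y : Euc n) (hy : y l = 0) : Kt n e l j z l y = 0 := by
  unfold Kt
  rw [sub_rf hy, Gk_rf]
  have h1 : sg l l = -1 := by simp [sg]
  rw [h1]
  linear_combination (-Gk n e j l (y - z)) * sg_mul l j

lemma Kt_bd' (hn : 0 < n) {e : ℝ} (he : 0 < e) (l j : Fin n) (z y : Euc n) (hy : y l = 0) (i : Fin n) (hi : i ≠ l) :
    Lop (Kt n e l j z) i l y = 0 := by
  rw [Kt_Lop he, sub_rf hy, Lop_rf hn l he]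
  have h1 : sg l l = -1 := by simp [sg]
  have h2 : sg l i = 1 := by simp [sg, hi]
  rw [h1, h2]
  linear_combination (-Lop (Gk n e j) i l (y - z)) * sg_mul l j

lemma Kt_bound (hn : 4 ≤ n) {e : ℝ} (he : 0 < e) (l j i : Fin n) {z y : Euc n} (hy : 0 ≤ y l) (hz : 0 ≤ z l)
    (hne : y ≠ z) : |Kt n e l j z i y| ≤ 40 * n ^ 3 * ‖y - z‖ ^ (2 - (n:ℝ)) := by
  have h4 : (4:ℝ) ≤ n := by exact_mod_cast hn
  have h0 : y - z ≠ 0 := sub_ne_zero.2 hne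
  have hp : 0 < ‖y - z‖ := by simpa using h0
  have h1 := rf_dist hy hz
  have h0' : y - rf l z ≠ 0 := by
    intro h; rw [h, norm_zero] at h1; linarith
  have a := Gk_bound hn he j i h0
  have b := Gk_bound hn he j i h0'
  have d : ‖y - rf l z‖ ^ (2 - (n:ℝ)) ≤ ‖y - z‖ ^ (2 - (n:ℝ)) :=
    Real.rpow_le_rpow_of_nonpos hp h1 (by linarith)
  unfold Kt
  refine (abs_add_le _ _).trans ?_
  rw [abs_mul, sg_abs, one_mul]
  have : 20 * (n:ℝ) ^ 3 * ‖y - rf l z‖ ^ (2 - (n:ℝ)) ≤ 20 * (n:ℝ) ^ 3 * ‖y - z‖ ^ (2 - (n:ℝ)) := by gcongr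
  linarith

lemma Kt_pd_bound (hn : 4 ≤ n) {e : ℝ} (he : 0 < e) (l j i k : Fin n) {z y : Euc n} (hy : 0 ≤ y l) (hz : 0 ≤ z l)
    (hne : y ≠ z) : |pd k (Kt n e l j z i) y| ≤ 40 * n ^ 3 * ‖y - z‖ ^ (1 - (n:ℝ)) := by
  have h4 : (4:ℝ) ≤ n := by exact_mod_cast hn
  have h0 : y - z ≠ 0 := sub_ne_zero.2 hne
  have hp : 0 < ‖y - z‖ := by simpa using h0
  have h1 := rf_dist hy hz
  have h0' : y - rf l z ≠ 0 := by
    intro h; rw [h, norm_zero] at h1; linarith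
  have a := Gk_pd_bound hn he j i k h0
  have b := Gk_pd_bound hn he j i k h0'
  have d : ‖y - rf l z‖ ^ (1 - (n:ℝ)) ≤ ‖y - z‖ ^ (1 - (n:ℝ)) :=
    Real.rpow_le_rpow_of_nonpos hp h1 (by linarith)
  rw [Kt_pd he]
  refine (abs_add_le _ _).trans ?_
  rw [abs_mul, sg_abs, one_mul]
  have : 20 * (n:ℝ) ^ 3 * ‖y - rf l z‖ ^ (1 - (n:ℝ)) ≤ 20 * (n:ℝ) ^ 3 * ‖y - z‖ ^ (1 - (n:ℝ)) := by gcongr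
  linarith

end Part7

section Part8

variable {n : ℕ}

def Mm (χ : Euc n → ℝ) (K : Fin n → Euc n → ℝ) (i k : Fin n) (y : Euc n) : ℝ :=
  pd i χ y * K k y + pd k χ y * K i y - (2 / (n:ℝ)) * (∑ m, pd m χ y * K m y) * kd i k

def Ee (χ : Euc n → ℝ) (K : Fin n → Euc n → ℝ) (f : Fin n → Euc n → ℝ) (F : Fin n → Fin n → Euc n → ℝ)
    (y : Euc n) : ℝ :=
  Wt n y * ∑ i, ∑ k, F i k y * (χ y * Lop K i k y + Mm χ K i k y)
  + 2 * ∑ i, ∑ k, f i y * (pd k (Wt n) y * (χ y * Lop K i k y + Mm χ K i k y)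
    + Wt n y * (pd k χ y * Lop K i k y + pd k (Mm χ K i k) y))

lemma Lop_mul {χ : Euc n → ℝ} {K : Fin n → Euc n → ℝ} (hχ : ContDiff ℝ (⊤ : ℕ∞) χ)
    (hK : ∀ i, ContDiff ℝ (⊤ : ℕ∞) (K i)) (i k : Fin n) (y : Euc n) :
    Lop (fun i y => χ y * K i y) i k y = χ y * Lop K i k y + Mm χ K i k y := by
  simp only [Lop, Mm]
  have := fun a b => pd_mul (x := y) a (cdDiff hχ y) (cdDiff (hK b) y)
  simp only [this, Finset.sum_add_distrib, ← Finset.mul_sum]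
  ring

lemma Mm_cd {χ : Euc n → ℝ} {K : Fin n → Euc n → ℝ} (hχ : ContDiff ℝ (⊤ : ℕ∞) χ)
    (hK : ∀ i, ContDiff ℝ (⊤ : ℕ∞) (K i)) (i k : Fin n) : ContDiff ℝ (⊤ : ℕ∞) (Mm χ K i k) := by
  unfold Mm
  exact (((hχ.pd' i).mul (hK k)).add ((hχ.pd' k).mul (hK i))).sub
    ((contDiff_const.mul (ContDiff.sum fun m _ => (hχ.pd' m).mul (hK m))).mul contDiff_const)

lemma starK (hn : 0 < n) {l : Fin n} {f : Fin n → Euc n → ℝ} {F : Fin n → Fin n → Euc n → ℝ} (H : WF l f F)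
    {χ : Euc n → ℝ} {K : Fin n → Euc n → ℝ} (hχ : ContDiff ℝ (⊤ : ℕ∞) χ) (hχc : HasCompactSupport χ)
    (hχ0 : (0 : Euc n) ∉ tsupport χ) (hχl : ∀ y : Euc n, y l = 0 → pd l χ y = 0)
    (hK : ∀ i, ContDiff ℝ (⊤ : ℕ∞) (K i)) (hKl : ∀ y : Euc n, y l = 0 → K l y = 0)
    (hKt : ∀ y : Euc n, y l = 0 → ∀ i, i ≠ l → Lop K i l y = 0) :
    ∫ y in {x : Euc n | 0 ≤ x l}, (Ee χ K f F y + 2 * Wt n y * χ y *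
      ∑ i, f i y * ∑ k, pd k (Lop K i k) y) = 0 := by
  have S := star hn H (Y := fun i y => χ y * K i y) (fun i => hχ.mul (hK i)) (fun i => hχc.mul_right)
    (fun i h => hχ0 (closure_mono (fun x hx => by
      simp only [Function.mem_support] at hx ⊢; exact left_ne_zero_of_mul hx) h))
    (fun x hx => by simp [hKl x hx])
    (fun x hx i hi => by
      rw [Lop_mul hχ hK, hKt x hx i hi]
      simp [Mm, hχl x hx, hKl x hx, kd, hi])
  refine Eq.trans ?_ S
  refine integral_congr_ae (Filter.Eventually.of_forall fun y => ?_)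
  dsimp only
  have e1 : ∀ i k, Lop (fun i y => χ y * K i y) i k = fun y => χ y * Lop K i k y + Mm χ K i k y := by
    intro i k; ext y; exact Lop_mul hχ hK i k y
  have e2 : ∀ i k, pd k (fun y => χ y * Lop K i k y + Mm χ K i k y) y
      = χ y * pd k (Lop K i k) y + (pd k χ y * Lop K i k y + pd k (Mm χ K i k) y) := by
    intro i k
    have dL := cdDiff (Lop_cd' hK i k) y
    rw [pd_add k ((cdDiff hχ y).fun_mul dL) (cdDiff (Mm_cd hχ hK i k) y), pd_mul k (cdDiff hχ y) dL]
    ring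
  simp only [e1, e2, Ee]
  have e3 : 2 * Wt n y * χ y * ∑ i, f i y * ∑ k, pd k (Lop K i k) y
      = 2 * ∑ i, ∑ k, f i y * (Wt n y * (χ y * pd k (Lop K i k) y)) := by
    simp only [Finset.mul_sum]
    exact Finset.sum_congr rfl fun m _ => Finset.sum_congr rfl fun l _ => by ring
  rw [e3, add_assoc, ← mul_add]
  congr 2
  simp only [← Finset.sum_add_distrib]
  exact Finset.sum_congr rfl fun m _ => Finset.sum_congr rfl fun l _ => by ring

lemma Wt_le (y : Euc n) : |Wt n y| ≤ 1 := by
  rw [abs_of_pos (Wt_pos y)]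
  exact inv_le_one_of_one_le₀ (one_le_pow₀ (by nlinarith [sq_nonneg ‖y‖]))

lemma Wt_pd (k : Fin n) (y : Euc n) : |pd k (Wt n) y| ≤ 2 * n * ‖y‖ := by
  have hb : (0:ℝ) < 1 + ‖y‖ ^ 2 := by positivity
  have hd : HasDerivAt (fun t : ℝ => (t ^ n)⁻¹) (-(n * (1 + ‖y‖ ^ 2) ^ (n - 1)) / ((1 + ‖y‖ ^ 2) ^ n) ^ 2)
    (1 + ‖y‖ ^ 2) := (hasDerivAt_pow n _).fun_inv (by positivity)
  have := pd_comp (f := fun y : Euc n => 1 + ‖y‖ ^ 2) k hd ((differentiableAt_const _).add (cdDiff cd_normsq y))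
  unfold Wt
  rw [this, pd_add k (differentiableAt_const _) (cdDiff cd_normsq y), pd_const, pd_normsq, zero_add]
  rw [abs_mul, abs_div, abs_neg, abs_of_nonneg (by positivity : (0:ℝ) ≤ n * (1 + ‖y‖ ^ 2) ^ (n - 1)),
    abs_of_pos (by positivity : (0:ℝ) < ((1 + ‖y‖ ^ 2) ^ n) ^ 2), abs_mul, abs_two]
  have h1 : (1 + ‖y‖ ^ 2) ^ (n - 1) ≤ ((1 + ‖y‖ ^ 2) ^ n) ^ 2 := by
    rw [← pow_mul]
    exact pow_le_pow_right₀ (by nlinarith [sq_nonneg ‖y‖]) (by omega)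
  have h2 : n * (1 + ‖y‖ ^ 2) ^ (n - 1) / ((1 + ‖y‖ ^ 2) ^ n) ^ 2 ≤ (n:ℝ) := by
    rw [div_le_iff₀ (by positivity)]; gcongr
  have := mul_le_mul h2 (mul_le_mul_of_nonneg_left (abs_coord_le y k) (by norm_num : (0:ℝ) ≤ 2)) (by positivity) (by positivity)
  linarith

lemma trc_bound (hn : 0 < n) (A : Fin n → ℝ) {B : ℝ} (hA : ∀ m, |A m| ≤ B) (i k : Fin n) :
    |(2 / (n:ℝ)) * (∑ m, A m) * kd i k| ≤ 2 * B := by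
  have hn' : (0:ℝ) < n := by positivity
  have hB : 0 ≤ B := (abs_nonneg _).trans (hA i)
  rw [abs_mul, abs_mul, abs_of_pos (by positivity : (0:ℝ) < 2 / n)]
  have h1 : |∑ m, A m| ≤ n * B := by
    refine (Finset.abs_sum_le_sum_abs _ _).trans ((Finset.sum_le_sum fun m _ => hA m).trans ?_)
    simp
  calc 2 / (n:ℝ) * |∑ m, A m| * |kd i k| ≤ 2 / (n:ℝ) * (n * B) * 1 := by
        gcongr; exact kd_abs i k
    _ = 2 * B := by field_simp

lemma Lop_bound (hn : 0 < n) {K : Fin n → Euc n → ℝ} {y : Euc n} {B : ℝ} (h : ∀ i k, |pd k (K i) y| ≤ B) (i k : Fin n) :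
    |Lop K i k y| ≤ 4 * B := by
  unfold Lop
  have := trc_bound hn (fun m => pd m (K m) y) (fun m => h m m) i k
  refine (abs_sub _ _).trans ((add_le_add (abs_add_le _ _) le_rfl).trans ?_)
  linarith [h k i, h i k]

lemma Mm_bound (hn : 0 < n) {χ : Euc n → ℝ} {K : Fin n → Euc n → ℝ} {y : Euc n} {B c : ℝ}
    (h : ∀ i, |K i y| ≤ B) (hc : ∀ i, |pd i χ y| ≤ c) (i k : Fin n) : |Mm χ K i k y| ≤ 4 * (c * B) := by
  have hc0 : 0 ≤ c := (abs_nonneg _).trans (hc i)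
  have m : ∀ i k, |pd i χ y * K k y| ≤ c * B := fun i k => by
    rw [abs_mul]; exact mul_le_mul (hc i) (h k) (abs_nonneg _) hc0
  unfold Mm
  have := trc_bound hn (fun m => pd m χ y * K m y) (fun a => m a a) i k
  refine (abs_sub _ _).trans ((add_le_add (abs_add_le _ _) le_rfl).trans ?_)
  linarith [m i k, m k i]

lemma Mm_pd_bound (hn : 0 < n) {χ : Euc n → ℝ} {K : Fin n → Euc n → ℝ} (hχ : ContDiff ℝ (⊤ : ℕ∞) χ)
    (hK : ∀ i, ContDiff ℝ (⊤ : ℕ∞) (K i)) {y : Euc n} {B B1 c c2 : ℝ}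
    (h : ∀ i, |K i y| ≤ B) (h1 : ∀ i k, |pd k (K i) y| ≤ B1) (hc : ∀ i, |pd i χ y| ≤ c)
    (hc2 : ∀ i k, |pd k (pd i χ) y| ≤ c2) (i k : Fin n) : |pd k (Mm χ K i k) y| ≤ 4 * (c2 * B + c * B1) := by
  have hc0 : 0 ≤ c := (abs_nonneg _).trans (hc i)
  have hc20 : 0 ≤ c2 := (abs_nonneg _).trans (hc2 i i)
  have hp : ∀ a b, HP k (fun y => pd a χ y * K b y) (pd k (pd a χ) y * K b y + pd a χ y * pd k (K b) y) y := fun a b =>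
    HP.mul ⟨cdDiff (hχ.pd' a) y, rfl⟩ ⟨cdDiff (hK b) y, rfl⟩
  have m : ∀ a b, |pd k (pd a χ) y * K b y + pd a χ y * pd k (K b) y| ≤ c2 * B + c * B1 := fun a b => by
    refine (abs_add_le _ _).trans ?_
    rw [abs_mul, abs_mul]
    exact add_le_add (mul_le_mul (hc2 a k) (h b) (abs_nonneg _) hc20) (mul_le_mul (hc a) (h1 b k) (abs_nonneg _) hc0)
  have hs : HP k (fun y => ∑ m, pd m χ y * K m y) (∑ m, (pd k (pd m χ) y * K m y + pd m χ y * pd k (K m) y)) y := by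
    refine ⟨DifferentiableAt.fun_sum fun m _ => (hp m m).1, ?_⟩
    rw [pd_sum (f := fun m y => pd m χ y * K m y) k (fun m _ => (hp m m).1)]
    exact Finset.sum_congr rfl fun m _ => (hp m m).2
  have e : pd k (Mm χ K i k) y = _ := (((hp i k).add (hp k i)).sub ((hs.cm (2 / (n:ℝ))).mul
    (⟨differentiableAt_const _, pd_const k _ y⟩ : HP k (fun _ => kd i k) 0 y))).2
  rw [e, mul_zero, add_zero]
  have := trc_bound hn (fun a => pd k (pd a χ) y * K a y + pd a χ y * pd k (K a) y) (fun a => m a a) i k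
  refine (abs_sub _ _).trans ((add_le_add (abs_add_le _ _) le_rfl).trans ?_)
  linarith [m i k, m k i]

lemma Ee_bound (hn : 0 < n) {χ : Euc n → ℝ} {K : Fin n → Euc n → ℝ} (hχ : ContDiff ℝ (⊤ : ℕ∞) χ)
    (hK : ∀ i, ContDiff ℝ (⊤ : ℕ∞) (K i)) (f : Fin n → Euc n → ℝ) (F : Fin n → Fin n → Euc n → ℝ) {y : Euc n} {B B1 c0 c c2 : ℝ}
    (h : ∀ i, |K i y| ≤ B) (h1 : ∀ i k, |pd k (K i) y| ≤ B1) (hc0 : |χ y| ≤ c0) (hc : ∀ i, |pd i χ y| ≤ c)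
    (hc2 : ∀ i k, |pd k (pd i χ) y| ≤ c2) :
    |Ee χ K f F y| ≤ 16 * n ^ 2 * ((∑ i, ∑ k, |F i k y| + ‖y‖ * ∑ i, |f i y|) * (c0 * B1 + c * B)
      + (∑ i, |f i y|) * (c * B1 + c2 * B)) := by
  have i0 : Fin n := ⟨0, hn⟩
  have hc' : 0 ≤ c := (abs_nonneg _).trans (hc i0)
  have hB : 0 ≤ B := (abs_nonneg _).trans (h i0)
  have hB1 : 0 ≤ B1 := (abs_nonneg _).trans (h1 i0 i0)
  have hc0' : 0 ≤ c0 := (abs_nonneg _).trans hc0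
  have hc2' : 0 ≤ c2 := (abs_nonneg _).trans (hc2 i0 i0)
  have hn1 : (1:ℝ) ≤ n := by exact_mod_cast hn
  have L := Lop_bound hn h1
  have T : ∀ i k, |χ y * Lop K i k y + Mm χ K i k y| ≤ 4 * (c0 * B1 + c * B) := fun i k => by
    refine (abs_add_le _ _).trans ?_
    rw [abs_mul]
    have a := mul_le_mul hc0 (L i k) (abs_nonneg _) hc0'
    have b := Mm_bound hn h hc i k
    linarith
  have U : ∀ i k, |pd k χ y * Lop K i k y + pd k (Mm χ K i k) y| ≤ 8 * (c * B1 + c2 * B) := fun i k => by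
    refine (abs_add_le _ _).trans ?_
    rw [abs_mul]
    have a := mul_le_mul (hc k) (L i k) (abs_nonneg _) hc'
    have b := Mm_pd_bound hn hχ hK h h1 hc hc2 i k
    have := mul_nonneg hc2' hB
    linarith
  have a1 : |Wt n y * ∑ i, ∑ k, F i k y * (χ y * Lop K i k y + Mm χ K i k y)|
      ≤ (∑ i, ∑ k, |F i k y|) * (4 * (c0 * B1 + c * B)) := by
    rw [abs_mul]
    refine (mul_le_mul (Wt_le y) le_rfl (abs_nonneg _) zero_le_one).trans ?_
    rw [one_mul, Finset.sum_mul]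
    refine (Finset.abs_sum_le_sum_abs _ _).trans (Finset.sum_le_sum fun i _ => ?_)
    rw [Finset.sum_mul]
    refine (Finset.abs_sum_le_sum_abs _ _).trans (Finset.sum_le_sum fun k _ => ?_)
    rw [abs_mul]; exact mul_le_mul_of_nonneg_left (T i k) (abs_nonneg _)
  have a2 : |∑ i, ∑ k, f i y * (pd k (Wt n) y * (χ y * Lop K i k y + Mm χ K i k y)
    + Wt n y * (pd k χ y * Lop K i k y + pd k (Mm χ K i k) y))| ≤ (∑ i, |f i y|) *
      (n * (2 * n * ‖y‖ * (4 * (c0 * B1 + c * B)) + 8 * (c * B1 + c2 * B))) := by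
    rw [Finset.sum_mul]
    refine (Finset.abs_sum_le_sum_abs _ _).trans (Finset.sum_le_sum fun i _ => ?_)
    refine (Finset.abs_sum_le_sum_abs _ _).trans ?_
    have : ∀ k, |f i y * (pd k (Wt n) y * (χ y * Lop K i k y + Mm χ K i k y)
      + Wt n y * (pd k χ y * Lop K i k y + pd k (Mm χ K i k) y))| ≤ |f i y| * (2 * n * ‖y‖ * (4 * (c0 * B1 + c * B)) + 8 * (c * B1 + c2 * B)) := by
      intro k
      rw [abs_mul]
      refine mul_le_mul_of_nonneg_left ?_ (abs_nonneg _)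
      refine (abs_add_le _ _).trans ?_
      rw [abs_mul, abs_mul]
      have a := mul_le_mul (Wt_pd k y) (T i k) (abs_nonneg _) (by positivity)
      have b := mul_le_mul (Wt_le y) (U i k) (abs_nonneg _) zero_le_one
      linarith
    refine (Finset.sum_le_sum fun k _ => this k).trans ?_
    simp only [Finset.sum_const, Finset.card_univ, Fintype.card_fin, nsmul_eq_mul]
    exact le_of_eq (by ring)
  have hF : 0 ≤ ∑ i, ∑ k, |F i k y| := Finset.sum_nonneg fun i _ => Finset.sum_nonneg fun k _ => abs_nonneg _
  have hf : 0 ≤ ∑ i, |f i y| := Finset.sum_nonneg fun i _ => abs_nonneg _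
  unfold Ee
  refine (abs_add_le _ _).trans ?_
  rw [abs_mul 2, abs_two]
  set sF := ∑ i, ∑ k, |F i k y|
  set sf := ∑ i, |f i y|
  set P := c0 * B1 + c * B
  set Q := c * B1 + c2 * B
  have hP : 0 ≤ P := by positivity
  have hQ : 0 ≤ Q := by positivity
  have hnn : (n:ℝ) ≤ n ^ 2 := by nlinarith
  have hn2 : (1:ℝ) ≤ n ^ 2 := by nlinarith
  have h1 : 4 * (sF * P) ≤ 16 * n ^ 2 * (sF * P) := by gcongr; nlinarith
  have h2 : 16 * n * (sf * Q) ≤ 16 * n ^ 2 * (sf * Q) := by gcongr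
  calc _ ≤ sF * (4 * P) + 2 * (sf * (n * (2 * n * ‖y‖ * (4 * P) + 8 * Q))) := by linarith
    _ = 4 * (sF * P) + 16 * n ^ 2 * (‖y‖ * sf * P) + 16 * n * (sf * Q) := by ring
    _ ≤ 16 * n ^ 2 * (sF * P) + 16 * n ^ 2 * (‖y‖ * sf * P) + 16 * n ^ 2 * (sf * Q) := by linarith
    _ = _ := by ring

end Part8

section Part9

variable {n : ℕ}

def eta (s : ℝ) (y : Euc n) : ℝ := Real.smoothTransition (3 - ‖y‖ ^ 2 / s ^ 2)

lemma st_cd : ContDiff ℝ (⊤ : ℕ∞) Real.smoothTransition := Real.smoothTransition.contDiff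

lemma st_dcd : ContDiff ℝ (⊤ : ℕ∞) (deriv Real.smoothTransition) := by
  have := st_cd.iterate_deriv 1
  simpa using this

lemma eta_cd (s : ℝ) : ContDiff ℝ (⊤ : ℕ∞) (eta s : Euc n → ℝ) :=
  st_cd.comp (contDiff_const.sub (cd_normsq.div_const _))

lemma cd_arg (s : ℝ) : ContDiff ℝ (⊤ : ℕ∞) (fun y : Euc n => 3 - ‖y‖ ^ 2 / s ^ 2) := 
  contDiff_const.sub (cd_normsq.div_const _)

lemma arg_pd (s : ℝ) (k : Fin n) (y : Euc n) : pd k (fun y : Euc n => 3 - ‖y‖ ^ 2 / s ^ 2) y = -(2 * y k / s ^ 2) := by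
  have e : (fun y : Euc n => 3 - ‖y‖ ^ 2 / s ^ 2) = fun y => 3 - (s ^ 2)⁻¹ * ‖y‖ ^ 2 := by
    ext y; ring
  rw [e, pd_sub k (differentiableAt_const _) ((cdDiff cd_normsq y).const_mul _), pd_const,
    pd_const_mul k _ (cdDiff cd_normsq y), pd_normsq]
  ring

lemma eta_pd (s : ℝ) (k : Fin n) (y : Euc n) :
    pd k (eta s) y = deriv Real.smoothTransition (3 - ‖y‖ ^ 2 / s ^ 2) * -(2 * y k / s ^ 2) := by
  have h := pd_comp (g := Real.smoothTransition) (f := fun y : Euc n => 3 - ‖y‖ ^ 2 / s ^ 2) (x := y) k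
    (st_cd.differentiable (by simp) _).hasDerivAt (cdDiff (cd_arg s) y)
  rw [arg_pd] at h
  exact h

lemma eta_pd2 (s : ℝ) (i k : Fin n) (y : Euc n) :
    pd k (pd i (eta s)) y = deriv (deriv Real.smoothTransition) (3 - ‖y‖ ^ 2 / s ^ 2) * -(2 * y k / s ^ 2) * -(2 * y i / s ^ 2)
      + deriv Real.smoothTransition (3 - ‖y‖ ^ 2 / s ^ 2) * -(2 * kd i k / s ^ 2) := by
  have e : pd i (eta s : Euc n → ℝ) = fun y => deriv Real.smoothTransition (3 - ‖y‖ ^ 2 / s ^ 2) * (-(2 / s ^ 2) * y i) := by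
    ext y; rw [eta_pd]; ring
  have h := pd_comp (g := deriv Real.smoothTransition) (f := fun y : Euc n => 3 - ‖y‖ ^ 2 / s ^ 2) (x := y) k
    (st_dcd.differentiable (by simp) _).hasDerivAt (cdDiff (cd_arg s) y)
  have c1 : ContDiff ℝ (⊤ : ℕ∞) (fun y : Euc n => deriv Real.smoothTransition (3 - ‖y‖ ^ 2 / s ^ 2)) :=
    st_dcd.comp (cd_arg s)
  rw [e, pd_mul k (cdDiff c1 y) ((cdDiff (cd_coord i) y).const_mul _), h, arg_pd,
    pd_const_mul k _ (cdDiff (cd_coord i) y), pd_coord]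
  ring

lemma st_deriv2_zero {t : ℝ} (h : t < 0 ∨ 1 < t) : deriv (deriv Real.smoothTransition) t = 0 := by
  rcases h with h | h
  · have : deriv Real.smoothTransition =ᶠ[nhds t] fun _ => 0 := by
      filter_upwards [Iio_mem_nhds h] with s hs
      exact st_deriv_zero (Or.inl hs)
    rw [this.deriv_eq]; simp
  · have : deriv Real.smoothTransition =ᶠ[nhds t] fun _ => 0 := by
      filter_upwards [Ioi_mem_nhds h] with s hs
      exact st_deriv_zero (Or.inr hs)
    rw [this.deriv_eq]; simp

lemma bdd_of {g : ℝ → ℝ} (hg : Continuous g) (h0 : ∀ t, (t < 0 ∨ 1 < t) → g t = 0) : ∃ B : ℝ, 0 ≤ B ∧ ∀ t, |g t| ≤ B := by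
  obtain ⟨B, hB⟩ := (isCompact_Icc (a := (0:ℝ)) (b := 1)).exists_bound_of_continuousOn hg.continuousOn
  have hB0 := (norm_nonneg _).trans (hB 0 (by simp))
  refine ⟨B, hB0, fun t => ?_⟩
  by_cases h : t ∈ Set.Icc (0:ℝ) 1
  · exact hB t h
  · rw [h0 t (by by_contra hh; push Not at hh; exact h hh)]; simpa using hB0

lemma arg_out {s : ℝ} (hs : 0 < s) {y : Euc n} (h : ‖y‖ < s ∨ 2 * s < ‖y‖) :
    3 - ‖y‖ ^ 2 / s ^ 2 < 0 ∨ 1 < 3 - ‖y‖ ^ 2 / s ^ 2 := by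
  rcases h with h | h
  · right
    have : ‖y‖ ^ 2 / s ^ 2 < 2 := by
      rw [div_lt_iff₀ (by positivity)]; nlinarith [norm_nonneg y]
    linarith
  · left
    have : 3 < ‖y‖ ^ 2 / s ^ 2 := by
      rw [lt_div_iff₀ (by positivity)]; nlinarith [norm_nonneg y]
    linarith

lemma eta_bounds : ∃ B : ℝ, 1 ≤ B ∧ ∀ (n : ℕ) (s : ℝ), 0 < s → ∀ y : Euc n, 
    (∀ k, |pd k (eta s) y| ≤ B / s) ∧ (∀ i k, |pd k (pd i (eta s)) y| ≤ B / s ^ 2) := by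
  obtain ⟨B1, h10, h1⟩ := bdd_of st_dcd.continuous (fun t => st_deriv_zero)
  obtain ⟨B2, h20, h2⟩ := bdd_of (st_dcd.continuous_deriv (by simp)) (fun t => st_deriv2_zero)
  refine ⟨1 + 4 * B1 + 2 * B1 + 16 * B2, by linarith, fun n s hs y => ?_⟩
  by_cases ho : ‖y‖ < s ∨ 2 * s < ‖y‖
  · have hB := arg_out hs ho
    constructor
    · intro k; rw [eta_pd, st_deriv_zero hB]; simp; positivity
    · intro i k; rw [eta_pd2, st_deriv_zero hB, st_deriv2_zero hB]; simp; positivity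
  · push Not at ho
    have c : ∀ k, |-(2 * y k / s ^ 2)| ≤ 4 / s := fun k => by
      rw [abs_neg, abs_div, abs_mul, abs_two, abs_of_pos (by positivity : (0:ℝ) < s ^ 2), div_le_div_iff₀ (by positivity) hs]
      have := abs_coord_le y k
      nlinarith
    have d : ∀ i k : Fin n, |-(2 * kd i k / s ^ 2)| ≤ 2 / s ^ 2 := fun i k => by
      rw [abs_neg, abs_div, abs_mul, abs_two, abs_of_pos (by positivity : (0:ℝ) < s ^ 2)]
      have := kd_abs i k
      gcongr; linarith
    constructor
    · intro k
      rw [eta_pd, abs_mul]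
      refine (mul_le_mul (h1 _) (c k) (abs_nonneg _) h10).trans ?_
      rw [mul_div_assoc']; gcongr; linarith
    · intro i k
      rw [eta_pd2]
      refine (abs_add_le _ _).trans ?_
      rw [abs_mul, abs_mul, abs_mul]
      refine (add_le_add (mul_le_mul (mul_le_mul (h2 _) (c k) (abs_nonneg _) h20) (c i) (abs_nonneg _) (by positivity))
        (mul_le_mul (h1 _) (d i k) (abs_nonneg _) h10)).trans ?_
      rw [show B2 * (4 / s) * (4 / s) + B1 * (2 / s ^ 2) = (16 * B2 + 2 * B1) / s ^ 2 by field_simp; ring]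
      exact div_le_div_of_nonneg_right (by linarith) (by positivity)

lemma eta_off {s : ℝ} (hs : 0 < s) {y : Euc n} (h : ‖y‖ < s ∨ 2 * s < ‖y‖) :
    (∀ k, pd k (eta s) y = 0) ∧ (∀ i k, pd k (pd i (eta s)) y = 0) := by
  have hB := arg_out hs h
  constructor
  · intro k; rw [eta_pd, st_deriv_zero hB]; simp
  · intro i k; rw [eta_pd2, st_deriv_zero hB, st_deriv2_zero hB]; simp

lemma eta_one {s : ℝ} (hs : 0 < s) {y : Euc n} (h : ‖y‖ ≤ s) : eta s y = 1 := by
  apply Real.smoothTransition.one_of_one_le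
  have : ‖y‖ ^ 2 / s ^ 2 ≤ 2 := by
    rw [div_le_iff₀ (by positivity)]; nlinarith [norm_nonneg y]
  linarith

lemma eta_zero {s : ℝ} (hs : 0 < s) {y : Euc n} (h : 2 * s ≤ ‖y‖) : eta s y = 0 := by
  apply Real.smoothTransition.zero_of_nonpos
  have : 3 ≤ ‖y‖ ^ 2 / s ^ 2 := by
    rw [le_div_iff₀ (by positivity)]; nlinarith [norm_nonneg y]
  linarith

lemma eta_hcs {s : ℝ} (hs : 0 < s) : HasCompactSupport (eta s : Euc n → ℝ) := by
  refine HasCompactSupport.intro (isCompact_closedBall (0 : Euc n) (2 * s)) fun x hx => eta_zero hs ?_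
  simp only [mem_closedBall_zero_iff, not_le] at hx
  exact hx.le

/-- the cutoff -/
def chi (δ τ : ℝ) (y : Euc n) : ℝ := eta δ y - eta τ y

lemma chi_cd (δ τ : ℝ) : ContDiff ℝ (⊤ : ℕ∞) (chi δ τ : Euc n → ℝ) := (eta_cd δ).sub (eta_cd τ)

lemma chi_pd (δ τ : ℝ) (k : Fin n) : pd k (chi δ τ : Euc n → ℝ) = fun y => pd k (eta δ) y - pd k (eta τ) y := by
  ext y; exact pd_sub k (cdDiff (eta_cd δ) y) (cdDiff (eta_cd τ) y)

lemma chi_pd2 (δ τ : ℝ) (i k : Fin n) (y : Euc n) : pd k (pd i (chi δ τ : Euc n → ℝ)) y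
    = pd k (pd i (eta δ)) y - pd k (pd i (eta τ)) y := by
  rw [chi_pd]; exact pd_sub k (cdDiff ((eta_cd δ).pd' i) y) (cdDiff ((eta_cd τ).pd' i) y)

lemma chi_hcs {δ τ : ℝ} (hδ : 0 < δ) (hτ : 0 < τ) : HasCompactSupport (chi δ τ : Euc n → ℝ) := 
  (eta_hcs hδ).sub (eta_hcs hτ)

lemma chi_in {δ τ : ℝ} (hτ : 0 < τ) (h : τ ≤ δ) {y : Euc n} (hy : ‖y‖ ≤ τ) : chi δ τ y = 0 := by
  rw [chi, eta_one hτ hy, eta_one (hτ.trans_le h) (hy.trans h), sub_self]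

lemma chi_zero {δ τ : ℝ} (hτ : 0 < τ) (h : τ ≤ δ) : (0 : Euc n) ∉ tsupport (chi δ τ : Euc n → ℝ) := by
  rw [notMem_tsupport_iff_eventuallyEq]
  filter_upwards [Metric.ball_mem_nhds (0 : Euc n) hτ] with y hy
  rw [mem_ball_zero_iff] at hy
  exact chi_in hτ h hy.le

lemma chi_abs (δ τ : ℝ) (y : Euc n) : |chi δ τ y| ≤ 1 := by
  unfold chi eta
  have := Real.smoothTransition.nonneg (3 - ‖y‖ ^ 2 / δ ^ 2)
  have := Real.smoothTransition.nonneg (3 - ‖y‖ ^ 2 / τ ^ 2)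
  have := Real.smoothTransition.le_one (3 - ‖y‖ ^ 2 / δ ^ 2)
  have := Real.smoothTransition.le_one (3 - ‖y‖ ^ 2 / τ ^ 2)
  rw [abs_le]; constructor <;> linarith

lemma chi_bdry (δ τ : ℝ) (l : Fin n) (y : Euc n) (hy : y l = 0) : pd l (chi δ τ) y = 0 := by
  rw [chi_pd]; simp [eta_pd, hy]

end Part9

section Part10

variable {n : ℕ}

def gf (f : Fin n → Euc n → ℝ) (y : Euc n) : ℝ := ∑ i, |f i y|
def gF (F : Fin n → Fin n → Euc n → ℝ) (y : Euc n) : ℝ := ∑ i, ∑ k, |F i k y|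

lemma gf_nn (f : Fin n → Euc n → ℝ) (y : Euc n) : 0 ≤ gf f y := Finset.sum_nonneg fun _ _ => abs_nonneg _
lemma gF_nn (F : Fin n → Fin n → Euc n → ℝ) (y : Euc n) : 0 ≤ gF F y :=
  Finset.sum_nonneg fun _ _ => Finset.sum_nonneg fun _ _ => abs_nonneg _

lemma rp_split {ρ : ℝ} (hρ : 0 < ρ) : ρ ^ (2 - (n:ℝ)) = ρ * ρ ^ (1 - (n:ℝ)) := by
  rw [show 2 - (n:ℝ) = 1 + (1 - n) by ring, Real.rpow_add hρ, Real.rpow_one]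

/-- pointwise bound, abstract form -/
lemma Ee_pt {A : ℝ} (hA : 1 ≤ A) (hn : 4 ≤ n) {B : ℝ} (hB : 1 ≤ B)
    (hbd : ∀ (s : ℝ), 0 < s → ∀ y : Euc n, 
    (∀ k, |pd k (eta s) y| ≤ B / s) ∧ (∀ i k, |pd k (pd i (eta s)) y| ≤ B / s ^ 2))
    {K : Fin n → Euc n → ℝ} (hK : ∀ i, ContDiff ℝ (⊤ : ℕ∞) (K i)) (f : Fin n → Euc n → ℝ) (F : Fin n → Fin n → Euc n → ℝ)
    {δ τ : ℝ} (hτ : 0 < τ) (hτ1 : τ ≤ 1) {z : Euc n} (hz : ‖z‖ ≤ δ / 2) (hzτ : 4 * τ ≤ ‖z‖)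
    (hF : ∀ y, y ≠ 0 → ‖y‖ ≤ 2 * τ → gF F y = 0) {y : Euc n} (hyz : y ≠ z)
    (k0 : ∀ i, |K i y| ≤ A * ‖y - z‖ ^ (2 - (n:ℝ))) (k1 : ∀ i k, |pd k (K i) y| ≤ A * ‖y - z‖ ^ (1 - (n:ℝ))) :
    |Ee (chi δ τ) K f F y| ≤ 
      {y : Euc n | ‖y‖ ≤ 2 * δ}.indicator (fun y => 64 * n ^ 2 * A * B * ‖y - z‖ ^ (1 - (n:ℝ)) * (gF F y + ‖y‖ * gf f y)) y
      + {y : Euc n | δ ≤ ‖y‖ ∧ ‖y‖ ≤ 2 * δ}.indicator (fun y => 64 * n ^ 2 * A * B * (2 ^ n * δ ^ (-(n:ℝ))) * gf f y) y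
      + {y : Euc n | τ ≤ ‖y‖ ∧ ‖y‖ ≤ 2 * τ}.indicator
        (fun y => 64 * n ^ 2 * A * B * (‖z‖ / 2) ^ (1 - (n:ℝ)) * (1 + 3 * ‖z‖) * τ ^ (-2:ℝ) * gf f y) y := by
  have hn0 : 0 < n := by omega
  have hn4 : (4:ℝ) ≤ n := by exact_mod_cast hn
  have hz0 : 0 < ‖z‖ := by linarith
  have hδ : 0 < δ := by linarith
  have hτδ : τ ≤ δ := by linarith
  have hρ : 0 < ‖y - z‖ := by rw [norm_pos_iff, sub_ne_zero]; exact hyz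
  have hA0 : 0 < A := by linarith
  have hB0 : 0 < B := by linarith
  have r1 : ‖y - z‖ ≤ ‖y‖ + ‖z‖ := norm_sub_le _ _
  have r2 : ‖y‖ - ‖z‖ ≤ ‖y - z‖ := norm_sub_norm_le _ _
  have r3 : ‖z‖ - ‖y‖ ≤ ‖y - z‖ := by rw [norm_sub_rev]; exact norm_sub_norm_le _ _
  have hf0 := gf_nn f y
  have hF0 := gF_nn F y
  have hG0 : 0 ≤ gF F y + ‖y‖ * gf f y := by positivity
  have Eb : ∀ c0 c c2 : ℝ, |chi δ τ y| ≤ c0 → (∀ i, |pd i (chi δ τ) y| ≤ c) → (∀ i k, |pd k (pd i (chi δ τ)) y| ≤ c2) → 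
      |Ee (chi δ τ) K f F y| ≤ 16 * n ^ 2 * A * ‖y - z‖ ^ (1 - (n:ℝ)) * ((gF F y + ‖y‖ * gf f y) * (c0 + c * ‖y - z‖)
      + gf f y * (c + c2 * ‖y - z‖)) := by
    intro c0 c c2 h0 h1 h2
    have := Ee_bound hn0 (chi_cd δ τ) hK f F k0 k1 h0 h1 h2
    refine this.trans (le_of_eq ?_)
    rw [rp_split hρ]; simp only [gF, gf]; ring
  rw [Set.indicator_apply, Set.indicator_apply, Set.indicator_apply]
  simp only [Set.mem_ofPred_eq]
  set R := ‖y - z‖ ^ (1 - (n:ℝ)) with hR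
  have hR0 : 0 < R := Real.rpow_pos_of_pos hρ _
  have hBτ := hbd τ hτ y
  have hBδ := hbd δ hδ y
  by_cases h1 : 2 * δ < ‖y‖
  · have e1 := eta_off hδ (Or.inr h1)
    have e2 := eta_off hτ (y := y) (Or.inr (by linarith))
    have := Eb 0 0 0 (by simp [chi, eta_zero hδ h1.le, eta_zero hτ (y := y) (by linarith)])
      (fun i => by simp [chi_pd, e1.1, e2.1]) (fun i k => by simp [chi_pd2, e1.2, e2.2])
    rw [if_neg (by linarith), if_neg (by intro h; linarith [h.2]), if_neg (by intro h; linarith [h.2])]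
    simpa using this
  push Not at h1
  rw [if_pos h1]
  by_cases h2 : δ ≤ ‖y‖
  · have e2 := eta_off hτ (y := y) (Or.inr (by linarith))
    have := Eb 1 (B / δ) (B / δ ^ 2) (chi_abs _ _ _)
      (fun i => by simpa [chi_pd, e2.1] using hBδ.1 i) (fun i k => by simpa [chi_pd2, e2.2] using hBδ.2 i k)
    rw [if_pos ⟨h2, h1⟩, if_neg (by intro h; linarith [h.2]), add_zero]
    refine this.trans ?_
    have a1 : 1 + B / δ * ‖y - z‖ ≤ 4 * B := by
      have : B / δ * ‖y - z‖ ≤ B / δ * (3 * δ) := by gcongr; linarith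
      have e : B / δ * (3 * δ) = 3 * B := by field_simp
      linarith
    have a2 : B / δ + B / δ ^ 2 * ‖y - z‖ ≤ 4 * B / δ := by
      have : B / δ ^ 2 * ‖y - z‖ ≤ B / δ ^ 2 * (3 * δ) := by gcongr; linarith
      have e : B / δ + B / δ ^ 2 * (3 * δ) = 4 * B / δ := by field_simp; ring
      linarith
    have a3 : R ≤ 2 ^ n * δ ^ (1 - (n:ℝ)) := by
      have h : δ / 2 ≤ ‖y - z‖ := by linarith
      have := Real.rpow_le_rpow_of_nonpos (by positivity) h (by linarith : 1 - (n:ℝ) ≤ 0)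
      refine this.trans ?_
      rw [Real.div_rpow hδ.le (by norm_num), div_eq_mul_inv, mul_comm, ← Real.rpow_neg (by norm_num)]
      gcongr
      rw [← Real.rpow_natCast]
      exact Real.rpow_le_rpow_of_exponent_le (by norm_num) (by linarith)
    have a4 : δ ^ (1 - (n:ℝ)) = δ * δ ^ (-(n:ℝ)) := by
      rw [sub_eq_add_neg, Real.rpow_add hδ, Real.rpow_one]
    calc _ ≤ 16 * n ^ 2 * A * R * ((gF F y + ‖y‖ * gf f y) * (4 * B) + gf f y * (4 * B / δ)) := by gcongr
      _ = 64 * n ^ 2 * A * B * R * (gF F y + ‖y‖ * gf f y) + 64 * n ^ 2 * A * B * (R / δ) * gf f y := by ring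
      _ ≤ _ := by
        have : R / δ ≤ 2 ^ n * δ ^ (-(n:ℝ)) := by
          rw [div_le_iff₀ hδ]; refine a3.trans (le_of_eq ?_); rw [a4]; ring
        gcongr
  push Not at h2
  have e1 := eta_off hδ (Or.inl h2)
  rw [if_neg (by intro h; linarith [h.1]), add_zero]
  by_cases h3 : 2 * τ < ‖y‖
  · have e2 := eta_off hτ (y := y) (Or.inr h3)
    have := Eb 1 0 0 (chi_abs _ _ _)
      (fun i => by simp [chi_pd, e1.1, e2.1]) (fun i k => by simp [chi_pd2, e1.2, e2.2])
    rw [if_neg (by intro h; linarith [h.2]), add_zero]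
    refine this.trans ?_
    calc _ = 16 * n ^ 2 * A * 1 * R * (gF F y + ‖y‖ * gf f y) := by ring
      _ ≤ 64 * n ^ 2 * A * B * R * (gF F y + ‖y‖ * gf f y) := by gcongr; norm_num
  push Not at h3
  by_cases h4 : ‖y‖ < τ
  · have e2 := eta_off hτ (y := y) (Or.inl h4)
    have := Eb 0 0 0 (by rw [chi_in hτ hτδ h4.le]; simp)
      (fun i => by simp [chi_pd, e1.1, e2.1]) (fun i k => by simp [chi_pd2, e1.2, e2.2])
    rw [if_neg (by intro h; linarith [h.1]), add_zero]
    refine this.trans ?_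
    simp only [zero_mul, add_zero, mul_zero]
    positivity
  push Not at h4
  rw [if_pos ⟨h4, h3⟩]
  have := Eb 1 (B / τ) (B / τ ^ 2) (chi_abs _ _ _)
      (fun i => by simpa [chi_pd, e1.1] using hBτ.1 i) (fun i k => by simpa [chi_pd2, e1.2] using hBτ.2 i k)
  refine this.trans ?_
  rw [hF y (norm_pos_iff.1 (hτ.trans_le h4)) h3, zero_add]
  have a1 : R ≤ (‖z‖ / 2) ^ (1 - (n:ℝ)) :=
    Real.rpow_le_rpow_of_nonpos (by positivity) (by linarith) (by linarith)
  have a0 : 0 ≤ (‖z‖ / 2) ^ (1 - (n:ℝ)) := by positivity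
  have a2 : τ ^ (-2:ℝ) = 1 / τ ^ 2 := by rw [Real.rpow_neg hτ.le]; norm_num
  have a3 : ‖y‖ * (1 + B / τ * ‖y - z‖) + (B / τ + B / τ ^ 2 * ‖y - z‖) ≤ 4 * B * (1 + 3 * ‖z‖) * τ ^ (-2:ℝ) := by
    have b1 : ‖y - z‖ ≤ 3 / 2 * ‖z‖ := by linarith
    have b2 : ‖y‖ * (1 + B / τ * ‖y - z‖) ≤ 2 * τ * (1 + B / τ * (3 / 2 * ‖z‖)) := by gcongr
    have b3 : B / τ ^ 2 * ‖y - z‖ ≤ B / τ ^ 2 * (3 / 2 * ‖z‖) := by gcongr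
    have t2 : τ ^ 2 ≤ 1 := by nlinarith
    have t3 : τ ^ 3 ≤ 1 := by nlinarith
    rw [a2]
    refine (add_le_add b2 (add_le_add le_rfl b3)).trans ?_
    rw [show 2 * τ * (1 + B / τ * (3 / 2 * ‖z‖)) + (B / τ + B / τ ^ 2 * (3 / 2 * ‖z‖))
      = (2 * τ ^ 3 + 3 * B * ‖z‖ * τ ^ 2 + B * τ + 3 / 2 * B * ‖z‖) / τ ^ 2 by field_simp; ring, mul_one_div]
    refine div_le_div_of_nonneg_right ?_ (by positivity)
    have : B * ‖z‖ * τ ^ 2 ≤ B * ‖z‖ * 1 := by gcongr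
    have : B * τ ≤ B * 1 := by gcongr
    nlinarith [mul_pos hB0 hz0]
  calc _ = 16 * n ^ 2 * A * R * (‖y‖ * (1 + B / τ * ‖y - z‖) + (B / τ + B / τ ^ 2 * ‖y - z‖)) * gf f y := by ring
    _ ≤ 16 * n ^ 2 * A * (‖z‖ / 2) ^ (1 - (n:ℝ)) * (4 * B * (1 + 3 * ‖z‖) * τ ^ (-2:ℝ)) * gf f y := by gcongr
    _ ≤ _ := by
      have : 0 ≤ 64 * n ^ 2 * A * B * R * (‖y‖ * gf f y) := by positivity
      refine le_trans (le_of_eq (by ring)) (le_add_of_nonneg_left this)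

end Part10

section Part11

variable {n : ℕ}

def cn (n : ℕ) : ℝ := ∫ y : Euc n, qq 1 ((n:ℝ) / 2 + 2) y

lemma qq1_int : Integrable (qq 1 ((n:ℝ) / 2 + 2) : Euc n → ℝ) := by
  have := integrable_rpow_neg_one_add_norm_sq (E := Euc n) (μ := volume) (r := (n:ℝ) + 4) (by simp)
  refine this.congr (Filter.Eventually.of_forall fun y => ?_)
  simp only [qq]; congr 1 <;> ring

lemma cn_pos : 0 < cn n := by
  unfold cn
  rw [integral_pos_iff_support_of_nonneg (fun y => (qq_pos one_pos _ y).le) qq1_int]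
  have : Function.support (qq 1 ((n:ℝ) / 2 + 2) : Euc n → ℝ) = Set.univ := by
    ext y; simp [(qq_pos one_pos _ y).ne']
  rw [this]
  exact Measure.measure_univ_pos.2 (NeZero.ne _)

lemma peak (hn : 0 < n) {Φ : Euc n → ℝ} (hΦ : Integrable Φ) {z : Euc n} (hz : ContinuousAt Φ z) :
    Filter.Tendsto (fun e : ℝ => ∫ y, e ^ 4 * qq e ((n:ℝ) / 2 + 2) (y - z) * Φ y) (nhdsWithin 0 (Set.Ioi 0))
      (nhds (cn n * Φ z)) := by
  have hc : 0 < cn n := cn_pos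
  have hdec : Filter.Tendsto (fun x : Euc n => ‖x‖ ^ Module.finrank ℝ (Euc n) * ((cn n)⁻¹ * qq 1 ((n:ℝ) / 2 + 2) x))
      (Bornology.cobounded (Euc n)) (nhds 0) := by
    have t1 : Filter.Tendsto (fun x : Euc n => ‖x‖ ^ 2 + 1) (Bornology.cobounded (Euc n)) Filter.atTop :=
      Filter.tendsto_atTop_add_const_right _ _ ((Filter.tendsto_pow_atTop (by norm_num)).comp tendsto_norm_cobounded_atTop)
    have t2 := ((tendsto_rpow_neg_atTop (y := 2) (by norm_num)).comp t1).const_mul (cn n)⁻¹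
    rw [mul_zero] at t2
    refine squeeze_zero (fun x => ?_) (fun x => ?_) t2
    · have := qq_pos one_pos ((n:ℝ) / 2 + 2) x
      positivity
    · simp only [Function.comp, finrank_euclideanSpace, Fintype.card_fin, qq, one_pow]
      have hb : 0 < ‖x‖ ^ 2 + 1 := by positivity
      have h1 : ‖x‖ ^ n ≤ (‖x‖ ^ 2 + 1) ^ ((n:ℝ) / 2) := by
        calc ‖x‖ ^ n = (‖x‖ ^ 2) ^ ((n:ℝ) / 2) := by
              rw [← Real.rpow_natCast, ← Real.rpow_natCast, ← Real.rpow_mul (norm_nonneg _)]; congr 1; push_cast; ring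
          _ ≤ _ := by gcongr; linarith
      calc ‖x‖ ^ n * ((cn n)⁻¹ * (‖x‖ ^ 2 + 1) ^ (-((n:ℝ) / 2 + 2)))
          ≤ (‖x‖ ^ 2 + 1) ^ ((n:ℝ) / 2) * ((cn n)⁻¹ * (‖x‖ ^ 2 + 1) ^ (-((n:ℝ) / 2 + 2))) := by gcongr
        _ = (cn n)⁻¹ * ((‖x‖ ^ 2 + 1) ^ ((n:ℝ) / 2) * (‖x‖ ^ 2 + 1) ^ (-((n:ℝ) / 2 + 2))) := by ring
        _ = _ := by rw [← Real.rpow_add hb]; congr 2; ring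
  have T := tendsto_integral_comp_smul_smul_of_integrable' (μ := volume) (φ := fun x : Euc n => (cn n)⁻¹ * qq 1 ((n:ℝ) / 2 + 2) x)
    (fun x => by have := qq_pos one_pos ((n:ℝ) / 2 + 2) x; positivity)
    (by rw [integral_const_mul]; exact inv_mul_cancel₀ hc.ne') hdec hΦ hz
  have T2 := (T.comp tendsto_inv_nhdsGT_zero).const_mul (cn n)
  refine T2.congr' ?_
  filter_upwards [self_mem_nhdsWithin] with e he
  have he' : 0 < e := he
  simp only [Function.comp]
  rw [← integral_const_mul]
  refine integral_congr_ae (Filter.Eventually.of_forall fun y => ?_)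
  simp only [finrank_euclideanSpace, Fintype.card_fin, smul_eq_mul, qq, norm_smul, norm_inv, Real.norm_eq_abs, abs_of_pos he', one_pow]
  have h1 : (e⁻¹ * ‖z - y‖) ^ 2 + 1 = (‖y - z‖ ^ 2 + e ^ 2) * (e ^ 2)⁻¹ := by
    rw [norm_sub_rev]; field_simp
  have h2 : ((e ^ 2)⁻¹) ^ (-((n:ℝ) / 2 + 2)) = e ^ n * e ^ 4 := by
    rw [Real.inv_rpow (by positivity), ← Real.rpow_neg (by positivity), ← Real.rpow_natCast e 2, ← Real.rpow_mul he'.le,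
      ← pow_add, ← Real.rpow_natCast]
    congr 1; push_cast; ring
  rw [h1, Real.mul_rpow (by positivity) (by positivity), h2]
  field_simp
  rw [← mul_pow, one_div_mul_cancel he'.ne', one_pow, one_mul]

end Part11

section Part12

variable {n : ℕ}

lemma Ee_meas (hn : 0 < n) {l : Fin n} {f : Fin n → Euc n → ℝ} {F : Fin n → Fin n → Euc n → ℝ} (H : WF l f F)
    {χ : Euc n → ℝ} {K : Fin n → Euc n → ℝ} (hχ : ContDiff ℝ (⊤ : ℕ∞) χ)
    (hK : ∀ i, ContDiff ℝ (⊤ : ℕ∞) (K i)) : AEStronglyMeasurable (Ee χ K f F) := by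
  have c1 : ∀ i, ContinuousOn (f i) {0}ᶜ := fun i x hx => (H.fcd i x hx).continuousAt.continuousWithinAt
  have c2 : ∀ i k, ContinuousOn (F i k) {0}ᶜ := fun i k x hx => (H.Fcd i k x hx).continuousAt.continuousWithinAt
  have c3 : ∀ i k, Continuous (Mm χ K i k) := fun i k => (Mm_cd hχ hK i k).continuous
  have c4 : ∀ i k, Continuous (pd k (Mm χ K i k)) := fun i k => ((Mm_cd hχ hK i k).pd' k).continuous
  have c5 : ∀ i k, Continuous (Lop K i k) := fun i k => (Lop_cd' hK i k).continuous
  have c6 : ∀ k, Continuous (pd k χ) := fun k => (hχ.pd' k).continuous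
  have c7 : ∀ k, Continuous (pd k (Wt n)) := fun k => (Wt_cd.pd' k).continuous
  have c8 : Continuous (Wt n) := Wt_cd.continuous
  have c9 := hχ.continuous
  have : ContinuousOn (Ee χ K f F) {0}ᶜ := by unfold Ee; fun_prop
  have h := this.aestronglyMeasurable (μ := volume) (measurableSet_singleton (0 : Euc n)).compl
  rwa [Measure.restrict_congr_set (ae_ne hn), Measure.restrict_univ] at h

lemma enorm_le_of_add {α : Type*} [MeasurableSpace α] {μ : Measure α} {E P : α → ℝ} (hE : AEStronglyMeasurable E μ)
    (hP : Integrable P μ) (h : ∫ x, (E x + P x) ∂μ = 0) : ‖∫ x, P x ∂μ‖ₑ ≤ ∫⁻ x, ‖E x‖ₑ ∂μ := by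
  by_cases hE' : Integrable E μ
  · rw [integral_add hE' hP] at h
    rw [eq_neg_of_add_eq_zero_right h, enorm_neg]
    exact enorm_integral_le_lintegral_enorm _
  · have : ∫⁻ x, ‖E x‖ₑ ∂μ = ⊤ := by
      by_contra hh
      exact hE' ⟨hE, lt_top_iff_ne_top.2 hh⟩
    rw [this]; exact le_top

lemma rep (hn : 4 ≤ n) {l : Fin n} {f : Fin n → Euc n → ℝ} {F : Fin n → Fin n → Euc n → ℝ} (H : WF l f F)
    {B : ℝ} (hB : 1 ≤ B)
    (hbd : ∀ (s : ℝ), 0 < s → ∀ y : Euc n, 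
    (∀ k, |pd k (eta s) y| ≤ B / s) ∧ (∀ i k, |pd k (pd i (eta s)) y| ≤ B / s ^ 2))
    {δ τ : ℝ} (hτ : 0 < τ) (hτ1 : τ ≤ 1) {z : Euc n} (hzl : 0 < z l) (hz : ‖z‖ ≤ δ / 2) (hzτ : 4 * τ ≤ ‖z‖)
    (hF : ∀ y, y ≠ 0 → ‖y‖ ≤ 2 * τ → gF F y = 0) (j : Fin n) :
    ENNReal.ofReal (2 * (2 * n * (n + 2) * (n - 1) * (n - 2)) * cn n * Wt n z * |f j z|)
      ≤ ∫⁻ y in {x : Euc n | 0 ≤ x l}, ENNReal.ofReal (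
      {y : Euc n | ‖y‖ ≤ 2 * δ}.indicator (fun y => 64 * n ^ 2 * (40 * n ^ 3) * B * ‖y - z‖ ^ (1 - (n:ℝ)) * (gF F y + ‖y‖ * gf f y)) y
      + {y : Euc n | δ ≤ ‖y‖ ∧ ‖y‖ ≤ 2 * δ}.indicator (fun y => 64 * n ^ 2 * (40 * n ^ 3) * B * (2 ^ n * δ ^ (-(n:ℝ))) * gf f y) y
      + {y : Euc n | τ ≤ ‖y‖ ∧ ‖y‖ ≤ 2 * τ}.indicator
        (fun y => 64 * n ^ 2 * (40 * n ^ 3) * B * (‖z‖ / 2) ^ (1 - (n:ℝ)) * (1 + 3 * ‖z‖) * τ ^ (-2:ℝ) * gf f y) y) := by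
  have hn0 : 0 < n := by omega
  have hn4 : (4:ℝ) ≤ n := by exact_mod_cast hn
  have hz0 : 0 < ‖z‖ := by linarith
  have hδ : 0 < δ := by linarith
  have hτδ : τ ≤ δ := by linarith
  have hA : (1:ℝ) ≤ 40 * n ^ 3 := by
    have : (1:ℝ) ≤ n ^ 3 := one_le_pow₀ (by linarith)
    linarith
  set κ : ℝ := 2 * n * (n + 2) * (n - 1) * (n - 2) with hκ
  have hκ0 : 0 < κ := by
    have : (0:ℝ) < n - 1 := by linarith
    have : (0:ℝ) < n - 2 := by linarith
    positivity
  set Ψ : Euc n → ℝ := fun y => Wt n y * chi δ τ y * f j y with hΨ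
  have Ψc : ContDiff ℝ (⊤ : ℕ∞) Ψ := by
    have := cd_mul_off (A := fun y => Wt n y * f j y) (fun x hx => (Wt_cd.contDiffAt).mul (H.fcd j x hx))
      (chi_cd δ τ) (chi_zero hτ hτδ)
    have e : Ψ = fun x => Wt n x * f j x * chi δ τ x := by
      ext y; rw [hΨ]; ring
    rw [e]; exact this
  have Ψs : HasCompactSupport Ψ := ((chi_hcs hδ hτ).mul_left (f := Wt n)).mul_right
  set Φ : Euc n → ℝ := {x : Euc n | 0 ≤ x l}.indicator Ψ with hΦ
  have Φi : Integrable Φ := (hcs_int Ψc.continuous Ψs).indicator (meas_half l)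
  have Φz : Φ =ᶠ[nhds z] Ψ := by
    filter_upwards [(isOpen_lt continuous_const (cd_coord l).continuous).mem_nhds hzl] with y hy
    exact Set.indicator_of_mem (s := {x : Euc n | 0 ≤ x l}) (le_of_lt hy) Ψ
  have Φzc : ContinuousAt Φ z := (Ψc.continuous.continuousAt).congr Φz.symm
  have Φr : Φ =ᶠ[nhds (rf l z)] fun _ => 0 := by
    have : rf l z l < 0 := by simp [rf_apply, sg]; exact hzl
    filter_upwards [(isOpen_lt (cd_coord l).continuous continuous_const).mem_nhds this] with y hy
    exact Set.indicator_of_notMem (s := {x : Euc n | 0 ≤ x l}) (by simpa using hy) Ψ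
  have Φrc : ContinuousAt Φ (rf l z) := continuousAt_const.congr Φr.symm
  have T := ((peak hn0 Φi Φzc).add ((peak hn0 Φi Φrc).const_mul (sg l j))).const_mul (-(2 * κ))
  have Tn := (T.enorm)
  have key : ∀ᶠ e in nhdsWithin (0:ℝ) (Set.Ioi 0), ‖-(2 * κ) * ((∫ y, e ^ 4 * qq e ((n:ℝ) / 2 + 2) (y - z) * Φ y)
      + sg l j * ∫ y, e ^ 4 * qq e ((n:ℝ) / 2 + 2) (y - rf l z) * Φ y)‖ₑ ≤ ∫⁻ y in {x : Euc n | 0 ≤ x l}, ENNReal.ofReal (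
      {y : Euc n | ‖y‖ ≤ 2 * δ}.indicator (fun y => 64 * n ^ 2 * (40 * n ^ 3) * B * ‖y - z‖ ^ (1 - (n:ℝ)) * (gF F y + ‖y‖ * gf f y)) y
      + {y : Euc n | δ ≤ ‖y‖ ∧ ‖y‖ ≤ 2 * δ}.indicator (fun y => 64 * n ^ 2 * (40 * n ^ 3) * B * (2 ^ n * δ ^ (-(n:ℝ))) * gf f y) y
      + {y : Euc n | τ ≤ ‖y‖ ∧ ‖y‖ ≤ 2 * τ}.indicator
        (fun y => 64 * n ^ 2 * (40 * n ^ 3) * B * (‖z‖ / 2) ^ (1 - (n:ℝ)) * (1 + 3 * ‖z‖) * τ ^ (-2:ℝ) * gf f y) y) := by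
    filter_upwards [self_mem_nhdsWithin] with e he
    have he' : 0 < e := he
    have S := starK hn0 H (chi_cd δ τ) (chi_hcs hδ hτ) (chi_zero hτ hτδ) (chi_bdry δ τ l)
      (Kt_cd he' l j z) (Kt_bd l j z) (Kt_bd' hn0 he' l j z)
    have qi : ∀ w : Euc n, Integrable (fun y => e ^ 4 * qq e ((n:ℝ) / 2 + 2) (y - w) * Ψ y) := fun w => by
      refine hcs_int ?_ (Ψs.mul_left (f := fun y => e ^ 4 * qq e ((n:ℝ) / 2 + 2) (y - w)))
      have := (qq_cd (n := n) he' ((n:ℝ) / 2 + 2)).continuous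
      have h2 := Ψc.continuous
      fun_prop
    have Pe : ∀ y, 2 * Wt n y * chi δ τ y * ∑ i, f i y * ∑ k, pd k (Lop (Kt n e l j z) i k) y
        = -(2 * κ) * (e ^ 4 * qq e ((n:ℝ) / 2 + 2) (y - z) * Ψ y + sg l j * (e ^ 4 * qq e ((n:ℝ) / 2 + 2) (y - rf l z) * Ψ y)) := by
      intro y
      simp only [Kt_divLop hn0 he', ← mul_assoc, kd, mul_ite, mul_one, mul_zero, Finset.sum_ite_eq', Finset.mem_univ, if_true]
      rw [hΨ, hκ]; ring
    simp only [Pe] at S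
    have Pi : Integrable (fun y => -(2 * κ) * (e ^ 4 * qq e ((n:ℝ) / 2 + 2) (y - z) * Ψ y
      + sg l j * (e ^ 4 * qq e ((n:ℝ) / 2 + 2) (y - rf l z) * Ψ y))) := ((qi z).add ((qi _).const_mul _)).const_mul _
    have b := enorm_le_of_add (Ee_meas hn0 H (chi_cd δ τ) (Kt_cd he' l j z)).restrict Pi.integrableOn S
    have eI : ∀ w : Euc n, ∫ y, e ^ 4 * qq e ((n:ℝ) / 2 + 2) (y - w) * Φ y
        = ∫ y in {x : Euc n | 0 ≤ x l}, e ^ 4 * qq e ((n:ℝ) / 2 + 2) (y - w) * Ψ y := fun w => by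
      rw [← integral_indicator (meas_half l)]
      congr 1; ext y
      simp only [hΦ, Set.indicator_apply]; split_ifs <;> simp
    rw [integral_const_mul, integral_add (qi z).integrableOn ((qi _).const_mul _).integrableOn, integral_const_mul,
      ← eI, ← eI] at b
    refine b.trans (lintegral_mono_ae ?_)
    rw [ae_restrict_iff' (meas_half l)]
    have : ∀ᵐ y : Euc n, y ≠ z := by
      have : Nonempty (Fin n) := ⟨l⟩
      exact Measure.ae_ne volume z
    filter_upwards [this] with y hy hyl
    rw [Real.enorm_eq_ofReal_abs]
    exact ENNReal.ofReal_le_ofReal (Ee_pt hA hn hB hbd (Kt_cd he' l j z) f F hτ hτ1 hz hzτ hF hy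
      (fun i => Kt_bound hn he' l j i hyl hzl.le hy) (fun i k => Kt_pd_bound hn he' l j i k hyl hzl.le hy))
  have fin := le_of_tendsto Tn key
  refine le_trans (le_of_eq ?_) fin
  rw [Φz.self_of_nhds, Φr.self_of_nhds, Real.enorm_eq_ofReal_abs]
  congr 1
  have c1 : chi δ τ z = 1 := by
    rw [chi, eta_one hδ (by linarith), eta_zero hτ (by linarith), sub_zero]
  rw [hΨ]; simp only [c1, mul_zero, add_zero, mul_one]
  rw [abs_mul, abs_neg, abs_of_pos (by positivity : 0 < 2 * κ), abs_mul, abs_mul, abs_of_pos cn_pos, abs_of_pos (Wt_pos z)]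
  ring

end Part12

section Part13

variable {n : ℕ}

lemma aem_off (hn : 0 < n) {g : Euc n → ℝ} (hg : ContinuousOn g {0}ᶜ) : AEMeasurable g := by
  have h := hg.aestronglyMeasurable (μ := volume) (measurableSet_singleton (0 : Euc n)).compl
  rw [Measure.restrict_congr_set (ae_ne hn), Measure.restrict_univ] at h
  exact h.aemeasurable

lemma gf_cont {l : Fin n} {f : Fin n → Euc n → ℝ} {F : Fin n → Fin n → Euc n → ℝ} (H : WF l f F) :
    ContinuousOn (gf f) {0}ᶜ := by
  have c1 : ∀ i, ContinuousOn (f i) {0}ᶜ := fun i x hx => (H.fcd i x hx).continuousAt.continuousWithinAt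
  unfold gf; fun_prop

lemma gF_cont {l : Fin n} {f : Fin n → Euc n → ℝ} {F : Fin n → Fin n → Euc n → ℝ} (H : WF l f F) :
    ContinuousOn (gF F) {0}ᶜ := by
  have c1 : ∀ i k, ContinuousOn (F i k) {0}ᶜ := fun i k x hx => (H.Fcd i k x hx).continuousAt.continuousWithinAt
  unfold gF; fun_prop

lemma meas_ann (a b : ℝ) : MeasurableSet {y : Euc n | a ≤ ‖y‖ ∧ ‖y‖ ≤ b} :=
  (measurableSet_le measurable_const measurable_norm).inter (measurableSet_le measurable_norm measurable_const)

lemma meas_cb (b : ℝ) : MeasurableSet {y : Euc n | ‖y‖ ≤ b} :=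
  measurableSet_le measurable_norm measurable_const

lemma lint_ind {s t : Set (Euc n)} (ht : MeasurableSet t) {a : ℝ} (ha : 0 ≤ a) (g : Euc n → ℝ) :
    ∫⁻ y in s, ENNReal.ofReal (t.indicator (fun y => a * g y) y) = ENNReal.ofReal a * ∫⁻ y in t ∩ s, ENNReal.ofReal (g y) := by
  rw [← lintegral_const_mul' _ _ ENNReal.ofReal_ne_top, ← Measure.restrict_restrict ht, ← lintegral_indicator ht]
  refine lintegral_congr fun y => ?_
  by_cases hy : y ∈ t <;> simp [hy, ENNReal.ofReal_mul ha]

lemma rep2 (hn : 4 ≤ n) : ∃ C0 : ℝ, 0 < C0 ∧ ∀ (l : Fin n) (f : Fin n → Euc n → ℝ) (F : Fin n → Fin n → Euc n → ℝ), WF l f F →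
    (∃ t0 : ℝ, 0 < t0 ∧ ∀ y, y ≠ 0 → ‖y‖ ≤ t0 → gF F y = 0) →
    Filter.Tendsto (fun τ : ℝ => ENNReal.ofReal (τ ^ (-2:ℝ)) * ∫⁻ y in {y : Euc n | τ ≤ ‖y‖ ∧ ‖y‖ ≤ 2 * τ} ∩ {x : Euc n | 0 ≤ x l},
      ENNReal.ofReal (gf f y)) (nhdsWithin 0 (Set.Ioi 0)) (nhds 0) →
    ∀ δ : ℝ, 0 < δ → δ ≤ 1 → ∀ z : Euc n, 0 < z l → ‖z‖ ≤ δ / 2 → ∀ j,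
    ENNReal.ofReal |f j z| ≤ ENNReal.ofReal C0 * 
      ((∫⁻ y in {y : Euc n | ‖y‖ ≤ 2 * δ} ∩ {x : Euc n | 0 ≤ x l}, ENNReal.ofReal (‖y - z‖ ^ (1 - (n:ℝ)) * (gF F y + ‖y‖ * gf f y)))
      + ENNReal.ofReal (δ ^ (-(n:ℝ))) * ∫⁻ y in {y : Euc n | δ ≤ ‖y‖ ∧ ‖y‖ ≤ 2 * δ} ∩ {x : Euc n | 0 ≤ x l}, ENNReal.ofReal (gf f y)) := by
  have hn0 : 0 < n := by omega
  have hn4 : (4:ℝ) ≤ n := by exact_mod_cast hn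
  obtain ⟨B, hB, hbd⟩ := eta_bounds
  set D : ℝ := 64 * n ^ 2 * (40 * n ^ 3) * B with hD
  have hD0 : 0 < D := by positivity
  set κ : ℝ := 2 * n * (n + 2) * (n - 1) * (n - 2) with hκ
  have hκ0 : 0 < κ := by
    have : (0:ℝ) < n - 1 := by linarith
    have : (0:ℝ) < n - 2 := by linarith
    positivity
  have hcn := cn_pos (n := n)
  set c0 : ℝ := 2 * κ * cn n * (2 ^ n)⁻¹ with hc0
  have hc00 : 0 < c0 := by positivity
  refine ⟨c0⁻¹ * (D * 2 ^ n), by positivity, fun l f F H ⟨t0, ht0, hF⟩ hτ δ hδ hδ1 z hzl hz j => ?_⟩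
  have hz0 : 0 < ‖z‖ := norm_pos_iff.2 (by rintro rfl; simp at hzl)
  set X := ∫⁻ y in {y : Euc n | ‖y‖ ≤ 2 * δ} ∩ {x : Euc n | 0 ≤ x l}, ENNReal.ofReal (‖y - z‖ ^ (1 - (n:ℝ)) * (gF F y + ‖y‖ * gf f y)) with hX
  set Y := ∫⁻ y in {y : Euc n | δ ≤ ‖y‖ ∧ ‖y‖ ≤ 2 * δ} ∩ {x : Euc n | 0 ≤ x l}, ENNReal.ofReal (gf f y) with hY
  set M : ℝ := D * (‖z‖ / 2) ^ (1 - (n:ℝ)) * (1 + 3 * ‖z‖) with hM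
  have hM0 : 0 ≤ M := by positivity
  have mf : AEMeasurable (gf f) := aem_off hn0 (gf_cont H)
  have key : ∀ᶠ τ in nhdsWithin (0:ℝ) (Set.Ioi 0), ENNReal.ofReal (c0 * |f j z|) ≤ 
      ENNReal.ofReal D * X + ENNReal.ofReal (D * (2 ^ n * δ ^ (-(n:ℝ)))) * Y + ENNReal.ofReal M * 
      (ENNReal.ofReal (τ ^ (-2:ℝ)) * ∫⁻ y in {y : Euc n | τ ≤ ‖y‖ ∧ ‖y‖ ≤ 2 * τ} ∩ {x : Euc n | 0 ≤ x l},
      ENNReal.ofReal (gf f y)) := by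
    have hlt : 0 < min 1 (min (‖z‖ / 4) (t0 / 2)) := by positivity
    filter_upwards [self_mem_nhdsWithin, nhdsWithin_le_nhds (Iio_mem_nhds hlt)] with τ h1 h2
    have hτ0 : 0 < τ := h1
    simp only [Set.mem_Iio, lt_min_iff] at h2
    have R := rep hn H hB (hbd n) hτ0 h2.1.le hzl hz (by linarith [h2.2.1]) (fun y hy0 hy => hF y hy0 (by linarith [h2.2.2])) j
    refine le_trans (ENNReal.ofReal_le_ofReal ?_) (R.trans ?_)
    · rw [hc0]
      refine mul_le_mul_of_nonneg_right ?_ (abs_nonneg _)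
      refine mul_le_mul_of_nonneg_left ?_ (by positivity)
      unfold Wt
      gcongr
      nlinarith
    · have e1 : ∀ y, ENNReal.ofReal _ ≤ _ := fun y => ENNReal.ofReal_add_le (p := {y : Euc n | ‖y‖ ≤ 2 * δ}.indicator (fun y => 64 * n ^ 2 * (40 * n ^ 3) * B * ‖y - z‖ ^ (1 - (n:ℝ)) * (gF F y + ‖y‖ * gf f y)) y
          + {y : Euc n | δ ≤ ‖y‖ ∧ ‖y‖ ≤ 2 * δ}.indicator (fun y => 64 * n ^ 2 * (40 * n ^ 3) * B * (2 ^ n * δ ^ (-(n:ℝ))) * gf f y) y)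
         (q := {y : Euc n | τ ≤ ‖y‖ ∧ ‖y‖ ≤ 2 * τ}.indicator
        (fun y => 64 * n ^ 2 * (40 * n ^ 3) * B * (‖z‖ / 2) ^ (1 - (n:ℝ)) * (1 + 3 * ‖z‖) * τ ^ (-2:ℝ) * gf f y) y)
      refine (lintegral_mono e1).trans ?_
      rw [lintegral_add_right']
      · refine add_le_add ((lintegral_mono fun y => ENNReal.ofReal_add_le).trans ?_) ?_
        · rw [lintegral_add_right']
          · refine add_le_add (le_of_eq ?_) (le_of_eq ?_)
            · rw [hX, ← lint_ind (meas_cb _) hD0.le]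
              congr 1; ext y; congr 2; ext y; rw [hD]; ring
            · rw [hY, ← lint_ind (meas_ann _ _) (by positivity)]
          · exact ((mf.const_mul _).indicator (meas_ann _ _)).ennreal_ofReal.restrict
        · rw [← mul_assoc (ENNReal.ofReal M), ← ENNReal.ofReal_mul hM0, ← lint_ind (meas_ann _ _) (by positivity)]
      · exact ((mf.const_mul _).indicator (meas_ann _ _)).ennreal_ofReal.restrict
  have L := ge_of_tendsto (Filter.Tendsto.const_add (ENNReal.ofReal D * X + ENNReal.ofReal (D * (2 ^ n * δ ^ (-(n:ℝ)))) * Y)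
    (ENNReal.Tendsto.const_mul (a := ENNReal.ofReal M) hτ (Or.inr ENNReal.ofReal_ne_top))) key
  rw [mul_zero, add_zero] at L
  have e : |f j z| = c0⁻¹ * (c0 * |f j z|) := by field_simp
  rw [e, ENNReal.ofReal_mul (by positivity), ENNReal.ofReal_mul (by positivity : 0 ≤ c0⁻¹), mul_assoc (ENNReal.ofReal c0⁻¹)]
  refine mul_le_mul_right ?_ _
  refine L.trans ?_
  rw [mul_add]
  refine add_le_add (mul_le_mul_left (ENNReal.ofReal_le_ofReal ?_) _) (le_of_eq ?_)
  · exact le_mul_of_one_le_right hD0.le (one_le_pow₀ (by norm_num))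
  · rw [← mul_assoc, ← mul_assoc, ENNReal.ofReal_mul (by positivity)]

end Part13

section Part14

variable {n : ℕ}

def An (n : ℕ) (t : ℝ) : Set (Euc n) := {y | t < ‖y‖ ∧ ‖y‖ ≤ 2 * t}

lemma An_meas (t : ℝ) : MeasurableSet (An n t) :=
  (measurableSet_lt measurable_const measurable_norm).inter (measurableSet_le measurable_norm measurable_const)

lemma sqE (k : ENNReal) : (k ^ (1 / 2 : ℝ)) ^ 2 = k := by
  rw [← ENNReal.rpow_natCast, ← ENNReal.rpow_mul]; norm_num

lemma CS {α : Type*} [MeasurableSpace α] (μ : Measure α) {a b : α → ENNReal} (ha : AEMeasurable a μ) (hb : AEMeasurable b μ) :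
    (∫⁻ x, a x * b x ∂μ) ^ 2 ≤ (∫⁻ x, a x ^ 2 ∂μ) * ∫⁻ x, b x ^ 2 ∂μ := by
  have h := ENNReal.lintegral_mul_le_Lp_mul_Lq μ Real.HolderConjugate.two_two ha hb
  have h2 := pow_le_pow_left' h 2
  rw [mul_pow, sqE, sqE] at h2
  simpa using h2

lemma volA (hn : 0 < n) : ∃ ω : ℝ, 0 < ω ∧ ∀ t : ℝ, 0 < t → volume (An n t) ≤ ENNReal.ofReal (ω * t ^ (n:ℝ)) := by
  have : Nonempty (Fin n) := ⟨⟨0, hn⟩⟩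
  have hv : volume (ball (0 : Euc n) 1) ≠ ⊤ := measure_ball_lt_top.ne
  have hv0 : 0 < volume (ball (0 : Euc n) 1) := measure_ball_pos _ _ one_pos
  refine ⟨2 ^ n * (volume (ball (0 : Euc n) 1)).toReal, by have := ENNReal.toReal_pos hv0.ne' hv; positivity, fun t ht => ?_⟩
  have h1 : An n t ⊆ closedBall 0 (2 * t) := fun y hy => by simpa using hy.2
  refine (measure_mono h1).trans (le_of_eq ?_)
  rw [Measure.addHaar_closedBall _ _ (by positivity), finrank_euclideanSpace, Fintype.card_fin,
    Real.rpow_natCast, mul_pow, show 2 ^ n * (volume (ball (0 : Euc n) 1)).toReal * t ^ n = 2 ^ n * t ^ n * (volume (ball (0 : Euc n) 1)).toReal by ring,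
    ENNReal.ofReal_mul (by positivity : (0:ℝ) ≤ 2 ^ n * t ^ n), ENNReal.ofReal_toReal hv]

lemma dyad_in (hn : 0 < n) {a : ℝ} (ha : 0 < a) : ∃ C : ℝ, 0 < C ∧ ∀ (φ : Euc n → ENNReal) (c : ENNReal),
    (∀ t : ℝ, 0 < t → ∫⁻ y in An n t, φ y ≤ c * ENNReal.ofReal (t ^ a)) → ∀ R : ℝ, 0 < R →
    ∫⁻ y in {y : Euc n | ‖y‖ ≤ R}, φ y ≤ c * ENNReal.ofReal (C * R ^ a) := by
  set q : ℝ := (1 / 2 : ℝ) ^ a with hq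
  have hq0 : 0 < q := by positivity
  have hq1 : q < 1 := Real.rpow_lt_one (by norm_num) (by norm_num) ha
  refine ⟨(1 - q)⁻¹, by simpa using hq1, fun φ c h R hR => ?_⟩
  have hs : {y : Euc n | ‖y‖ ≤ R} \ {0} ⊆ ⋃ m : ℕ, An n (R * (1 / 2) ^ (m + 1)) := by
    rintro y ⟨hy, hy0⟩
    have hy' : 0 < ‖y‖ := norm_pos_iff.2 hy0
    have hyR : ‖y‖ ≤ R := hy
    obtain ⟨m, hm⟩ := exists_pow_lt_of_lt_one (div_pos hy' hR) (by norm_num : (1/2:ℝ) < 1)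
    have hex : ∃ m : ℕ, R * (1 / 2) ^ (m + 1) < ‖y‖ := ⟨m, by
      rw [lt_div_iff₀ hR] at hm
      have : (1/2:ℝ) ^ (m + 1) ≤ (1/2) ^ m := pow_le_pow_of_le_one (by norm_num) (by norm_num) (by omega)
      nlinarith⟩
    classical
    have h1 := Nat.find_spec hex
    refine Set.mem_iUnion.2 ⟨Nat.find hex, h1, ?_⟩
    rcases Nat.eq_zero_or_pos (Nat.find hex) with h0 | h0
    · rw [h0]; norm_num; linarith
    · have := Nat.find_min hex (m := Nat.find hex - 1) (by omega)
      rw [not_lt, Nat.sub_add_cancel h0] at this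
      rw [pow_succ]; linarith
  have hae : ({y : Euc n | ‖y‖ ≤ R} \ {0} : Set (Euc n)) =ᵐ[volume] {y : Euc n | ‖y‖ ≤ R} := by
    have : Nonempty (Fin n) := ⟨⟨0, hn⟩⟩
    exact sdiff_null_ae_eq_self (by simp)
  rw [← setLIntegral_congr hae]
  refine (lintegral_mono_set hs).trans ((lintegral_iUnion_le _ _).trans ?_)
  have hb : ∀ m : ℕ, ∫⁻ y in An n (R * (1 / 2) ^ (m + 1)), φ y ≤ c * ENNReal.ofReal (R ^ a) * ENNReal.ofReal q ^ m := fun m => by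
    refine (h _ (by positivity)).trans ?_
    rw [mul_assoc, ← ENNReal.ofReal_pow hq0.le, ← ENNReal.ofReal_mul (by positivity)]
    gcongr
    rw [Real.mul_rpow hR.le (by positivity), hq, ← Real.rpow_natCast, ← Real.rpow_mul (by norm_num), mul_comm _ a, Real.rpow_mul (by norm_num), Real.rpow_natCast]
    gcongr ?_ * ?_
    rw [← hq]
    exact pow_le_pow_of_le_one hq0.le hq1.le (by omega)
  refine (ENNReal.tsum_le_tsum hb).trans ?_
  rw [ENNReal.tsum_mul_left, ENNReal.tsum_geometric, mul_assoc]
  gcongr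
  rw [mul_comm _ (R ^ a), ENNReal.ofReal_mul (by positivity), ENNReal.ofReal_inv_of_pos (by linarith), ENNReal.ofReal_sub _ hq0.le, ENNReal.ofReal_one]

lemma dyad_out {a : ℝ} (ha : a < 0) : ∃ C : ℝ, 0 < C ∧ ∀ (φ : Euc n → ENNReal) (c : ENNReal),
    (∀ t : ℝ, 0 < t → ∫⁻ y in An n t, φ y ≤ c * ENNReal.ofReal (t ^ a)) → ∀ R : ℝ, 0 < R →
    ∫⁻ y in {y : Euc n | R < ‖y‖}, φ y ≤ c * ENNReal.ofReal (C * R ^ a) := by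
  set q : ℝ := (2 : ℝ) ^ a with hq
  have hq0 : 0 < q := by positivity
  have hq1 : q < 1 := Real.rpow_lt_one_of_one_lt_of_neg (by norm_num) ha
  refine ⟨(1 - q)⁻¹, by simpa using hq1, fun φ c h R hR => ?_⟩
  have hs : {y : Euc n | R < ‖y‖} ⊆ ⋃ m : ℕ, An n (R * 2 ^ m) := by
    intro y hy
    have hyR : R < ‖y‖ := hy
    have hy' : 0 < ‖y‖ := hR.trans hyR
    obtain ⟨m, hm⟩ := pow_unbounded_of_one_lt (‖y‖ / R) (by norm_num : (1:ℝ) < 2)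
    have hex : ∃ m : ℕ, ‖y‖ ≤ R * 2 ^ (m + 1) := ⟨m, by
      rw [div_lt_iff₀ hR] at hm
      have : (2:ℝ) ^ m ≤ 2 ^ (m + 1) := pow_le_pow_right₀ (by norm_num) (by omega)
      nlinarith⟩
    classical
    have h1 := Nat.find_spec hex
    refine Set.mem_iUnion.2 ⟨Nat.find hex, ?_, by rw [pow_succ] at h1; linarith⟩
    rcases Nat.eq_zero_or_pos (Nat.find hex) with h0 | h0
    · rw [h0]; simpa using hyR
    · have := Nat.find_min hex (m := Nat.find hex - 1) (by omega)
      rw [not_le, Nat.sub_add_cancel h0] at this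
      exact this
  refine (lintegral_mono_set hs).trans ((lintegral_iUnion_le _ _).trans ?_)
  have hb : ∀ m : ℕ, ∫⁻ y in An n (R * 2 ^ m), φ y ≤ c * ENNReal.ofReal (R ^ a) * ENNReal.ofReal q ^ m := fun m => by
    refine (h _ (by positivity)).trans ?_
    rw [mul_assoc, ← ENNReal.ofReal_pow hq0.le, ← ENNReal.ofReal_mul (by positivity)]
    gcongr
    rw [Real.mul_rpow hR.le (by positivity), hq, ← Real.rpow_natCast, ← Real.rpow_mul (by norm_num), mul_comm _ a, Real.rpow_mul (by norm_num), Real.rpow_natCast]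
  refine (ENNReal.tsum_le_tsum hb).trans ?_
  rw [ENNReal.tsum_mul_left, ENNReal.tsum_geometric, mul_assoc]
  gcongr
  rw [mul_comm _ (R ^ a), ENNReal.ofReal_mul (by positivity), ENNReal.ofReal_inv_of_pos (by linarith), ENNReal.ofReal_sub _ hq0.le, ENNReal.ofReal_one]

end Part14

section Part15

variable {n : ℕ}

lemma sqle {a b : ENNReal} (h : a ^ 2 ≤ b ^ 2) : a ≤ b := by
  by_contra hc
  rw [not_le] at hc
  exact absurd h (not_le.2 (ENNReal.pow_lt_pow_left two_ne_zero hc))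

lemma addsq (a b : ENNReal) : (a + b) ^ 2 ≤ 4 * (a ^ 2 + b ^ 2) := by
  have key : ∀ a b : ENNReal, a ≤ b → (a + b) ^ 2 ≤ 4 * (a ^ 2 + b ^ 2) := fun a b h => by
    calc (a + b) ^ 2 ≤ (b + b) ^ 2 := by gcongr
      _ = 4 * b ^ 2 := by ring
      _ ≤ _ := by gcongr; exact le_add_self
  rcases le_total a b with h | h
  · exact key a b h
  · rw [add_comm a b, add_comm (a ^ 2)]; exact key b a h

lemma ker_meas : Measurable fun p : Euc n × Euc n => ENNReal.ofReal (‖p.1 - p.2‖ ^ (1 - (n:ℝ))) := by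
  fun_prop

lemma ker_int (hn : 1 ≤ n) : ∃ C : ℝ, 0 < C ∧ ∀ s : ℝ, 0 < s → ∫⁻ w in {w : Euc n | ‖w‖ ≤ 6 * s}, ENNReal.ofReal (‖w‖ ^ (1 - (n:ℝ))) ≤ ENNReal.ofReal (C * s) := by
  have hn1 : (1:ℝ) ≤ n := by exact_mod_cast hn
  obtain ⟨ω, hω, hv⟩ := volA (n := n) (by omega)
  obtain ⟨C, hC, hd⟩ := dyad_in (n := n) (by omega) (one_pos)
  refine ⟨ω * (C * 6), by positivity, fun s hs => ?_⟩
  have := hd (fun w => ENNReal.ofReal (‖w‖ ^ (1 - (n:ℝ)))) (ENNReal.ofReal ω) (fun t ht => ?_) (6 * s) (by positivity)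
  · refine this.trans (le_of_eq ?_)
    rw [← ENNReal.ofReal_mul hω.le, Real.rpow_one]; congr 1; ring
  · calc ∫⁻ y in An n t, ENNReal.ofReal (‖y‖ ^ (1 - (n:ℝ))) ≤ ∫⁻ y in An n t, ENNReal.ofReal (t ^ (1 - (n:ℝ))) := by
          refine setLIntegral_mono' (An_meas t) fun y hy => ENNReal.ofReal_le_ofReal ?_
          exact Real.rpow_le_rpow_of_nonpos ht hy.1.le (by linarith)
      _ = ENNReal.ofReal (t ^ (1 - (n:ℝ))) * volume (An n t) := by simp
      _ ≤ ENNReal.ofReal (t ^ (1 - (n:ℝ))) * ENNReal.ofReal (ω * t ^ (n:ℝ)) := by gcongr; exact hv t ht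
      _ = _ := by
          rw [← ENNReal.ofReal_mul (by positivity), ← ENNReal.ofReal_mul hω.le]; congr 1
          rw [show t ^ (1:ℝ) = t ^ (1 - (n:ℝ)) * t ^ (n:ℝ) by rw [← Real.rpow_add ht]; congr 1; ring]; ring

lemma ker_tr (hn : 1 ≤ n) : ∃ C : ℝ, 0 < C ∧ ∀ s : ℝ, 0 < s → ∀ (S : Set (Euc n)) (z : Euc n), (∀ y ∈ S, ‖y - z‖ ≤ 6 * s) → MeasurableSet S →
    ∫⁻ y in S, ENNReal.ofReal (‖y - z‖ ^ (1 - (n:ℝ))) ≤ ENNReal.ofReal (C * s) := by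
  obtain ⟨C, hC, h⟩ := ker_int hn
  refine ⟨C, hC, fun s hs S z hS hm => le_trans ?_ (h s hs)⟩
  have hm2 := meas_cb (n := n) (6 * s)
  rw [← lintegral_indicator hm, ← lintegral_indicator hm2]
  rw [← lintegral_sub_right_eq_self (μ := volume) (Set.indicator {y : Euc n | ‖y‖ ≤ 6 * s} _) z]
  refine lintegral_mono fun y => ?_
  by_cases hy : y ∈ S
  · rw [Set.indicator_of_mem hy, Set.indicator_of_mem (by exact hS y hy)]
  · simp [Set.indicator_of_notMem hy]

lemma gL1 (hn : 1 ≤ n) : ∃ A : ℝ, 0 < A ∧ ∀ (σ : ℝ) (g : Euc n → ENNReal) (k : ENNReal), Measurable g →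
    ∀ t : ℝ, 0 < t → ∫⁻ y in An n t, g y ^ 2 ≤ k * ENNReal.ofReal (t ^ ((n:ℝ) - 2 * σ)) → 
    ∫⁻ y in An n t, g y ≤ k ^ (1 / 2 : ℝ) * ENNReal.ofReal A * ENNReal.ofReal (t ^ ((n:ℝ) - σ)) := by
  obtain ⟨ω, hω, hv⟩ := volA (n := n) (by omega)
  refine ⟨√ω, by positivity, fun σ g k hg t ht hk => sqle ?_⟩
  have h := CS (volume.restrict (An n t)) (a := fun _ => 1) (b := g) (by fun_prop) (by fun_prop)
  simp only [one_mul, one_pow, lintegral_one, Measure.restrict_apply_univ] at h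
  refine h.trans ((mul_le_mul' (hv t ht) hk).trans (le_of_eq ?_))
  rw [mul_pow, mul_pow, sqE, ← ENNReal.ofReal_pow (by positivity), ← ENNReal.ofReal_pow (by positivity), Real.sq_sqrt hω.le,
    ← mul_assoc, mul_comm _ k, mul_assoc, mul_assoc, ← ENNReal.ofReal_mul (by positivity), ← ENNReal.ofReal_mul (by positivity)]
  congr 2
  rw [mul_assoc, ← Real.rpow_add ht, ← Real.rpow_natCast, ← Real.rpow_mul ht.le]
  congr 2; push_cast; ring

lemma nearfar (hn : 4 ≤ n) {σ : ℝ} (h1 : 1 < σ) (h2 : σ < n) : ∃ C : ℝ, 0 < C ∧ ∀ (g : Euc n → ENNReal) (k : ENNReal), Measurable g →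
    (∀ t : ℝ, 0 < t → ∫⁻ y in An n t, g y ^ 2 ≤ k * ENNReal.ofReal (t ^ ((n:ℝ) - 2 * σ))) → ∀ s : ℝ, 0 < s → ∀ z ∈ An n s,
    (∫⁻ y in {y : Euc n | ‖y‖ ≤ s / 2}, ENNReal.ofReal (‖y - z‖ ^ (1 - (n:ℝ))) * g y) +
    (∫⁻ y in {y : Euc n | 4 * s < ‖y‖}, ENNReal.ofReal (‖y - z‖ ^ (1 - (n:ℝ))) * g y) ≤ k ^ (1 / 2 : ℝ) * ENNReal.ofReal (C * s ^ (1 - σ)) := by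
  have hn4 : (4:ℝ) ≤ n := by exact_mod_cast hn
  obtain ⟨A, hA, hL⟩ := gL1 (n := n) (by omega)
  obtain ⟨Ci, hCi, hin⟩ := dyad_in (n := n) (by omega) (show 0 < (n:ℝ) - σ by linarith)
  obtain ⟨Co, hCo, hout⟩ := dyad_out (n := n) (show 1 - σ < 0 by linarith)
  refine ⟨A * Ci * (1 / 2) ^ (1 - σ) + A * (1 / 2) ^ (1 - (n:ℝ)) * Co * 4 ^ (1 - σ), by positivity, fun g k hg hk s hs z hz => ?_⟩
  set κ := k ^ (1 / 2 : ℝ) with hκ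
  have hgL : ∀ t : ℝ, 0 < t → ∫⁻ y in An n t, g y ≤ κ * ENNReal.ofReal A * ENNReal.ofReal (t ^ ((n:ℝ) - σ)) :=
    fun t ht => hL σ g k hg t ht (hk t ht)
  have hzs : s < ‖z‖ := hz.1
  have hzs2 : ‖z‖ ≤ 2 * s := hz.2
  rw [add_mul, ENNReal.ofReal_add (by positivity) (by positivity), mul_add]
  refine add_le_add ?_ ?_
  · have e := hin g _ hgL (s / 2) (by positivity)
    calc ∫⁻ y in {y : Euc n | ‖y‖ ≤ s / 2}, ENNReal.ofReal (‖y - z‖ ^ (1 - (n:ℝ))) * g y 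
        ≤ ∫⁻ y in {y : Euc n | ‖y‖ ≤ s / 2}, ENNReal.ofReal ((s / 2) ^ (1 - (n:ℝ))) * g y := by
          refine setLIntegral_mono' (meas_cb _) fun y hy => mul_le_mul_left (ENNReal.ofReal_le_ofReal ?_) _
          have hy : ‖y‖ ≤ s / 2 := hy
          have := norm_sub_norm_le z y
          rw [norm_sub_rev] at this
          exact Real.rpow_le_rpow_of_nonpos (by positivity) (by linarith) (by linarith)
      _ = ENNReal.ofReal ((s / 2) ^ (1 - (n:ℝ))) * ∫⁻ y in {y : Euc n | ‖y‖ ≤ s / 2}, g y := lintegral_const_mul' _ _ ENNReal.ofReal_ne_top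
      _ ≤ ENNReal.ofReal ((s / 2) ^ (1 - (n:ℝ))) * (κ * ENNReal.ofReal A * ENNReal.ofReal (Ci * (s / 2) ^ ((n:ℝ) - σ))) := mul_le_mul_right e _
      _ = _ := by
        rw [mul_comm, mul_assoc, mul_assoc, ← ENNReal.ofReal_mul (by positivity), ← ENNReal.ofReal_mul (by positivity)]
        congr 2
        have : (1/2:ℝ) ^ (1 - σ) * s ^ (1 - σ) = (s / 2) ^ ((n:ℝ) - σ) * (s / 2) ^ (1 - (n:ℝ)) := by
          rw [← Real.rpow_add (by positivity), ← Real.mul_rpow (by positivity) (by positivity)]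
          congr 1 <;> ring
        linear_combination (-(A * Ci)) * this
  · have e := hout (fun y => ENNReal.ofReal ((‖y‖ / 2) ^ (1 - (n:ℝ))) * g y) (κ * ENNReal.ofReal (A * (1 / 2) ^ (1 - (n:ℝ)))) (fun t ht => ?_) (4 * s) (by positivity)
    · calc ∫⁻ y in {y : Euc n | 4 * s < ‖y‖}, ENNReal.ofReal (‖y - z‖ ^ (1 - (n:ℝ))) * g y 
        ≤ ∫⁻ y in {y : Euc n | 4 * s < ‖y‖}, ENNReal.ofReal ((‖y‖ / 2) ^ (1 - (n:ℝ))) * g y := by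
            refine setLIntegral_mono' (measurableSet_lt measurable_const measurable_norm) fun y hy => mul_le_mul_left (ENNReal.ofReal_le_ofReal ?_) _
            have hy : 4 * s < ‖y‖ := hy
            have := norm_sub_norm_le y z
            exact Real.rpow_le_rpow_of_nonpos (by linarith) (by linarith) (by linarith)
        _ ≤ _ := e
        _ = _ := by
          rw [mul_assoc, ← ENNReal.ofReal_mul (by positivity)]
          congr 2
          rw [Real.mul_rpow (by norm_num) hs.le]; ring
    · calc ∫⁻ y in An n t, ENNReal.ofReal ((‖y‖ / 2) ^ (1 - (n:ℝ))) * g y 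
          ≤ ∫⁻ y in An n t, ENNReal.ofReal ((t / 2) ^ (1 - (n:ℝ))) * g y := by
            refine setLIntegral_mono' (An_meas t) fun y hy => mul_le_mul_left (ENNReal.ofReal_le_ofReal ?_) _
            have := hy.1
            exact Real.rpow_le_rpow_of_nonpos (by linarith) (by linarith) (by linarith)
        _ = ENNReal.ofReal ((t / 2) ^ (1 - (n:ℝ))) * ∫⁻ y in An n t, g y := lintegral_const_mul' _ _ ENNReal.ofReal_ne_top
        _ ≤ ENNReal.ofReal ((t / 2) ^ (1 - (n:ℝ))) * (κ * ENNReal.ofReal A * ENNReal.ofReal (t ^ ((n:ℝ) - σ))) := mul_le_mul_right (hgL t ht) _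
        _ = _ := by
          rw [mul_comm, mul_assoc, mul_assoc, mul_assoc, ← ENNReal.ofReal_mul (by positivity), ← ENNReal.ofReal_mul (by positivity), ← ENNReal.ofReal_mul (by positivity)]
          congr 2
          have : t ^ (1 - σ) = t ^ ((n:ℝ) - σ) * t ^ (1 - (n:ℝ)) := by
            rw [← Real.rpow_add ht]; congr 1; ring
          rw [this, div_eq_mul_inv, Real.mul_rpow ht.le (by norm_num)]
          norm_num; ring

lemma annT (hn : 4 ≤ n) {σ : ℝ} (h1 : 1 < σ) (h2 : σ < n) : ∃ C : ℝ, 0 < C ∧ ∀ (g : Euc n → ENNReal) (k : ENNReal), Measurable g →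
    (∀ t : ℝ, 0 < t → ∫⁻ y in An n t, g y ^ 2 ≤ k * ENNReal.ofReal (t ^ ((n:ℝ) - 2 * σ))) → ∀ s : ℝ, 0 < s →
    ∫⁻ z in An n s, (∫⁻ y, ENNReal.ofReal (‖y - z‖ ^ (1 - (n:ℝ))) * g y) ^ 2 ≤ ENNReal.ofReal C * k * ENNReal.ofReal (s ^ ((n:ℝ) + 2 - 2 * σ)) := by
  have hn4 : (4:ℝ) ≤ n := by exact_mod_cast hn
  obtain ⟨N, hN, hnf⟩ := nearfar hn h1 h2
  obtain ⟨B, hB, hker⟩ := ker_tr (n := n) (by omega)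
  obtain ⟨ω, hω, hv⟩ := volA (n := n) (by omega)
  set D : ℝ := (1/2) ^ ((n:ℝ) - 2 * σ) + (1 + 2 ^ ((n:ℝ) - 2 * σ)) with hD
  have hD0 : 0 < D := by positivity
  refine ⟨4 * (N ^ 2 * ω + B * (B * D)), by positivity, fun g k hg hk s hs => ?_⟩
  set m : Set (Euc n) := An n (s / 2) ∪ (An n s ∪ An n (2 * s)) with hm
  have hmm : MeasurableSet m := (An_meas _).union ((An_meas _).union (An_meas _))
  have hm4 : ∀ y ∈ m, ‖y‖ ≤ 4 * s := by
    rintro y (h | h | h) <;> linarith [h.2]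
  have hg2 : ∫⁻ y in m, g y ^ 2 ≤ k * ENNReal.ofReal (D * s ^ ((n:ℝ) - 2 * σ)) := by
    refine (lintegral_union_le _ _ _).trans ?_
    refine (add_le_add (hk _ (by positivity)) ((lintegral_union_le _ _ _).trans (add_le_add (hk _ hs) (hk _ (by positivity))))).trans (le_of_eq ?_)
    rw [← mul_add, ← mul_add, ← ENNReal.ofReal_add (by positivity) (by positivity), ← ENNReal.ofReal_add (by positivity) (by positivity)]
    congr 2
    rw [hD, Real.mul_rpow (by norm_num) hs.le, show s / 2 = 1 / 2 * s by ring, Real.mul_rpow (by norm_num) hs.le]; ring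
  have hpt : ∀ z ∈ An n s, (∫⁻ y, ENNReal.ofReal (‖y - z‖ ^ (1 - (n:ℝ))) * g y) ^ 2 ≤
      4 * (k * ENNReal.ofReal (N ^ 2 * s ^ (2 - 2 * σ)) + ENNReal.ofReal (B * s) * ∫⁻ y in m, ENNReal.ofReal (‖y - z‖ ^ (1 - (n:ℝ))) * g y ^ 2) := by
    intro z hz
    have hcov : (∫⁻ y, ENNReal.ofReal (‖y - z‖ ^ (1 - (n:ℝ))) * g y) ≤ 
       ((∫⁻ y in {y : Euc n | ‖y‖ ≤ s / 2}, ENNReal.ofReal (‖y - z‖ ^ (1 - (n:ℝ))) * g y) +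
        (∫⁻ y in {y : Euc n | 4 * s < ‖y‖}, ENNReal.ofReal (‖y - z‖ ^ (1 - (n:ℝ))) * g y)) + 
        ∫⁻ y in m, ENNReal.ofReal (‖y - z‖ ^ (1 - (n:ℝ))) * g y := by
      have hu : (Set.univ : Set (Euc n)) ⊆ ({y : Euc n | ‖y‖ ≤ s / 2} ∪ {y : Euc n | 4 * s < ‖y‖}) ∪ m := by
        intro y _
        simp only [hm, An, Set.mem_union, Set.mem_ofPred_eq]
        by_cases a1 : ‖y‖ ≤ s / 2
        · exact .inl (.inl a1)
        by_cases a2 : 4 * s < ‖y‖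
        · exact .inl (.inr a2)
        right
        rw [not_le] at a1; rw [not_lt] at a2
        by_cases a3 : ‖y‖ ≤ s
        · exact .inl ⟨a1, by linarith⟩
        rw [not_le] at a3
        by_cases a4 : ‖y‖ ≤ 2 * s
        · exact .inr (.inl ⟨a3, a4⟩)
        · exact .inr (.inr ⟨not_le.1 a4, by linarith⟩)
      rw [← setLIntegral_univ]
      exact (lintegral_mono_set hu).trans ((lintegral_union_le _ _ _).trans (add_le_add_left (lintegral_union_le _ _ _) _))
    refine (pow_le_pow_left' hcov 2).trans ((addsq _ _).trans (mul_le_mul_right (add_le_add ?_ ?_) _))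
    · refine (pow_le_pow_left' (hnf g k hg hk s hs z hz) 2).trans (le_of_eq ?_)
      rw [mul_pow, sqE, ← ENNReal.ofReal_pow (by positivity), mul_pow, ← Real.rpow_natCast (s ^ (1 - σ)), ← Real.rpow_mul hs.le]
      congr 4; push_cast; ring
    · have hmK : Measurable fun y : Euc n => ENNReal.ofReal (‖y - z‖ ^ (1 - (n:ℝ))) := by fun_prop
      have := CS (volume.restrict m) (a := fun y => ENNReal.ofReal (‖y - z‖ ^ (1 - (n:ℝ))) ^ (1 / 2 : ℝ))
        (b := fun y => ENNReal.ofReal (‖y - z‖ ^ (1 - (n:ℝ))) ^ (1 / 2 : ℝ) * g y) (by fun_prop) (by fun_prop)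
      simp only [← mul_assoc, ← sq, mul_pow, sqE] at this
      refine this.trans (mul_le_mul_left (hker s hs m z (fun y hy => ?_) hmm) _)
      linarith [norm_sub_le y z, hm4 y hy, hz.2]
  refine (setLIntegral_mono' (An_meas s) hpt).trans ?_
  have hjm : Measurable fun p : Euc n × Euc n => ENNReal.ofReal (‖p.2 - p.1‖ ^ (1 - (n:ℝ))) * g p.2 ^ 2 := by fun_prop
  have hin : Measurable fun z => ∫⁻ y in m, ENNReal.ofReal (‖y - z‖ ^ (1 - (n:ℝ))) * g y ^ 2 := hjm.lintegral_prod_right'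
  rw [lintegral_const_mul' _ _ (by norm_num), lintegral_add_left measurable_const, lintegral_const_mul' _ _ ENNReal.ofReal_ne_top,
    lintegral_lintegral_swap hjm.aemeasurable, lintegral_const, Measure.restrict_apply_univ]
  have hsw : ∫⁻ y in m, ∫⁻ z in An n s, ENNReal.ofReal (‖y - z‖ ^ (1 - (n:ℝ))) * g y ^ 2 ≤ ∫⁻ y in m, ENNReal.ofReal (B * s) * g y ^ 2 := by
    refine setLIntegral_mono' hmm fun y hy => ?_
    rw [lintegral_mul_const _ (by fun_prop)]
    refine mul_le_mul_left ?_ _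
    simp_rw [norm_sub_rev y]
    exact hker s hs _ y (fun z hz => by linarith [norm_sub_le z y, hm4 y hy, hz.2]) (An_meas s)
  rw [lintegral_const_mul' _ _ ENNReal.ofReal_ne_top] at hsw
  have hfin := mul_le_mul_right (a := (4 : ENNReal)) (add_le_add (mul_le_mul_right (hv s hs) (k * ENNReal.ofReal (N ^ 2 * s ^ (2 - 2 * σ))))
    (mul_le_mul_right (hsw.trans (mul_le_mul_right hg2 _)) (ENNReal.ofReal (B * s))))
  refine hfin.trans (le_of_eq ?_)
  have e : (4:ENNReal) = ENNReal.ofReal 4 := by norm_num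
  have p1 : s ^ ((n:ℝ) + 2 - 2 * σ) = s ^ (2 - 2 * σ) * s ^ (n:ℝ) := by rw [← Real.rpow_add hs]; congr 1; ring
  have p2 : s ^ ((n:ℝ) + 2 - 2 * σ) = s * (s * s ^ ((n:ℝ) - 2 * σ)) := by
    rw [← mul_assoc, ← sq, ← Real.rpow_natCast s 2, ← Real.rpow_add hs]; congr 1; push_cast; ring
  have q1 : k * ENNReal.ofReal (N ^ 2 * s ^ (2 - 2 * σ)) * ENNReal.ofReal (ω * s ^ (n:ℝ)) = k * ENNReal.ofReal (N ^ 2 * ω * s ^ ((n:ℝ) + 2 - 2 * σ)) := by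
    rw [mul_assoc, ← ENNReal.ofReal_mul (by positivity), p1]; congr 2; ring
  have q2 : ENNReal.ofReal (B * s) * (ENNReal.ofReal (B * s) * (k * ENNReal.ofReal (D * s ^ ((n:ℝ) - 2 * σ)))) = k * ENNReal.ofReal (B * (B * D) * s ^ ((n:ℝ) + 2 - 2 * σ)) := by
    rw [show B * (B * D) * s ^ ((n:ℝ) + 2 - 2 * σ) = (B * s) * ((B * s) * (D * s ^ ((n:ℝ) - 2 * σ))) by rw [p2]; ring, ENNReal.ofReal_mul (p := B * s) (by positivity), ENNReal.ofReal_mul (p := B * s) (by positivity)]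
    ring
  rw [q1, q2, ← mul_add, ← ENNReal.ofReal_add (by positivity) (by positivity), ← add_mul, ENNReal.ofReal_mul (by positivity), ENNReal.ofReal_mul (by norm_num), e]
  ring

end Part15

section Part16

variable {n : ℕ}

lemma meas_gf {l : Fin n} {f : Fin n → Euc n → ℝ} {F : Fin n → Fin n → Euc n → ℝ} (H : WF l f F) : Measurable (gf f) :=
  measurable_of_continuousOn_compl_singleton 0 (gf_cont H)

lemma meas_gF {l : Fin n} {f : Fin n → Euc n → ℝ} {F : Fin n → Fin n → Euc n → ℝ} (H : WF l f F) : Measurable (gF F) :=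
  measurable_of_continuousOn_compl_singleton 0 (gF_cont H)

lemma gk {l : Fin n} {f : Fin n → Euc n → ℝ} {F : Fin n → Fin n → Euc n → ℝ} (H : WF l f F) {δ σ : ℝ} (hδ : 0 < δ) {M N : ENNReal}
    (hM : ∀ t : ℝ, 0 < t → t ≤ 2 * δ → ∫⁻ y in An n t ∩ {x : Euc n | 0 ≤ x l}, ENNReal.ofReal (gF F y) ^ 2 ≤ M * ENNReal.ofReal (t ^ ((n:ℝ) - 2 * σ)))
    (hN : ∀ t : ℝ, 0 < t → t ≤ 2 * δ → ∫⁻ y in An n t ∩ {x : Euc n | 0 ≤ x l}, ENNReal.ofReal (gf f y) ^ 2 ≤ N * ENNReal.ofReal (t ^ ((n:ℝ) + 2 - 2 * σ)))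
    (t : ℝ) (ht : 0 < t) :
    ∫⁻ y in An n t, (({y : Euc n | ‖y‖ ≤ 2 * δ} ∩ {x : Euc n | 0 ≤ x l}).indicator (fun y => ENNReal.ofReal (gF F y + ‖y‖ * gf f y)) y) ^ 2 ≤
      256 * (M + ENNReal.ofReal (δ ^ 4) * N) * ENNReal.ofReal (t ^ ((n:ℝ) - 2 * σ)) := by
  set S : Set (Euc n) := {y : Euc n | ‖y‖ ≤ 2 * δ} ∩ {x : Euc n | 0 ≤ x l} with hS
  have hSm : MeasurableSet S := (meas_cb _).inter (meas_half l)
  have e : ∀ y, (S.indicator (fun y => ENNReal.ofReal (gF F y + ‖y‖ * gf f y)) y) ^ 2 = S.indicator (fun y => ENNReal.ofReal (gF F y + ‖y‖ * gf f y) ^ 2) y := by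
    intro y; by_cases hy : y ∈ S <;> simp [hy]
  simp_rw [e]
  rw [lintegral_indicator hSm, Measure.restrict_restrict hSm]
  rcases le_total (2 * δ) t with h | h
  · have : S ∩ An n t = ∅ := by
      ext y; simp only [hS, An, Set.mem_inter_iff, Set.mem_ofPred_eq, Set.mem_empty_iff_false, iff_false]
      rintro ⟨⟨a, -⟩, b, -⟩; linarith
    rw [this]; simp
  have hm1 := meas_gf H
  have hm2 := meas_gF H
  have hsub : S ∩ An n t ⊆ An n t ∩ {x : Euc n | 0 ≤ x l} := fun y hy => ⟨hy.2, hy.1.2⟩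
  calc ∫⁻ y in S ∩ An n t, ENNReal.ofReal (gF F y + ‖y‖ * gf f y) ^ 2 
      ≤ ∫⁻ y in An n t ∩ {x : Euc n | 0 ≤ x l}, ENNReal.ofReal (gF F y + ‖y‖ * gf f y) ^ 2 := lintegral_mono_set hsub
    _ ≤ ∫⁻ y in An n t ∩ {x : Euc n | 0 ≤ x l}, 4 * (ENNReal.ofReal (gF F y) ^ 2 + ENNReal.ofReal (4 * t ^ 2) * ENNReal.ofReal (gf f y) ^ 2) := by
        refine setLIntegral_mono' ((An_meas t).inter (meas_half l)) fun y hy => ?_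
        rw [ENNReal.ofReal_add (gF_nn F y) (mul_nonneg (norm_nonneg _) (gf_nn f y))]
        refine (addsq _ _).trans (mul_le_mul_right (add_le_add_right ?_ _) _)
        rw [ENNReal.ofReal_mul (norm_nonneg _), mul_pow]
        refine mul_le_mul_left ?_ _
        rw [← ENNReal.ofReal_pow (norm_nonneg _)]
        refine ENNReal.ofReal_le_ofReal ?_
        nlinarith [hy.1.1, hy.1.2, norm_nonneg y]
    _ = 4 * ((∫⁻ y in An n t ∩ {x : Euc n | 0 ≤ x l}, ENNReal.ofReal (gF F y) ^ 2) + ENNReal.ofReal (4 * t ^ 2) * ∫⁻ y in An n t ∩ {x : Euc n | 0 ≤ x l}, ENNReal.ofReal (gf f y) ^ 2) := by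
        rw [lintegral_const_mul' _ _ (by norm_num), lintegral_add_left (by fun_prop), lintegral_const_mul' _ _ ENNReal.ofReal_ne_top]
    _ ≤ 4 * (M * ENNReal.ofReal (t ^ ((n:ℝ) - 2 * σ)) + ENNReal.ofReal (4 * t ^ 2) * (N * ENNReal.ofReal (t ^ ((n:ℝ) + 2 - 2 * σ)))) := 
        mul_le_mul_right (add_le_add (hM t ht h) (mul_le_mul_right (hN t ht h) _)) _
    _ ≤ 4 * (M * ENNReal.ofReal (t ^ ((n:ℝ) - 2 * σ)) + 64 * (ENNReal.ofReal (δ ^ 4) * N * ENNReal.ofReal (t ^ ((n:ℝ) - 2 * σ)))) := by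
        refine mul_le_mul_right (add_le_add_right ?_ _) _
        have e1 : t ^ ((n:ℝ) + 2 - 2 * σ) = t ^ 2 * t ^ ((n:ℝ) - 2 * σ) := by
          rw [← Real.rpow_natCast t 2, ← Real.rpow_add ht]; congr 1; push_cast; ring
        have e2 : (64:ENNReal) = ENNReal.ofReal 64 := by norm_num
        have h4 : t ^ 4 ≤ (2 * δ) ^ 4 := pow_le_pow_left₀ ht.le h 4
        calc ENNReal.ofReal (4 * t ^ 2) * (N * ENNReal.ofReal (t ^ ((n:ℝ) + 2 - 2 * σ))) = N * ENNReal.ofReal (4 * t ^ 4 * t ^ ((n:ℝ) - 2 * σ)) := by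
              rw [mul_left_comm, ← ENNReal.ofReal_mul (by positivity), e1]; congr 2; ring
          _ ≤ N * ENNReal.ofReal (64 * (δ ^ 4 * t ^ ((n:ℝ) - 2 * σ))) := by
              refine mul_le_mul_right (ENNReal.ofReal_le_ofReal ?_) _
              have : 0 < t ^ ((n:ℝ) - 2 * σ) := by positivity
              nlinarith
          _ = _ := by rw [ENNReal.ofReal_mul (by norm_num), ENNReal.ofReal_mul (by positivity), ← e2]; ring
    _ ≤ 4 * (64 * (M * ENNReal.ofReal (t ^ ((n:ℝ) - 2 * σ))) + 64 * (ENNReal.ofReal (δ ^ 4) * N * ENNReal.ofReal (t ^ ((n:ℝ) - 2 * σ)))) := by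
        refine mul_le_mul_right (add_le_add_left ?_ _) _
        exact le_mul_of_one_le_left' (by norm_num)
    _ = _ := by ring

lemma core (hn : 4 ≤ n) {σ : ℝ} (h1 : 1 < σ) (h2 : σ < n) : ∃ C1 : ℝ, 0 < C1 ∧ ∀ (l : Fin n) (f : Fin n → Euc n → ℝ) (F : Fin n → Fin n → Euc n → ℝ), WF l f F →
    (∃ t0 : ℝ, 0 < t0 ∧ ∀ y, y ≠ 0 → ‖y‖ ≤ t0 → gF F y = 0) →
    Filter.Tendsto (fun τ : ℝ => ENNReal.ofReal (τ ^ (-2:ℝ)) * ∫⁻ y in {y : Euc n | τ ≤ ‖y‖ ∧ ‖y‖ ≤ 2 * τ} ∩ {x : Euc n | 0 ≤ x l},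
      ENNReal.ofReal (gf f y)) (nhdsWithin 0 (Set.Ioi 0)) (nhds 0) →
    ∀ δ : ℝ, 0 < δ → δ ≤ 1 → ∀ M N : ENNReal,
    (∀ t : ℝ, 0 < t → t ≤ 2 * δ → ∫⁻ y in An n t ∩ {x : Euc n | 0 ≤ x l}, ENNReal.ofReal (gF F y) ^ 2 ≤ M * ENNReal.ofReal (t ^ ((n:ℝ) - 2 * σ))) →
    (∀ t : ℝ, 0 < t → t ≤ 2 * δ → ∫⁻ y in An n t ∩ {x : Euc n | 0 ≤ x l}, ENNReal.ofReal (gf f y) ^ 2 ≤ N * ENNReal.ofReal (t ^ ((n:ℝ) + 2 - 2 * σ))) →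
    ∀ s : ℝ, 0 < s → 4 * s ≤ δ →
    ∫⁻ y in An n s ∩ {x : Euc n | 0 ≤ x l}, ENNReal.ofReal (gf f y) ^ 2 ≤ ENNReal.ofReal C1 * ((M + ENNReal.ofReal (δ ^ 4) * N) + 
      ENNReal.ofReal (δ ^ (-(n:ℝ))) ^ 2 * (∫⁻ y in {y : Euc n | δ ≤ ‖y‖ ∧ ‖y‖ ≤ 2 * δ} ∩ {x : Euc n | 0 ≤ x l}, ENNReal.ofReal (gf f y)) ^ 2) *
      ENNReal.ofReal (s ^ ((n:ℝ) + 2 - 2 * σ)) := by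
  obtain ⟨C0, hC0, hrep⟩ := rep2 hn
  obtain ⟨Ct, hCt, hT⟩ := annT hn h1 h2
  obtain ⟨ω, hω, hv⟩ := volA (n := n) (by omega)
  have hn0 : (0:ℝ) < n := by exact_mod_cast (show 0 < n by omega)
  refine ⟨n ^ 2 * C0 ^ 2 * 4 * (256 * Ct + ω), by positivity, fun l f F H hF hτ δ hδ hδ1 M N hM hN s hs hsδ => ?_⟩
  set S : Set (Euc n) := {y : Euc n | ‖y‖ ≤ 2 * δ} ∩ {x : Euc n | 0 ≤ x l} with hS
  have hSm : MeasurableSet S := (meas_cb _).inter (meas_half l)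
  have hm1 := meas_gf H
  have hm2 := meas_gF H
  set g : Euc n → ENNReal := S.indicator (fun y => ENNReal.ofReal (gF F y + ‖y‖ * gf f y)) with hg
  have hgm : Measurable g := Measurable.indicator (by fun_prop) hSm
  set Y := ∫⁻ y in {y : Euc n | δ ≤ ‖y‖ ∧ ‖y‖ ≤ 2 * δ} ∩ {x : Euc n | 0 ≤ x l}, ENNReal.ofReal (gf f y) with hY
  set D := ENNReal.ofReal (δ ^ (-(n:ℝ))) with hD
  set k := 256 * (M + ENNReal.ofReal (δ ^ 4) * N) with hk
  have hT' := hT g k hgm (fun t ht => gk H hδ hM hN t ht) s hs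
  set T : Euc n → ENNReal := fun z => ∫⁻ y, ENNReal.ofReal (‖y - z‖ ^ (1 - (n:ℝ))) * g y with hTd
  have hpt : ∀ z ∈ An n s ∩ {x : Euc n | 0 ≤ x l}, z l ≠ 0 → ENNReal.ofReal (gf f z) ^ 2 ≤ ENNReal.ofReal (n ^ 2 * C0 ^ 2 * 4) * (T z ^ 2 + D ^ 2 * Y ^ 2) := by
    intro z hz hz0
    have hzl : 0 < z l := lt_of_le_of_ne hz.2 (Ne.symm hz0)
    have hX : ∫⁻ y in S, ENNReal.ofReal (‖y - z‖ ^ (1 - (n:ℝ)) * (gF F y + ‖y‖ * gf f y)) = T z := by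
      rw [hTd, ← lintegral_indicator hSm]
      refine lintegral_congr fun y => ?_
      by_cases hy : y ∈ S
      · simp only [hg, Set.indicator_of_mem hy]; rw [ENNReal.ofReal_mul (by positivity)]
      · simp [hg, hy]
    have hj : ∀ j, ENNReal.ofReal |f j z| ≤ ENNReal.ofReal C0 * (T z + D * Y) := fun j => by
      have := hrep l f F H hF hτ δ hδ hδ1 z hzl (by linarith [hz.1.2]) j
      rwa [hX] at this
    have hsum : ENNReal.ofReal (gf f z) ≤ n * (ENNReal.ofReal C0 * (T z + D * Y)) := by
      rw [gf, ENNReal.ofReal_sum_of_nonneg (fun _ _ => abs_nonneg _)]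
      refine (Finset.sum_le_sum fun j _ => hj j).trans ?_
      simp
    refine (pow_le_pow_left' hsum 2).trans ?_
    rw [mul_pow, mul_pow, ENNReal.ofReal_mul (by positivity), ENNReal.ofReal_mul (by positivity), ENNReal.ofReal_pow hC0.le,
      ENNReal.ofReal_pow hn0.le, ENNReal.ofReal_natCast, show ENNReal.ofReal 4 = 4 by norm_num, mul_assoc, mul_assoc]
    refine mul_le_mul_right (mul_le_mul_right ?_ _) _
    rw [← mul_pow]
    exact addsq _ _
  have hae : ∀ᵐ z : Euc n, z l ≠ 0 := by
    rw [ae_iff]; simpa using null_bdry l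
  have hsp : s ^ (n:ℝ) ≤ s ^ ((n:ℝ) + 2 - 2 * σ) := Real.rpow_le_rpow_of_exponent_ge hs (by linarith) (by linarith)
  calc ∫⁻ y in An n s ∩ {x : Euc n | 0 ≤ x l}, ENNReal.ofReal (gf f y) ^ 2 
      ≤ ∫⁻ z in An n s ∩ {x : Euc n | 0 ≤ x l}, ENNReal.ofReal (n ^ 2 * C0 ^ 2 * 4) * (T z ^ 2 + D ^ 2 * Y ^ 2) := by
        refine setLIntegral_mono_ae' ((An_meas s).inter (meas_half l)) ?_
        filter_upwards [hae] with z hz0 hz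
        exact hpt z hz hz0
    _ ≤ ∫⁻ z in An n s, ENNReal.ofReal (n ^ 2 * C0 ^ 2 * 4) * (T z ^ 2 + D ^ 2 * Y ^ 2) := lintegral_mono_set Set.inter_subset_left
    _ = ENNReal.ofReal (n ^ 2 * C0 ^ 2 * 4) * ((∫⁻ z in An n s, T z ^ 2) + D ^ 2 * Y ^ 2 * volume (An n s)) := by
        rw [lintegral_const_mul' _ _ ENNReal.ofReal_ne_top, lintegral_add_right _ measurable_const, lintegral_const, Measure.restrict_apply_univ]
    _ ≤ ENNReal.ofReal (n ^ 2 * C0 ^ 2 * 4) * (ENNReal.ofReal Ct * k * ENNReal.ofReal (s ^ ((n:ℝ) + 2 - 2 * σ)) + D ^ 2 * Y ^ 2 * ENNReal.ofReal (ω * s ^ ((n:ℝ) + 2 - 2 * σ))) := by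
        refine mul_le_mul_right (add_le_add hT' (mul_le_mul_right ((hv s hs).trans (ENNReal.ofReal_le_ofReal ?_)) _)) _
        exact mul_le_mul_of_nonneg_left hsp hω.le
    _ = ENNReal.ofReal (n ^ 2 * C0 ^ 2 * 4) * (ENNReal.ofReal (256 * Ct) * (M + ENNReal.ofReal (δ ^ 4) * N) + ENNReal.ofReal ω * (D ^ 2 * Y ^ 2)) * ENNReal.ofReal (s ^ ((n:ℝ) + 2 - 2 * σ)) := by
        rw [hk, ENNReal.ofReal_mul hω.le, ENNReal.ofReal_mul (p := 256) (by norm_num), show ENNReal.ofReal 256 = 256 by norm_num]; ring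
    _ ≤ _ := by
        rw [ENNReal.ofReal_mul (p := n ^ 2 * C0 ^ 2 * 4) (by positivity), mul_assoc (ENNReal.ofReal (n ^ 2 * C0 ^ 2 * 4)) _ (_ + _), ENNReal.ofReal_add (by positivity) hω.le]
        refine mul_le_mul_left (mul_le_mul_right ?_ _) _
        rw [mul_add (ENNReal.ofReal (256 * Ct) + ENNReal.ofReal ω)]
        exact add_le_add (mul_le_mul_left le_self_add _) (mul_le_mul_left le_add_self _)

end Part16

section Part17

variable {n : ℕ}

lemma transf (hn : 0 < n) {A B : Set (Euc n)} (hA : MeasurableSet A) (hB : MeasurableSet B) (hAB : ∀ y : Euc n, y ≠ 0 → (Jv y ∈ A ↔ y ∈ B))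
    {Φ G : Euc n → ENNReal} {c : ENNReal} (hc : c ≠ ⊤) 
    (hle : ∀ y ∈ B, y ≠ 0 → ENNReal.ofReal (‖y‖ ^ (2 * n))⁻¹ * Φ (Jv y) ≤ c * G y) : ∫⁻ x in A, Φ x ≤ c * ∫⁻ y in B, G y := by
  rw [← lintegral_indicator hA, lint_J hn, ← lintegral_const_mul' _ _ hc, ← lintegral_indicator hB]
  have h0 : ∀ᵐ y : Euc n, y ≠ 0 := by
    have : Nonempty (Fin n) := ⟨⟨0, hn⟩⟩
    rw [ae_iff]; simp
  refine lintegral_mono_ae ?_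
  filter_upwards [h0] with y hy
  by_cases hB' : y ∈ B
  · rw [Set.indicator_of_mem ((hAB y hy).2 hB'), Set.indicator_of_mem hB']; exact hle y hB' hy
  · rw [Set.indicator_of_notMem (fun h => hB' ((hAB y hy).1 h))]; simp

def Ar (l : Fin n) (r : ℝ) : Set (Euc n) := (Metric.ball (0 : Euc n) (2 * r) \ Metric.ball (0 : Euc n) r) ∩ {x : Euc n | 0 ≤ x l}

lemma Ar_meas (l : Fin n) (r : ℝ) : MeasurableSet (Ar l r) := (measurableSet_ball.diff measurableSet_ball).inter (meas_half l)

lemma Ar_mem {l : Fin n} {r : ℝ} {x : Euc n} : x ∈ Ar l r ↔ (‖x‖ < 2 * r ∧ r ≤ ‖x‖) ∧ 0 ≤ x l := by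
  simp [Ar]

lemma Jv_half {l : Fin n} {y : Euc n} (hy : y ≠ 0) : 0 ≤ (Jv y) l ↔ 0 ≤ y l := by
  have : 0 < (‖y‖ ^ 2)⁻¹ := by have := norm_pos_iff.2 hy; positivity
  rw [Jv_apply]
  exact mul_nonneg_iff_of_pos_left this

lemma Jv_Ar {l : Fin n} {r t : ℝ} (hr : 0 < r) (ht : 2 * r * t = 1) {y : Euc n} (hy : y ≠ 0) : Jv y ∈ Ar l r ↔ y ∈ An n t ∩ {x : Euc n | 0 ≤ x l} := by
  have hy' := norm_pos_iff.2 hy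
  have e : t = (2 * r)⁻¹ := eq_inv_of_mul_eq_one_right ht
  rw [Ar_mem, Jv_half hy, norm_Jv]
  refine and_congr (and_congr ?_ ?_) Iff.rfl
  · rw [e, inv_lt_comm₀ hy' (by positivity)]
  · rw [le_inv_comm₀ hr hy']
    rw [e, show 2 * (2 * r)⁻¹ = r⁻¹ by field_simp]

lemma Jv_An {l : Fin n} {r t : ℝ} (hr : 0 < r) (ht : 2 * r * t = 1) {y : Euc n} (hy : y ≠ 0) : Jv y ∈ An n t ∩ {x : Euc n | 0 ≤ x l} ↔ y ∈ Ar l r := by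
  rw [← Jv_Ar hr ht (Jv_ne hy), Jv_Jv]

lemma sum_abs_sq {ι : Type*} [Fintype ι] (a : ι → ℝ) : (∑ i, |a i|) ^ 2 ≤ Fintype.card ι * ∑ i, a i ^ 2 := by
  have := sq_sum_le_card_mul_sum_sq (s := Finset.univ) (f := fun i => |a i|)
  simpa using this

lemma Kvi_sq (V : Fin n → Euc n → ℝ) (y : Euc n) : ∑ i, Kvi V i y ^ 2 = ‖y‖ ^ 4 * ∑ i, V i (Jv y) ^ 2 := by
  set S := ∑ m, y m * V m (Jv y) with hS
  have e : ∀ i, Kvi V i y ^ 2 = ‖y‖ ^ 4 * V i (Jv y) ^ 2 - 4 * ‖y‖ ^ 2 * S * (y i * V i (Jv y)) + 4 * S ^ 2 * y i ^ 2 := fun i => by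
    rw [Kvi, ← hS]; ring
  simp_rw [e]
  rw [Finset.sum_add_distrib, Finset.sum_sub_distrib, ← Finset.mul_sum, ← Finset.mul_sum, ← Finset.mul_sum, ← hS, ← normsq_eq]
  ring

lemma gf_sq_le (V : Fin n → Euc n → ℝ) (y : Euc n) : gf (Kvi V) y ^ 2 ≤ n * (‖y‖ ^ 4 * ∑ i, V i (Jv y) ^ 2) := by
  have := sum_abs_sq (fun i => Kvi V i y)
  rw [Kvi_sq, Fintype.card_fin] at this
  exact this

lemma le_gf_sq (V : Fin n → Euc n → ℝ) (y : Euc n) : ‖y‖ ^ 4 * ∑ i, V i (Jv y) ^ 2 ≤ gf (Kvi V) y ^ 2 := by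
  rw [← Kvi_sq, gf]
  have := Finset.sum_sq_le_sq_sum_of_nonneg (s := Finset.univ) (f := fun i => |Kvi V i y|) (fun i _ => abs_nonneg _)
  simpa using this

lemma Rm_abs {y : Euc n} (hy : y ≠ 0) (i k : Fin n) : |Rm y i k| ≤ 1 := by
  have h := Rm_mul hy i i
  rw [kd, if_pos rfl] at h
  have h2 := Finset.single_le_sum (f := fun m => Rm y i m * Rm y i m) (fun m _ => mul_self_nonneg _) (Finset.mem_univ k)
  rw [abs_le_one_iff_mul_self_le_one]
  linarith

lemma gF_sq_le (h : Fin n → Fin n → Euc n → ℝ) {y : Euc n} (hy : y ≠ 0) : gF (FF h) y ^ 2 ≤ (n:ℝ) ^ 6 * ∑ i, ∑ k, h i k (Jv y) ^ 2 := by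
  have h1 : ∀ i k, |FF h i k y| ≤ ∑ m, ∑ l, |h m l (Jv y)| := fun i k => by
    unfold FF
    refine (Finset.abs_sum_le_sum_abs _ _).trans (Finset.sum_le_sum fun m _ => (Finset.abs_sum_le_sum_abs _ _).trans (Finset.sum_le_sum fun l _ => ?_))
    rw [abs_mul, abs_mul]
    have a := Rm_abs hy i m
    have b := Rm_abs hy k l
    have : |Rm y i m| * |Rm y k l| ≤ 1 := mul_le_one₀ a (abs_nonneg _) b
    nlinarith [abs_nonneg (h m l (Jv y))]
  have h2 : gF (FF h) y ≤ n * (n * ∑ m, ∑ l, |h m l (Jv y)|) := by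
    unfold gF
    refine (Finset.sum_le_sum fun i _ => Finset.sum_le_sum fun k _ => h1 i k).trans (le_of_eq ?_)
    simp
  have h3 : (∑ m, ∑ l, |h m l (Jv y)|) ^ 2 ≤ n ^ 2 * ∑ i, ∑ k, h i k (Jv y) ^ 2 := by
    have := sum_abs_sq (fun p : Fin n × Fin n => h p.1 p.2 (Jv y))
    rw [Fintype.sum_prod_type, Fintype.sum_prod_type, Fintype.card_prod, Fintype.card_fin] at this
    push_cast at this
    simpa [sq] using this
  refine (pow_le_pow_left₀ (gF_nn _ _) h2 2).trans ?_
  rw [mul_pow, mul_pow]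
  have : (0:ℝ) ≤ (n:ℝ) ^ 2 := by positivity
  calc (n:ℝ) ^ 2 * ((n:ℝ) ^ 2 * (∑ m, ∑ l, |h m l (Jv y)|) ^ 2) ≤ (n:ℝ) ^ 2 * ((n:ℝ) ^ 2 * (n ^ 2 * ∑ i, ∑ k, h i k (Jv y) ^ 2)) := by gcongr
    _ = _ := by ring

lemma T1 (hn : 0 < n) (l : Fin n) (V : Fin n → Euc n → ℝ) {r t : ℝ} (hr : 0 < r) (ht : 2 * r * t = 1) :
    ∫⁻ y in An n t ∩ {x : Euc n | 0 ≤ x l}, ENNReal.ofReal (gf (Kvi V) y) ^ 2 ≤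
      ENNReal.ofReal (n * (r ^ (2 * n + 4))⁻¹) * ∫⁻ x in Ar l r, ENNReal.ofReal (∑ i, V i x ^ 2) := by
  refine transf hn ((An_meas t).inter (meas_half l)) (Ar_meas l r) (fun y hy => Jv_An hr ht hy) ENNReal.ofReal_ne_top fun y hy hy0 => ?_
  have hyr := (Ar_mem.1 hy).1.2
  rw [← ENNReal.ofReal_pow (gf_nn _ _), ← ENNReal.ofReal_mul (by positivity), ← ENNReal.ofReal_mul (by positivity)]
  refine ENNReal.ofReal_le_ofReal ?_
  have h1 := gf_sq_le V (Jv y)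
  rw [Jv_Jv, norm_Jv] at h1
  have hs : 0 ≤ ∑ i, V i y ^ 2 := Finset.sum_nonneg fun _ _ => sq_nonneg _
  have hy' : 0 < ‖y‖ := hr.trans_le hyr
  calc (‖y‖ ^ (2 * n))⁻¹ * gf (Kvi V) (Jv y) ^ 2 ≤ (‖y‖ ^ (2 * n))⁻¹ * (n * (‖y‖⁻¹ ^ 4 * ∑ i, V i y ^ 2)) := by gcongr
    _ = n * (‖y‖ ^ (2 * n + 4))⁻¹ * ∑ i, V i y ^ 2 := by rw [pow_add, mul_inv, inv_pow]; ring
    _ ≤ _ := by gcongr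

lemma T2 (hn : 0 < n) (l : Fin n) (h : Fin n → Fin n → Euc n → ℝ) {r t : ℝ} (hr : 0 < r) (ht : 2 * r * t = 1) :
    ∫⁻ y in An n t ∩ {x : Euc n | 0 ≤ x l}, ENNReal.ofReal (gF (FF h) y) ^ 2 ≤
      ENNReal.ofReal ((n:ℝ) ^ 6 * (r ^ (2 * n))⁻¹) * ∫⁻ x in Ar l r, ENNReal.ofReal (∑ i, ∑ k, h i k x ^ 2) := by
  refine transf hn ((An_meas t).inter (meas_half l)) (Ar_meas l r) (fun y hy => Jv_An hr ht hy) ENNReal.ofReal_ne_top fun y hy hy0 => ?_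
  have hyr := (Ar_mem.1 hy).1.2
  rw [← ENNReal.ofReal_pow (gF_nn _ _), ← ENNReal.ofReal_mul (by positivity), ← ENNReal.ofReal_mul (by positivity)]
  refine ENNReal.ofReal_le_ofReal ?_
  have h1 := gF_sq_le h (Jv_ne hy0)
  rw [Jv_Jv] at h1
  have hs : 0 ≤ ∑ i, ∑ k, h i k y ^ 2 := Finset.sum_nonneg fun _ _ => Finset.sum_nonneg fun _ _ => sq_nonneg _
  have hy' : 0 < ‖y‖ := hr.trans_le hyr
  calc (‖y‖ ^ (2 * n))⁻¹ * gF (FF h) (Jv y) ^ 2 ≤ (r ^ (2 * n))⁻¹ * ((n:ℝ) ^ 6 * ∑ i, ∑ k, h i k y ^ 2) := by gcongr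
    _ = _ := by ring

lemma T3 (hn : 0 < n) (l : Fin n) (V : Fin n → Euc n → ℝ) {r t : ℝ} (hr : 0 < r) (ht : 2 * r * t = 1) :
    ∫⁻ x in Ar l r, ENNReal.ofReal (∑ i, V i x ^ 2) ≤
      ENNReal.ofReal ((t ^ (2 * n + 4))⁻¹) * ∫⁻ y in An n t ∩ {x : Euc n | 0 ≤ x l}, ENNReal.ofReal (gf (Kvi V) y) ^ 2 := by
  have ht0 : 0 < t := by by_contra hc; nlinarith
  refine transf hn (Ar_meas l r) ((An_meas t).inter (meas_half l)) (fun y hy => Jv_Ar hr ht hy) ENNReal.ofReal_ne_top fun y hy hy0 => ?_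
  have hyt : t < ‖y‖ := hy.1.1
  have hy' : 0 < ‖y‖ := ht0.trans hyt
  rw [← ENNReal.ofReal_pow (gf_nn _ _), ← ENNReal.ofReal_mul (by positivity), ← ENNReal.ofReal_mul (by positivity)]
  refine ENNReal.ofReal_le_ofReal ?_
  have h1 := le_gf_sq V y
  calc (‖y‖ ^ (2 * n))⁻¹ * ∑ i, V i (Jv y) ^ 2 = (‖y‖ ^ (2 * n + 4))⁻¹ * (‖y‖ ^ 4 * ∑ i, V i (Jv y) ^ 2) := by rw [pow_add]; field_simp
    _ ≤ (t ^ (2 * n + 4))⁻¹ * gf (Kvi V) y ^ 2 := by gcongr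

lemma Ar_int (l : Fin n) (r : ℝ) {Φ : Euc n → ℝ} (hΦ : Continuous Φ) (hp : ∀ x, 0 ≤ Φ x) :
    ∫⁻ x in Ar l r, ENNReal.ofReal (Φ x) = ENNReal.ofReal (∫ x in Ar l r, Φ x) := by
  refine (ofReal_integral_eq_lintegral_ofReal ?_ (ae_of_all _ hp)).symm
  have : IntegrableOn Φ (closedBall 0 (2 * r)) := hΦ.continuousOn.integrableOn_compact (isCompact_closedBall _ _)
  exact this.mono_set fun x hx => by simpa using (Ar_mem.1 hx).1.1.le

lemma PV_I (l : Fin n) (V : Fin n → Euc n → ℝ) (hV : ∀ i, ContDiff ℝ (⊤ : ℕ∞) (V i)) {r : ℝ} (hr : 0 < r)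
    (hI : IntegrableOn (fun x : Euc n => (1 + ‖x‖ ^ 2) ^ (-(n : ℝ) - 2) * ∑ i, (V i x) ^ 2) {x : Euc n | 0 ≤ x l}) :
    ∫ x in Ar l r, ∑ i, V i x ^ 2 ≤ (1 + 4 * r ^ 2) ^ ((n:ℝ) + 2) * ∫ x in {x : Euc n | 0 ≤ x l}, (1 + ‖x‖ ^ 2) ^ (-(n : ℝ) - 2) * ∑ i, (V i x) ^ 2 := by
  have hsub : Ar l r ⊆ {x : Euc n | 0 ≤ x l} := fun x hx => hx.2
  have hnn : ∀ x : Euc n, 0 ≤ (1 + ‖x‖ ^ 2) ^ (-(n : ℝ) - 2) * ∑ i, (V i x) ^ 2 := fun x => by positivity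
  have hc : Continuous fun x => ∑ i, V i x ^ 2 := by
    have := fun i => (hV i).continuous
    fun_prop
  calc ∫ x in Ar l r, ∑ i, V i x ^ 2 ≤ ∫ x in Ar l r, (1 + 4 * r ^ 2) ^ ((n:ℝ) + 2) * ((1 + ‖x‖ ^ 2) ^ (-(n : ℝ) - 2) * ∑ i, (V i x) ^ 2) := by
        refine setIntegral_mono_on ?_ ((hI.mono_set hsub).const_mul _) (Ar_meas l r) fun x hx => ?_
        · have : IntegrableOn (fun x => ∑ i, V i x ^ 2) (closedBall 0 (2 * r)) := hc.continuousOn.integrableOn_compact (isCompact_closedBall _ _)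
          exact this.mono_set fun x hx => by simpa using (Ar_mem.1 hx).1.1.le
        · have h2 := (Ar_mem.1 hx).1.1
          have hs : 0 ≤ ∑ i, V i x ^ 2 := Finset.sum_nonneg fun _ _ => sq_nonneg _
          have : (1 + ‖x‖ ^ 2) ^ ((n:ℝ) + 2) ≤ (1 + 4 * r ^ 2) ^ ((n:ℝ) + 2) := by
            refine Real.rpow_le_rpow (by positivity) ?_ (by positivity)
            nlinarith [norm_nonneg x]
          have e : (1 + ‖x‖ ^ 2) ^ (-(n : ℝ) - 2) = ((1 + ‖x‖ ^ 2) ^ ((n:ℝ) + 2))⁻¹ := by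
            rw [← Real.rpow_neg (by positivity)]; congr 1; ring
          have hp : 0 < (1 + ‖x‖ ^ 2) ^ ((n:ℝ) + 2) := by positivity
          rw [e, ← mul_assoc]
          refine le_mul_of_one_le_left hs ?_
          rw [← div_eq_mul_inv, one_le_div hp]; exact this
    _ = (1 + 4 * r ^ 2) ^ ((n:ℝ) + 2) * ∫ x in Ar l r, (1 + ‖x‖ ^ 2) ^ (-(n : ℝ) - 2) * ∑ i, (V i x) ^ 2 := integral_const_mul _ _
    _ ≤ _ := by
        refine mul_le_mul_of_nonneg_left ?_ (by positivity)
        exact setIntegral_mono_set hI (ae_of_all _ hnn) hsub.eventuallyLE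

end Part17

section Part18

variable {n : ℕ}

lemma holA (hn : 0 < n) : ∃ ω : ℝ, 0 < ω ∧ ∀ (l : Fin n) (g : Euc n → ENNReal), Measurable g → ∀ t : ℝ, 0 < t →
    (∫⁻ y in An n t ∩ {x : Euc n | 0 ≤ x l}, g y) ^ 2 ≤ ENNReal.ofReal (ω * t ^ (n:ℝ)) * ∫⁻ y in An n t ∩ {x : Euc n | 0 ≤ x l}, g y ^ 2 := by
  obtain ⟨ω, hω, hv⟩ := volA hn
  refine ⟨ω, hω, fun l g hg t ht => ?_⟩
  have h := CS (volume.restrict (An n t ∩ {x : Euc n | 0 ≤ x l})) (a := fun _ => 1) (b := g) (by fun_prop) (by fun_prop)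
  simp only [one_mul, one_pow, lintegral_one, Measure.restrict_apply_univ] at h
  exact h.trans (mul_le_mul_left ((measure_mono Set.inter_subset_left).trans (hv t ht)) _)

lemma annC (l : Fin n) (φ : Euc n → ENNReal) {δ : ℝ} (hδ : 0 < δ) : 
    ∫⁻ y in {y : Euc n | δ ≤ ‖y‖ ∧ ‖y‖ ≤ 2 * δ} ∩ {x : Euc n | 0 ≤ x l}, φ y ≤ 
    (∫⁻ y in An n (δ / 2) ∩ {x : Euc n | 0 ≤ x l}, φ y) + ∫⁻ y in An n δ ∩ {x : Euc n | 0 ≤ x l}, φ y := by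
  refine (lintegral_mono_set ?_).trans (lintegral_union_le _ _ _)
  rintro y ⟨⟨h1, h2⟩, h3⟩
  rcases h1.eq_or_lt with h | h
  · exact .inl ⟨⟨by linarith, by linarith⟩, h3⟩
  · exact .inr ⟨⟨h, h2⟩, h3⟩

lemma Y2 (hn : 0 < n) {δ : ℝ} (hδ : 0 < δ) : ∃ Q : ℝ, 0 < Q ∧ ∀ (l : Fin n) (V : Fin n → Euc n → ℝ) (F : Fin n → Fin n → Euc n → ℝ),
    WF l (Kvi V) F → (∀ i, ContDiff ℝ (⊤ : ℕ∞) (V i)) →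
    IntegrableOn (fun x : Euc n => (1 + ‖x‖ ^ 2) ^ (-(n : ℝ) - 2) * ∑ i, (V i x) ^ 2) {x : Euc n | 0 ≤ x l} →
    ENNReal.ofReal (δ ^ (-(n:ℝ))) ^ 2 * (∫⁻ y in {y : Euc n | δ ≤ ‖y‖ ∧ ‖y‖ ≤ 2 * δ} ∩ {x : Euc n | 0 ≤ x l}, ENNReal.ofReal (gf (Kvi V) y)) ^ 2 ≤ 
    ENNReal.ofReal (Q * ∫ x in {x : Euc n | 0 ≤ x l}, (1 + ‖x‖ ^ 2) ^ (-(n : ℝ) - 2) * ∑ i, (V i x) ^ 2) := by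
  obtain ⟨ω, hω, hh⟩ := holA hn
  have hn' : (0:ℝ) < n := by exact_mod_cast hn
  set q : ℝ → ℝ := fun t => (ω * t ^ (n:ℝ)) * (n * (((2 * t)⁻¹) ^ (2 * n + 4))⁻¹ * (1 + 4 * ((2 * t)⁻¹) ^ 2) ^ ((n:ℝ) + 2)) with hq
  have hq0 : ∀ t, 0 < t → 0 < q t := fun t ht => by simp only [hq]; positivity
  refine ⟨(δ ^ (-(n:ℝ))) ^ 2 * (4 * (q (δ / 2) + q δ)), by have := hq0 (δ / 2) (by positivity); have := hq0 δ hδ; positivity, fun l V F H hV hI => ?_⟩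
  set I := ∫ x in {x : Euc n | 0 ≤ x l}, (1 + ‖x‖ ^ 2) ^ (-(n : ℝ) - 2) * ∑ i, (V i x) ^ 2 with hId
  have hI0 : 0 ≤ I := integral_nonneg fun x => by positivity
  have hgm := meas_gf H
  have hc : Continuous fun x => ∑ i, V i x ^ 2 := by
    have := fun i => (hV i).continuous
    fun_prop
  have key : ∀ t, 0 < t → (∫⁻ y in An n t ∩ {x : Euc n | 0 ≤ x l}, ENNReal.ofReal (gf (Kvi V) y)) ^ 2 ≤ ENNReal.ofReal (q t * I) := by
    intro t ht
    refine (hh l _ (by fun_prop) t ht).trans ?_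
    have hr : 0 < (2 * t)⁻¹ := by positivity
    have := T1 hn l V hr (show 2 * (2 * t)⁻¹ * t = 1 by field_simp)
    rw [Ar_int l _ hc (fun x => Finset.sum_nonneg fun _ _ => sq_nonneg _)] at this
    refine (mul_le_mul_right (this.trans (mul_le_mul_right (ENNReal.ofReal_le_ofReal (PV_I l V hV hr hI)) _)) _).trans (le_of_eq ?_)
    rw [← ENNReal.ofReal_mul (by positivity), ← ENNReal.ofReal_mul (by positivity)]
    congr 1; simp only [hq]; ring
  calc _ ≤ ENNReal.ofReal (δ ^ (-(n:ℝ))) ^ 2 * (4 * (ENNReal.ofReal (q (δ / 2) * I) + ENNReal.ofReal (q δ * I))) := by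
        refine mul_le_mul_right ?_ _
        refine (pow_le_pow_left' (annC l _ hδ) 2).trans ((addsq _ _).trans (mul_le_mul_right (add_le_add (key _ (by positivity)) (key _ hδ)) _))
    _ = _ := by
        have a := hq0 (δ / 2) (by positivity)
        have b := hq0 δ hδ
        rw [← ENNReal.ofReal_add (by positivity) (by positivity), show (4:ENNReal) = ENNReal.ofReal 4 by norm_num, ← ENNReal.ofReal_mul (by norm_num), 
          ← ENNReal.ofReal_pow (by positivity), ← ENNReal.ofReal_mul (by positivity)]
        congr 1; ring

lemma tau0 (hn : 0 < n) {σ : ℝ} (hσ : σ < n - 1) {l : Fin n} {f : Fin n → Euc n → ℝ} {F : Fin n → Fin n → Euc n → ℝ} (H : WF l f F) {a : ℝ} (ha : 0 ≤ a)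
    (hN : ∀ t : ℝ, 0 < t → t ≤ 1 / 2 → ∫⁻ y in An n t ∩ {x : Euc n | 0 ≤ x l}, ENNReal.ofReal (gf f y) ^ 2 ≤ ENNReal.ofReal a * ENNReal.ofReal (t ^ ((n:ℝ) + 2 - 2 * σ))) :
    Filter.Tendsto (fun τ : ℝ => ENNReal.ofReal (τ ^ (-2:ℝ)) * ∫⁻ y in {y : Euc n | τ ≤ ‖y‖ ∧ ‖y‖ ≤ 2 * τ} ∩ {x : Euc n | 0 ≤ x l},
      ENNReal.ofReal (gf f y)) (nhdsWithin 0 (Set.Ioi 0)) (nhds 0) := by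
  obtain ⟨ω, hω, hh⟩ := holA hn
  have hgm := meas_gf H
  set b : ℝ := √(ω * a) with hb
  have hb0 : 0 ≤ b := Real.sqrt_nonneg _
  have key : ∀ t, 0 < t → t ≤ 1 / 2 → ∫⁻ y in An n t ∩ {x : Euc n | 0 ≤ x l}, ENNReal.ofReal (gf f y) ≤ ENNReal.ofReal (b * t ^ ((n:ℝ) + 1 - σ)) := by
    intro t ht ht2
    refine sqle ((hh l _ (by fun_prop) t ht).trans ((mul_le_mul_right (hN t ht ht2) _).trans (le_of_eq ?_)))
    rw [← ENNReal.ofReal_mul ha, ← ENNReal.ofReal_mul (by positivity), ← ENNReal.ofReal_pow (by positivity)]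
    congr 1
    rw [mul_pow, hb, Real.sq_sqrt (by positivity), ← Real.rpow_natCast (t ^ _), ← Real.rpow_mul ht.le]
    have : t ^ (((n:ℝ) + 1 - σ) * (2:ℕ)) = t ^ (n:ℝ) * t ^ ((n:ℝ) + 2 - 2 * σ) := by
      rw [← Real.rpow_add ht]; congr 1; push_cast; ring
    rw [this]; ring
  have hlim : Filter.Tendsto (fun τ : ℝ => ENNReal.ofReal (2 * b * τ ^ ((n:ℝ) - 1 - σ))) (nhdsWithin 0 (Set.Ioi 0)) (nhds 0) := by
    have h0 : ContinuousAt (fun τ : ℝ => ENNReal.ofReal (2 * b * τ ^ ((n:ℝ) - 1 - σ))) 0 := by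
      refine ENNReal.continuous_ofReal.continuousAt.comp (continuousAt_const.mul ?_)
      exact Real.continuousAt_rpow_const _ _ (.inr (by linarith))
    have := h0.tendsto
    rw [Real.zero_rpow (by linarith), mul_zero, ENNReal.ofReal_zero] at this
    exact this.mono_left nhdsWithin_le_nhds
  refine tendsto_of_tendsto_of_tendsto_of_le_of_le' tendsto_const_nhds hlim (Filter.Eventually.of_forall fun _ => bot_le) ?_
  have hev : ∀ᶠ τ : ℝ in nhdsWithin 0 (Set.Ioi 0), τ ∈ Set.Ioo (0:ℝ) (1 / 2) := Ioo_mem_nhdsGT (by norm_num)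
  filter_upwards [hev] with τ hτ
  have hτ0 := hτ.1
  refine (mul_le_mul_right ((annC l _ hτ0).trans (add_le_add (key _ (by positivity) (by linarith [hτ.2])) (key _ hτ0 hτ.2.le))) _).trans ?_
  rw [← ENNReal.ofReal_add (by positivity) (by positivity), ← ENNReal.ofReal_mul (by positivity)]
  refine ENNReal.ofReal_le_ofReal ?_
  have h1 : (τ / 2) ^ ((n:ℝ) + 1 - σ) ≤ τ ^ ((n:ℝ) + 1 - σ) := Real.rpow_le_rpow (by positivity) (by linarith) (by linarith)
  have h2 : τ ^ ((n:ℝ) - 1 - σ) = τ ^ (-2:ℝ) * τ ^ ((n:ℝ) + 1 - σ) := by rw [← Real.rpow_add hτ0]; congr 1; ring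
  rw [h2]
  have h3 : 0 ≤ τ ^ (-2:ℝ) := by positivity
  have : b * (τ / 2) ^ ((n:ℝ) + 1 - σ) + b * τ ^ ((n:ℝ) + 1 - σ) ≤ 2 * b * τ ^ ((n:ℝ) + 1 - σ) := by nlinarith
  nlinarith

lemma FF_van (h : Fin n → Fin n → Euc n → ℝ) (hc : ∀ i k, HasCompactSupport (h i k)) : ∃ t0 : ℝ, 0 < t0 ∧ ∀ y : Euc n, y ≠ 0 → ‖y‖ ≤ t0 → gF (FF h) y = 0 := by
  have hR : ∀ i k, ∃ R : ℝ, ∀ x, R < ‖x‖ → h i k x = 0 := fun i k => by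
    obtain ⟨R, hR⟩ := (hc i k).isCompact.isBounded.subset_closedBall 0
    refine ⟨R, fun x hx => ?_⟩
    by_contra h0
    have := hR (subset_tsupport _ h0)
    rw [mem_closedBall_zero_iff] at this
    linarith
  choose R hR using hR
  set S : ℝ := 1 + ∑ i, ∑ k, |R i k| with hS
  have hS0 : 0 < S := by positivity
  refine ⟨S⁻¹, by positivity, fun y hy hyS => ?_⟩
  have hy' := norm_pos_iff.2 hy
  have hz : ∀ i k, h i k (Jv y) = 0 := fun i k => hR i k _ (by
    rw [norm_Jv]
    have h1 : S ≤ ‖y‖⁻¹ := (le_inv_comm₀ hS0 hy').2 hyS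
    have h2 : |R i k| ≤ ∑ k, |R i k| := Finset.single_le_sum (f := fun k => |R i k|) (fun _ _ => abs_nonneg _) (Finset.mem_univ k)
    have h3 : ∑ k, |R i k| ≤ ∑ i, ∑ k, |R i k| := Finset.single_le_sum (f := fun i => ∑ k, |R i k|) (fun _ _ => Finset.sum_nonneg fun _ _ => abs_nonneg _) (Finset.mem_univ i)
    linarith [le_abs_self (R i k)])
  simp [gF, FF, hz]

end Part18

section Part19

variable {n : ℕ}

lemma rp {r t p q X m : ℝ} {k : ℕ} (hr : 0 < r) (ht : 2 * r * t = 1) (hX : r ^ p * X ≤ m) (hq : q = p + k) :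
    (r ^ k)⁻¹ * X ≤ 2 ^ q * m * t ^ q := by
  have ht0 : 0 < t := by by_contra hc; nlinarith
  have e : 2 * t = r⁻¹ := by field_simp; linarith
  have h1 : X ≤ m * r ^ (-p) := by
    rw [Real.rpow_neg hr.le, ← div_eq_mul_inv, le_div_iff₀ (by positivity), mul_comm]; exact hX
  have h2 : (2:ℝ) ^ q * m * t ^ q = m * r ^ (-q) := by
    rw [mul_right_comm, ← Real.mul_rpow (by norm_num) ht0.le, e, Real.inv_rpow hr.le, Real.rpow_neg hr.le]; ring
  have h3 : r ^ (-q) = (r ^ k)⁻¹ * r ^ (-p) := by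
    rw [← Real.rpow_natCast, ← Real.rpow_neg hr.le, ← Real.rpow_add hr]; congr 1; rw [hq]; ring
  rw [h2, h3]
  calc (r ^ k)⁻¹ * X ≤ (r ^ k)⁻¹ * (m * r ^ (-p)) := by gcongr
    _ = _ := by ring

lemma convN (hn : 0 < n) (l : Fin n) (V : Fin n → Euc n → ℝ) (hV : ∀ i, ContDiff ℝ (⊤ : ℕ∞) (V i)) {σ m : ℝ} (hm0 : 0 ≤ m)
    (hm : ∀ r : ℝ, 1 ≤ r → r ^ (-2 * σ - (n:ℝ) - 2) * ∫ x in Ar l r, ∑ i, V i x ^ 2 ≤ m) (t : ℝ) (ht : 0 < t) (ht2 : t ≤ 1 / 2) :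
    ∫⁻ y in An n t ∩ {x : Euc n | 0 ≤ x l}, ENNReal.ofReal (gf (Kvi V) y) ^ 2 ≤ ENNReal.ofReal (n * 2 ^ ((n:ℝ) + 2 - 2 * σ) * m) * ENNReal.ofReal (t ^ ((n:ℝ) + 2 - 2 * σ)) := by
  have hr : 0 < (2 * t)⁻¹ := by positivity
  have hr1 : 1 ≤ (2 * t)⁻¹ := (one_le_inv₀ (by positivity)).2 (by linarith)
  have h2 : 2 * (2 * t)⁻¹ * t = 1 := by field_simp
  have hc : Continuous fun x => ∑ i, V i x ^ 2 := by
    have := fun i => (hV i).continuous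
    fun_prop
  have := T1 hn l V hr h2
  rw [Ar_int l _ hc (fun x => Finset.sum_nonneg fun _ _ => sq_nonneg _)] at this
  refine this.trans ?_
  rw [← ENNReal.ofReal_mul (by positivity), ← ENNReal.ofReal_mul (by positivity)]
  refine ENNReal.ofReal_le_ofReal ?_
  have := rp (k := 2 * n + 4) hr h2 (hm _ hr1) (q := (n:ℝ) + 2 - 2 * σ) (by push_cast; ring)
  rw [mul_assoc, mul_assoc, mul_assoc]
  refine mul_le_mul_of_nonneg_left (this.trans (le_of_eq (by ring))) (by positivity)

lemma convM (hn : 0 < n) (l : Fin n) (h : Fin n → Fin n → Euc n → ℝ) (hh : ∀ i k, ContDiff ℝ (⊤ : ℕ∞) (h i k)) {σ m : ℝ} (hm0 : 0 ≤ m)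
    (hm : ∀ r : ℝ, 1 ≤ r → r ^ (-2 * σ - (n:ℝ)) * ∫ x in Ar l r, ∑ i, ∑ k, h i k x ^ 2 ≤ m) (t : ℝ) (ht : 0 < t) (ht2 : t ≤ 1 / 2) :
    ∫⁻ y in An n t ∩ {x : Euc n | 0 ≤ x l}, ENNReal.ofReal (gF (FF h) y) ^ 2 ≤ ENNReal.ofReal ((n:ℝ) ^ 6 * 2 ^ ((n:ℝ) - 2 * σ) * m) * ENNReal.ofReal (t ^ ((n:ℝ) - 2 * σ)) := by
  have hr : 0 < (2 * t)⁻¹ := by positivity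
  have hr1 : 1 ≤ (2 * t)⁻¹ := (one_le_inv₀ (by positivity)).2 (by linarith)
  have h2 : 2 * (2 * t)⁻¹ * t = 1 := by field_simp
  have hc : Continuous fun x => ∑ i, ∑ k, h i k x ^ 2 := by
    have := fun i k => (hh i k).continuous
    fun_prop
  have := T2 hn l h hr h2
  rw [Ar_int l _ hc (fun x => Finset.sum_nonneg fun _ _ => Finset.sum_nonneg fun _ _ => sq_nonneg _)] at this
  refine this.trans ?_
  rw [← ENNReal.ofReal_mul (by positivity), ← ENNReal.ofReal_mul (by positivity)]
  refine ENNReal.ofReal_le_ofReal ?_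
  have := rp (k := 2 * n) hr h2 (hm _ hr1) (q := (n:ℝ) - 2 * σ) (by push_cast; ring)
  rw [mul_assoc, mul_assoc, mul_assoc]
  refine mul_le_mul_of_nonneg_left (this.trans (le_of_eq (by ring))) (by positivity)

lemma bddM (l : Fin n) (h : Fin n → Fin n → Euc n → ℝ) (hh : ∀ i k, ContDiff ℝ (⊤ : ℕ∞) (h i k)) (hc : ∀ i k, HasCompactSupport (h i k)) {p : ℝ} (hp : p ≤ 0) :
    BddAbove {y : ℝ | ∃ r : ℝ, 1 ≤ r ∧ y = r ^ p * ∫ x in Ar l r, ∑ i, ∑ k, h i k x ^ 2} := by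
  have hi : Integrable fun x => ∑ i, ∑ k, h i k x ^ 2 := 
    integrable_finsetSum _ fun i _ => integrable_finsetSum _ fun k _ => hcs_int (by have := (hh i k).continuous; fun_prop) (by
      have := (hc i k).mul_left (f := h i k)
      simp only [sq]; exact this)
  have hnn : ∀ x, 0 ≤ ∑ i, ∑ k, h i k x ^ 2 := fun x => Finset.sum_nonneg fun _ _ => Finset.sum_nonneg fun _ _ => sq_nonneg _
  refine ⟨∫ x, ∑ i, ∑ k, h i k x ^ 2, ?_⟩
  rintro y ⟨r, hr, rfl⟩
  have h1 : r ^ p ≤ 1 := Real.rpow_le_one_of_one_le_of_nonpos hr hp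
  have h2 : ∫ x in Ar l r, ∑ i, ∑ k, h i k x ^ 2 ≤ ∫ x, ∑ i, ∑ k, h i k x ^ 2 := setIntegral_le_integral hi (ae_of_all _ hnn)
  have h3 : 0 ≤ ∫ x in Ar l r, ∑ i, ∑ k, h i k x ^ 2 := integral_nonneg hnn
  have h4 : 0 ≤ r ^ p := by positivity
  nlinarith

theorem final (hn : 4 ≤ n) {σ : ℝ} (h1 : 1 < σ) (h2 : σ < (n:ℝ) - 2) : ∃ C : ℝ, 0 < C ∧ ∀ (l : Fin n) (h : Fin n → Fin n → Euc n → ℝ),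
    (∀ i k, ContDiff ℝ (⊤ : ℕ∞) (h i k)) → (∀ i k, HasCompactSupport (h i k)) → ∀ V : Fin n → Euc n → ℝ, (∀ i, ContDiff ℝ (⊤ : ℕ∞) (V i)) →
    WF l (Kvi V) (FF h) →
    IntegrableOn (fun x : Euc n => (1 + ‖x‖ ^ 2) ^ (-(n : ℝ) - 2) * ∑ i, (V i x) ^ 2) {x : Euc n | 0 ≤ x l} →
    BddAbove {y : ℝ | ∃ r : ℝ, 1 ≤ r ∧ y = r ^ (-2 * σ - (n : ℝ) - 2) * ∫ x in Ar l r, ∑ i, (V i x) ^ 2} →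
    sSup {y : ℝ | ∃ r : ℝ, 1 ≤ r ∧ y = r ^ (-2 * σ - (n : ℝ) - 2) * ∫ x in Ar l r, ∑ i, (V i x) ^ 2} ≤
      C * (∫ x in {x : Euc n | 0 ≤ x l}, (1 + ‖x‖ ^ 2) ^ (-(n : ℝ) - 2) * ∑ i, (V i x) ^ 2) +
      C * sSup {y : ℝ | ∃ r : ℝ, 1 ≤ r ∧ y = r ^ (-2 * σ - (n : ℝ)) * ∫ x in Ar l r, ∑ i, ∑ k, (h i k x) ^ 2} := by
  have hn0 : 0 < n := by omega
  have hnr : (0:ℝ) < n := by exact_mod_cast hn0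
  obtain ⟨C1, hC1, hcore⟩ := core hn h1 (by linarith : σ < n)
  set aV : ℝ := n * 2 ^ ((n:ℝ) + 2 - 2 * σ) with haV
  set ah : ℝ := (n:ℝ) ^ 6 * 2 ^ ((n:ℝ) - 2 * σ) with hah
  have haV0 : 0 < aV := by positivity
  have hah0 : 0 < ah := by positivity
  set P : ℝ := 2 ^ (2 * σ + n + 2) * C1 with hP
  have hP0 : 0 < P := by positivity
  set δ : ℝ := min (1 / 4) (1 / (2 * P * aV)) with hδd
  have hδ : 0 < δ := by positivity
  have hδ4 : δ ≤ 1 / 4 := min_le_left _ _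
  have hδP : P * aV * δ ^ 4 ≤ 1 / 2 := by
    have e1 : δ ≤ 1 / (2 * P * aV) := min_le_right _ _
    have e2 : δ ^ 4 ≤ δ := by
      have := pow_le_of_le_one hδ.le (by linarith : δ ≤ 1) (n := 4) (by norm_num); exact this
    calc P * aV * δ ^ 4 ≤ P * aV * (1 / (2 * P * aV)) := by gcongr; exact e2.trans e1
      _ = 1 / 2 := by field_simp
  obtain ⟨Q, hQ, hY⟩ := Y2 hn0 hδ
  set Q2 : ℝ := (1 + 4 * (2 / δ) ^ 2) ^ ((n:ℝ) + 2) with hQ2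
  have hQ20 : 0 < Q2 := by positivity
  refine ⟨2 * (P * ah) + 2 * (P * Q + Q2), by positivity, fun l h hh hhc V hV H hI hB => ?_⟩
  set SV := {y : ℝ | ∃ r : ℝ, 1 ≤ r ∧ y = r ^ (-2 * σ - (n : ℝ) - 2) * ∫ x in Ar l r, ∑ i, (V i x) ^ 2} with hSV
  set SH := {y : ℝ | ∃ r : ℝ, 1 ≤ r ∧ y = r ^ (-2 * σ - (n : ℝ)) * ∫ x in Ar l r, ∑ i, ∑ k, (h i k x) ^ 2} with hSH
  set I := ∫ x in {x : Euc n | 0 ≤ x l}, (1 + ‖x‖ ^ 2) ^ (-(n : ℝ) - 2) * ∑ i, (V i x) ^ 2 with hId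
  have hI0 : 0 ≤ I := integral_nonneg fun x => by positivity
  have hBH : BddAbove SH := bddM l h hh hhc (by linarith)
  have hm : ∀ r : ℝ, 1 ≤ r → r ^ (-2 * σ - (n:ℝ)) * ∫ x in Ar l r, ∑ i, ∑ k, h i k x ^ 2 ≤ sSup SH := fun r hr => le_csSup hBH ⟨r, hr, rfl⟩
  have hv : ∀ r : ℝ, 1 ≤ r → r ^ (-2 * σ - (n:ℝ) - 2) * ∫ x in Ar l r, ∑ i, V i x ^ 2 ≤ sSup SV := fun r hr => le_csSup hB ⟨r, hr, rfl⟩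
  have hm0 : 0 ≤ sSup SH := le_trans (mul_nonneg (by positivity) (integral_nonneg fun x => Finset.sum_nonneg fun _ _ => Finset.sum_nonneg fun _ _ => sq_nonneg _)) (hm 1 le_rfl)
  have hv0 : 0 ≤ sSup SV := le_trans (mul_nonneg (by positivity) (integral_nonneg fun x => Finset.sum_nonneg fun _ _ => sq_nonneg _)) (hv 1 le_rfl)
  set nv := sSup SV with hnv
  set mh := sSup SH with hmh
  have hN := convN hn0 l V hV hv0 hv
  have hM := convM hn0 l h hh hm0 hm
  have hτ := tau0 hn0 (by linarith : σ < n - 1) H (by positivity) hN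
  have hco := hcore l (Kvi V) (FF h) H (FF_van h hhc) hτ δ hδ (by linarith) _ _ (fun t ht ht2 => hM t ht (by linarith)) (fun t ht ht2 => hN t ht (by linarith))
  have hY' := hY l V (FF h) H hV hI
  have hmain : nv ≤ P * ah * mh + 1 / 2 * nv + (P * Q + Q2) * I := by
    refine csSup_le ⟨_, 1, le_rfl, rfl⟩ ?_
    rintro y ⟨r, hr, rfl⟩
    have hr0 : 0 < r := by linarith
    rcases lt_or_ge r (2 / δ) with hlt | hge
    · have e1 := PV_I l V hV hr0 hI
      have e2 : r ^ (-2 * σ - (n:ℝ) - 2) ≤ 1 := Real.rpow_le_one_of_one_le_of_nonpos hr (by linarith)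
      have e3 : (1 + 4 * r ^ 2) ^ ((n:ℝ) + 2) ≤ Q2 := by
        refine Real.rpow_le_rpow (by positivity) ?_ (by positivity)
        gcongr
      have e4 : 0 ≤ ∫ x in Ar l r, ∑ i, V i x ^ 2 := integral_nonneg fun x => Finset.sum_nonneg fun _ _ => sq_nonneg _
      have e5 : 0 ≤ P * ah * mh + 1 / 2 * nv + P * Q * I := by positivity
      calc r ^ (-2 * σ - (n:ℝ) - 2) * ∫ x in Ar l r, ∑ i, V i x ^ 2 ≤ 1 * ∫ x in Ar l r, ∑ i, V i x ^ 2 := mul_le_mul_of_nonneg_right e2 e4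
        _ ≤ Q2 * I := by rw [one_mul]; exact e1.trans (mul_le_mul_of_nonneg_right e3 hI0)
        _ ≤ _ := by linarith
    · set s : ℝ := (2 * r)⁻¹ with hs
      have hs0 : 0 < s := by positivity
      have hrs : 2 * r * s = 1 := by rw [hs]; field_simp
      have hsδ : 4 * s ≤ δ := by
        rw [div_le_iff₀ hδ] at hge
        nlinarith
      have e1 := T3 hn0 l V hr0 hrs
      have hc : Continuous fun x => ∑ i, V i x ^ 2 := by
        have := fun i => (hV i).continuous
        fun_prop
      rw [Ar_int l _ hc (fun x => Finset.sum_nonneg fun _ _ => sq_nonneg _)] at e1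
      have e2 := e1.trans (mul_le_mul_right ((hco s hs0 hsδ).trans (mul_le_mul_left (mul_le_mul_right (add_le_add_right hY' _) _) _)) _)
      rw [← ENNReal.ofReal_mul (by positivity), ← ENNReal.ofReal_add (by positivity) (by positivity), ← ENNReal.ofReal_add (by positivity) (by positivity),
        ← ENNReal.ofReal_mul (by positivity), ← ENNReal.ofReal_mul (by positivity), ← ENNReal.ofReal_mul (by positivity), ENNReal.ofReal_le_ofReal_iff (by positivity)] at e2
      have e3 : r ^ (-2 * σ - (n:ℝ) - 2) = 2 ^ (2 * σ + n + 2) * s ^ (2 * σ + n + 2) := by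
        rw [← Real.mul_rpow (by norm_num) hs0.le, show 2 * s = r⁻¹ by rw [hs]; field_simp, Real.inv_rpow hr0.le, ← Real.rpow_neg hr0.le]
        congr 1; ring
      have e4 : s ^ (2 * σ + n + 2) * ((s ^ (2 * n + 4))⁻¹ * s ^ ((n:ℝ) + 2 - 2 * σ)) = 1 := by
        rw [← Real.rpow_natCast, ← Real.rpow_neg hs0.le, ← Real.rpow_add hs0, ← Real.rpow_add hs0]
        rw [← Real.rpow_zero s]; congr 1; push_cast; ring
      have hPQ : 0 ≤ Q2 * I := by positivity
      calc r ^ (-2 * σ - (n:ℝ) - 2) * ∫ x in Ar l r, ∑ i, V i x ^ 2 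
          ≤ r ^ (-2 * σ - (n:ℝ) - 2) * ((s ^ (2 * n + 4))⁻¹ * (C1 * (ah * mh + δ ^ 4 * (aV * nv) + Q * I) * s ^ ((n:ℝ) + 2 - 2 * σ))) := by gcongr
        _ = P * (ah * mh + δ ^ 4 * (aV * nv) + Q * I) * (s ^ (2 * σ + n + 2) * ((s ^ (2 * n + 4))⁻¹ * s ^ ((n:ℝ) + 2 - 2 * σ))) := by rw [e3, hP]; ring
        _ = P * ah * mh + (P * aV * δ ^ 4) * nv + P * Q * I := by rw [e4]; ring
        _ ≤ P * ah * mh + 1 / 2 * nv + (P * Q + Q2) * I := by nlinarith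
  have hx1 : 0 ≤ P * ah * I := by positivity
  have hx2 : 0 ≤ (P * Q + Q2) * mh := by positivity
  nlinarith

end Part19

/-- the weighted estimate for `V` (Proposition `weighted.estimate`). -/
theorem statement14 (n : ℕ) (hn : 4 ≤ n) (l₀ : Fin n) (hl₀ : (l₀ : ℕ) = n - 1)
    (σ : ℝ) (hσ1 : 1 < σ) (hσ2 : σ < (n : ℝ) - 2) :
    ∃ C : ℝ, 0 < C ∧
      ∀ (h : Fin n → Fin n → Euc n → ℝ),
        (∀ i k, ContDiff ℝ (⊤ : ℕ∞) (h i k)) →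
        (∀ i k, HasCompactSupport (h i k)) →
        (∀ i k x, h i k x = h k i x) →
        (∀ x, ∑ i, h i i x = 0) →
      ∀ V : Fin n → Euc n → ℝ, (∀ i, ContDiff ℝ (⊤ : ℕ∞) (V i)) →
        (∀ x : Euc n, 0 ≤ x l₀ → ∀ i,
          ∑ k, pd k (fun y => u0 n y ^ (2 * (n : ℝ) / ((n : ℝ) - 2))
            * (h i k y - pd i (V k) y - pd k (V i) y
                + (2 / (n : ℝ)) * (∑ m, pd m (V m) y) * kd i k)) x = 0) →
        (∀ x : Euc n, x l₀ = 0 →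
          V l₀ x = 0 ∧ ∀ i, i ≠ l₀ → pd l₀ (V i) x = h i l₀ x) →
        MeasureTheory.IntegrableOn
          (fun x : Euc n => (1 + ‖x‖ ^ 2) ^ (-(n : ℝ) - 2) * ∑ i, (V i x) ^ 2)
          {x : Euc n | 0 ≤ x l₀} →
        MeasureTheory.IntegrableOn
          (fun x : Euc n => (1 + ‖x‖ ^ 2) ^ (-(n : ℝ)) * ∑ i, ∑ k, (pd k (V i) x) ^ 2)
          {x : Euc n | 0 ≤ x l₀} →
        BddAbove {y : ℝ | ∃ r : ℝ, 1 ≤ r ∧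
          y = r ^ (-2 * σ - (n : ℝ) - 2)
            * ∫ x in (Metric.ball (0 : Euc n) (2 * r) \ Metric.ball (0 : Euc n) r)
                ∩ {x : Euc n | 0 ≤ x l₀}, ∑ i, (V i x) ^ 2} →
        sSup {y : ℝ | ∃ r : ℝ, 1 ≤ r ∧
            y = r ^ (-2 * σ - (n : ℝ) - 2)
              * ∫ x in (Metric.ball (0 : Euc n) (2 * r) \ Metric.ball (0 : Euc n) r)
                  ∩ {x : Euc n | 0 ≤ x l₀}, ∑ i, (V i x) ^ 2}
          ≤ C * (∫ x in {x : Euc n | 0 ≤ x l₀},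
                (1 + ‖x‖ ^ 2) ^ (-(n : ℝ) - 2) * ∑ i, (V i x) ^ 2)
            + C * sSup {y : ℝ | ∃ r : ℝ, 1 ≤ r ∧
                y = r ^ (-2 * σ - (n : ℝ))
                  * ∫ x in (Metric.ball (0 : Euc n) (2 * r) \ Metric.ball (0 : Euc n) r)
                      ∩ {x : Euc n | 0 ≤ x l₀}, ∑ i, ∑ k, (h i k x) ^ 2} := by
  obtain ⟨C, hC, hf⟩ := final hn hσ1 hσ2
  refine ⟨C, hC, fun h hh hc hs ht V hV he hb hI _ hB => ?_⟩
  exact hf l₀ h hh hc V hV (WF_of hn l₀ h hh hs ht V hV he hb) hI hB
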